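/- Let A be a negative square-free integer with A ≡ 1 or 25 (mod 36), and let D be a square-free integer coprime to A with D ≡ 1 (mod 12). Then rank E_D(ℚ) ≤ 1 + 2·dim_{𝔽₃} Cl(ℚ(√(−A·D)))[3], where Cl(ℚ(√(−A·D)))[3] is the 3-torsion subgroup of the ideal class group of the real quadratic field ℚ(√(−A·D)), viewed as a vector space over the field with 3 elements. -/

import Mathlib

open IntermediateField

/-- The Mordell curve `y² = x³ + a` as a Weierstrass curve over `ℚ`. -/
noncomputable def MordellCurve (a : ℤ) : WeierstrassCurve ℚ :=
  { a₁ := 0, a₂ := 0, a₃ := 0, a₄ := 0, a₆ := (a : ℚ) }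

/-- The Mordell–Weil rank of `y² = x³ + a` over `ℚ`. -/
noncomputable def mordellRank (a : ℤ) : ℕ :=
  Module.finrank ℤ (MordellCurve a).toAffine.Point

namespace MRank

open WeierstrassCurve

/-- the group of points -/
abbrev Pt (k : ℤ) := (MordellCurve k).toAffine.Point

/-- `P` is the affine point `(x, y)` -/
def IsPt {k : ℤ} (P : Pt k) (x y : ℚ) : Prop := ∃ h, P = Affine.Point.some x y h

lemma equation_iff {k : ℤ} {x y : ℚ} :
    (MordellCurve k).toAffine.Equation x y ↔ y ^ 2 = x ^ 3 + k := by
  rw [Affine.equation_iff]; simp [MordellCurve]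

lemma nonsingular_of {k : ℤ} (hk : k ≠ 0) {x y : ℚ} (h : y ^ 2 = x ^ 3 + k) :
    (MordellCurve k).toAffine.Nonsingular x y := by
  rw [Affine.nonsingular_iff]
  refine ⟨equation_iff.2 h, ?_⟩
  simp only [MordellCurve]
  by_contra hh
  push Not at hh
  obtain ⟨h1, h2⟩ := hh
  have hy : y = 0 := by linarith
  have hx : x ^ 2 = 0 := by linarith
  have hx : x = 0 := by simpa using hx
  subst hx hy
  apply hk
  have : (k : ℚ) = 0 := by linarith
  exact_mod_cast this

lemma IsPt.eq {k : ℤ} {P : Pt k} {x y : ℚ} (h : IsPt P x y) : y ^ 2 = x ^ 3 + k := by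
  obtain ⟨h, -⟩ := h
  exact equation_iff.1 h.1

lemma exists_isPt {k : ℤ} (hk : k ≠ 0) {x y : ℚ} (h : y ^ 2 = x ^ 3 + k) :
    ∃ P : Pt k, IsPt P x y := ⟨_, nonsingular_of hk h, rfl⟩

lemma exists_coords {k : ℤ} {P : Pt k} (h : P ≠ 0) : ∃ x y, IsPt P x y := by
  cases P with
  | zero => exact absurd rfl h
  | some x y h' => exact ⟨x, y, h', rfl⟩

lemma IsPt.ne_zero {k : ℤ} {P : Pt k} {x y : ℚ} (h : IsPt P x y) : P ≠ 0 := by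
  obtain ⟨h, rfl⟩ := h
  exact Affine.Point.some_ne_zero h

lemma IsPt.unique {k : ℤ} {P : Pt k} {x y x' y' : ℚ} (h : IsPt P x y) (h' : IsPt P x' y') :
    x = x' ∧ y = y' := by
  obtain ⟨h, rfl⟩ := h
  obtain ⟨h', e⟩ := h'
  simpa using e

lemma IsPt.inj {k : ℤ} {P Q : Pt k} {x y : ℚ} (h : IsPt P x y) (h' : IsPt Q x y) : P = Q := by
  obtain ⟨h, rfl⟩ := h
  obtain ⟨h', rfl⟩ := h'
  rfl

lemma negY_eq {k : ℤ} (x y : ℚ) : (MordellCurve k).toAffine.negY x y = -y := by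
  simp [Affine.negY, MordellCurve]

lemma IsPt.neg {k : ℤ} {P : Pt k} {x y : ℚ} (h : IsPt P x y) : IsPt (-P) x (-y) := by
  obtain ⟨h, rfl⟩ := h
  rw [Affine.Point.neg_some]
  have := negY_eq (k := k) x y
  exact ⟨by rw [← this]; exact (Affine.nonsingular_neg ..).2 h, by congr⟩

lemma add_eq_zero_iff' {k : ℤ} {P Q : Pt k} {x₁ y₁ x₂ y₂ : ℚ} (hP : IsPt P x₁ y₁)
    (hQ : IsPt Q x₂ y₂) : P + Q = 0 ↔ x₁ = x₂ ∧ y₁ = -y₂ := by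
  rw [add_eq_zero_iff_eq_neg]
  constructor
  · rintro rfl
    exact hP.unique hQ.neg
  · rintro ⟨rfl, rfl⟩
    exact hP.inj hQ.neg

/-- Chord-tangent law in Vieta form. -/
lemma vieta {k : ℤ} {P Q : Pt k} {x₁ y₁ x₂ y₂ x₃ y₃ : ℚ} (hP : IsPt P x₁ y₁)
    (hQ : IsPt Q x₂ y₂) (hR : IsPt (P + Q) x₃ y₃) :
    ∃ l m : ℚ, y₁ = l * x₁ + m ∧ y₂ = l * x₂ + m ∧ -y₃ = l * x₃ + m ∧
      x₁ + x₂ + x₃ = l ^ 2 ∧ x₁ * x₂ + x₁ * x₃ + x₂ * x₃ = -2 * l * m ∧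
      x₁ * x₂ * x₃ = m ^ 2 - k := by
  have hne : ¬ (x₁ = x₂ ∧ y₁ = -y₂) := by
    rw [← add_eq_zero_iff' hP hQ]; exact hR.ne_zero
  have e1 := hP.eq
  have e2 := hQ.eq
  obtain ⟨h₁, rfl⟩ := hP
  obtain ⟨h₂, rfl⟩ := hQ
  have hxy : ¬(x₁ = x₂ ∧ y₁ = (MordellCurve k).toAffine.negY x₂ y₂) := by rwa [negY_eq]
  rw [Affine.Point.add_some hxy] at hR
  have hadd := Affine.addPolynomial_slope h₁.1 h₂.1 hxy
  obtain ⟨h₃, hR⟩ := hR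
  rw [Affine.Point.some.injEq] at hR
  obtain ⟨ex, ey⟩ := hR
  rw [ex] at hadd
  have ex := ex.symm
  have ey := ey.symm
  generalize hl : (MordellCurve k).toAffine.slope x₁ x₂ y₁ y₂ = l at *
  have ex' : x₃ = l ^ 2 - x₁ - x₂ := by
    rw [ex]; simp [Affine.addX, MordellCurve]
  have ey' : y₃ = -(l * (x₃ - x₁) + y₁) := by
    rw [ey, Affine.addY, negY_eq, Affine.negAddY, ← ex]
  have a0 := congrArg (Polynomial.eval 0) hadd
  have a1 := congrArg (Polynomial.eval 1) hadd
  rw [Affine.addPolynomial_eq] at a0 a1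
  simp [Cubic.toPoly, MordellCurve] at a0 a1
  refine ⟨l, y₁ - l * x₁, by ring, ?_, by rw [ey']; ring, by rw [ex']; ring, ?_, ?_⟩
  · by_cases hx : x₁ = x₂
    · subst hx
      have : (y₂ - y₁) * (y₂ + y₁) = 0 := by linear_combination e2 - e1
      rcases mul_eq_zero.1 this with h | h
      · linarith
      · exact absurd ⟨rfl, by linarith⟩ hne
    · rw [← hl, Affine.slope_of_X_ne hx]
      have : x₁ - x₂ ≠ 0 := sub_ne_zero.2 hx
      field_simp; ring
  · linear_combination a1 - a0 + ex'
  · linear_combination -a0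

lemma add_eq_of_vieta {k : ℤ} (hk : k ≠ 0) {P Q R : Pt k} {x₁ y₁ x₂ y₂ x₃ y₃ l m : ℚ}
    (hP : IsPt P x₁ y₁) (hQ : IsPt Q x₂ y₂) (hR : IsPt R x₃ y₃)
    (l₁ : y₁ = l * x₁ + m) (l₂ : y₂ = l * x₂ + m) (l₃ : -y₃ = l * x₃ + m)
    (v₁ : x₁ + x₂ + x₃ = l ^ 2) (v₂ : x₁ * x₂ + x₁ * x₃ + x₂ * x₃ = -2 * l * m)
    (v₃ : x₁ * x₂ * x₃ = m ^ 2 - k) : P + Q = R := by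
  have e1 := hP.eq
  have e2 := hQ.eq
  have hkQ : (k : ℚ) ≠ 0 := by exact_mod_cast hk
  have hne : P + Q ≠ 0 := by
    rw [Ne, add_eq_zero_iff' hP hQ]
    rintro ⟨rfl, h⟩
    have hy : y₂ = 0 := by linarith
    have hy1 : y₁ = 0 := by linarith
    have : 3 * x₁ ^ 2 = 0 := by
      have hm : m = - l * x₁ := by linarith
      subst hm
      have : x₃ = l ^ 2 - 2 * x₁ := by linarith
      subst this
      linarith
    have : x₁ = 0 := by simpa using this
    subst this hy1
    apply hkQ; linarith
  obtain ⟨x, y, hS⟩ := exists_coords hne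
  obtain ⟨l', m', b₁, b₂, b₃, w₁, w₂, w₃⟩ := vieta hP hQ hS
  have hll : l = l' := by
    by_cases hx : x₁ = x₂
    · subst hx
      have hy : y₁ ≠ 0 := by
        intro hy
        apply hne
        rw [add_eq_zero_iff' hP hQ]
        refine ⟨rfl, ?_⟩
        have : y₂ = y₁ := by linarith
        rw [this, hy]; simp
      have A : 3 * x₁ ^ 2 = 2 * l * y₁ := by
        rw [l₁]; linear_combination 2 * x₁ * v₁ - v₂
      have B : 3 * x₁ ^ 2 = 2 * l' * y₁ := by
        rw [b₁]; linear_combination 2 * x₁ * w₁ - w₂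
      have : (l - l') * (2 * y₁) = 0 := by linarith
      rcases mul_eq_zero.1 this with h | h
      · linarith
      · exact absurd (by linarith) hy
    · have : (l - l') * (x₁ - x₂) = 0 := by linear_combination -l₁ + l₂ + b₁ - b₂
      rcases mul_eq_zero.1 this with h | h
      · linarith
      · exact absurd (by linarith) hx
  subst hll
  have hm : m = m' := by linarith
  subst hm
  have hx : x = x₃ := by linarith
  subst hx
  have hy : y = y₃ := by linarith
  subst hy
  exact hS.inj hR

end MRank

namespace MRank

/-- the defining property of a 3-isogeny `Pt k → Pt l` -/
def IsIsog {k l : ℤ} (u : ℚ) (f : Pt k →+ Pt l) : Prop :=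
  ∀ P x y, IsPt P x y → IsPt (f P) ((x ^ 3 + 4 * k) / (u ^ 2 * x ^ 2))
    (y * (x ^ 3 - 8 * k) / (u ^ 3 * x ^ 3))

lemma x_ne_zero {k : ℤ} (hk : ¬ IsSquare (k : ℚ)) {P : Pt k} {x y : ℚ} (h : IsPt P x y) :
    x ≠ 0 := by
  rintro rfl
  exact hk ⟨y, by have := h.eq; linarith⟩

section
variable {x₁ x₂ x₃ l m k : ℚ}

lemma sum_X (h1 : x₁ ≠ 0) (h2 : x₂ ≠ 0) (h3 : x₃ ≠ 0)
    (v₁ : x₁ + x₂ + x₃ = l ^ 2) (v₂ : x₁ * x₂ + x₁ * x₃ + x₂ * x₃ = -2 * l * m)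
    (v₃ : x₁ * x₂ * x₃ = m ^ 2 - k) :
    (x₁ ^ 3 + 4 * k) / x₁ ^ 2 + (x₂ ^ 3 + 4 * k) / x₂ ^ 2 + (x₃ ^ 3 + 4 * k) / x₃ ^ 2
      = (l * (m ^ 2 + 3 * k) / (m ^ 2 - k)) ^ 2 := by
  have hm : m ^ 2 - k ≠ 0 := by rw [← v₃]; positivity
  have : (x₁ ^ 3 + 4 * k) / x₁ ^ 2 + (x₂ ^ 3 + 4 * k) / x₂ ^ 2 + (x₃ ^ 3 + 4 * k) / x₃ ^ 2
      = (x₁ + x₂ + x₃) + 4 * k * ((x₁ * x₂ + x₁ * x₃ + x₂ * x₃) ^ 2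
        - 2 * (x₁ + x₂ + x₃) * (x₁ * x₂ * x₃)) / (x₁ * x₂ * x₃) ^ 2 := by
    field_simp; ring
  rw [this, v₁, v₂, v₃]
  field_simp; ring

lemma sum_XX (h1 : x₁ ≠ 0) (h2 : x₂ ≠ 0) (h3 : x₃ ≠ 0)
    (v₁ : x₁ + x₂ + x₃ = l ^ 2) (v₂ : x₁ * x₂ + x₁ * x₃ + x₂ * x₃ = -2 * l * m)
    (v₃ : x₁ * x₂ * x₃ = m ^ 2 - k) :
    (x₁ ^ 3 + 4 * k) / x₁ ^ 2 * ((x₂ ^ 3 + 4 * k) / x₂ ^ 2)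
      + (x₁ ^ 3 + 4 * k) / x₁ ^ 2 * ((x₃ ^ 3 + 4 * k) / x₃ ^ 2)
      + (x₂ ^ 3 + 4 * k) / x₂ ^ 2 * ((x₃ ^ 3 + 4 * k) / x₃ ^ 2)
      = -2 * (l * (m ^ 2 + 3 * k) / (m ^ 2 - k)) * ((m * (m ^ 2 - 9 * k) - 4 * l ^ 3 * k) / (m ^ 2 - k)) := by
  have hm : m ^ 2 - k ≠ 0 := by rw [← v₃]; positivity
  have : (x₁ ^ 3 + 4 * k) / x₁ ^ 2 * ((x₂ ^ 3 + 4 * k) / x₂ ^ 2)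
      + (x₁ ^ 3 + 4 * k) / x₁ ^ 2 * ((x₃ ^ 3 + 4 * k) / x₃ ^ 2)
      + (x₂ ^ 3 + 4 * k) / x₂ ^ 2 * ((x₃ ^ 3 + 4 * k) / x₃ ^ 2)
      = ((x₁ * x₂ * x₃) ^ 2 * (x₁ * x₂ + x₁ * x₃ + x₂ * x₃) + 4 * k *
        ((x₁ + x₂ + x₃) * (x₁ * x₂ + x₁ * x₃ + x₂ * x₃) ^ 2
          - 2 * (x₁ + x₂ + x₃) ^ 2 * (x₁ * x₂ * x₃)
          - (x₁ * x₂ + x₁ * x₃ + x₂ * x₃) * (x₁ * x₂ * x₃))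
        + 16 * k ^ 2 * ((x₁ + x₂ + x₃) ^ 2 - 2 * (x₁ * x₂ + x₁ * x₃ + x₂ * x₃)))
        / (x₁ * x₂ * x₃) ^ 2 := by
    field_simp; ring
  rw [this, v₁, v₂, v₃]
  field_simp; ring

lemma prod_X (h1 : x₁ ≠ 0) (h2 : x₂ ≠ 0) (h3 : x₃ ≠ 0)
    (v₁ : x₁ + x₂ + x₃ = l ^ 2) (v₂ : x₁ * x₂ + x₁ * x₃ + x₂ * x₃ = -2 * l * m)
    (v₃ : x₁ * x₂ * x₃ = m ^ 2 - k) :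
    (x₁ ^ 3 + 4 * k) / x₁ ^ 2 * ((x₂ ^ 3 + 4 * k) / x₂ ^ 2) * ((x₃ ^ 3 + 4 * k) / x₃ ^ 2)
      = ((m * (m ^ 2 - 9 * k) - 4 * l ^ 3 * k) / (m ^ 2 - k)) ^ 2 + 27 * k := by
  have hm : m ^ 2 - k ≠ 0 := by rw [← v₃]; positivity
  have : (x₁ ^ 3 + 4 * k) / x₁ ^ 2 * ((x₂ ^ 3 + 4 * k) / x₂ ^ 2) * ((x₃ ^ 3 + 4 * k) / x₃ ^ 2)
      = ((x₁ * x₂ * x₃) ^ 3 + 4 * k *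
        ((x₁ * x₂ + x₁ * x₃ + x₂ * x₃) ^ 3
          - 3 * (x₁ + x₂ + x₃) * (x₁ * x₂ + x₁ * x₃ + x₂ * x₃) * (x₁ * x₂ * x₃)
          + 3 * (x₁ * x₂ * x₃) ^ 2)
        + 16 * k ^ 2 * ((x₁ + x₂ + x₃) ^ 3
          - 3 * (x₁ + x₂ + x₃) * (x₁ * x₂ + x₁ * x₃ + x₂ * x₃) + 3 * (x₁ * x₂ * x₃))
        + 64 * k ^ 3)
        / (x₁ * x₂ * x₃) ^ 2 := by
    field_simp; ring
  rw [this, v₁, v₂, v₃]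
  field_simp; ring

lemma line_X {x y : ℚ} (hx : x ≠ 0) (hm : m ^ 2 - k ≠ 0) (hy : y ^ 2 = x ^ 3 + k)
    (hl : y = l * x + m) : y * (x ^ 3 - 8 * k) / x ^ 3 =
      (l * (m ^ 2 + 3 * k) / (m ^ 2 - k)) * ((x ^ 3 + 4 * k) / x ^ 2)
        + (m * (m ^ 2 - 9 * k) - 4 * l ^ 3 * k) / (m ^ 2 - k) := by
  have key : y * (x ^ 3 - 8 * k) * (m ^ 2 - k) =
      l * (m ^ 2 + 3 * k) * (x ^ 3 + 4 * k) * x + (m * (m ^ 2 - 9 * k) - 4 * l ^ 3 * k) * x ^ 3 := by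
    subst hl
    obtain rfl : k = (l * x + m) ^ 2 - x ^ 3 := by linarith
    ring
  field_simp
  linear_combination key
end

theorem exists_isog {k l : ℤ} {u : ℚ} (hu : u ≠ 0) (hkl : (l : ℚ) * u ^ 6 = -27 * k)
    (hk : ¬ IsSquare (k : ℚ)) : ∃ f : Pt k →+ Pt l, IsIsog u f := by
  have hk0 : (k : ℚ) ≠ 0 := by
    intro h; apply hk; rw [h]; exact ⟨0, by simp⟩
  have hl0 : l ≠ 0 := by
    rintro rfl
    apply hk0; simp at hkl; simpa using hkl
  have hex : ∀ P : Pt k, ∃ Q : Pt l, (P = 0 → Q = 0) ∧ ∀ x y, IsPt P x y →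
      IsPt Q ((x ^ 3 + 4 * k) / (u ^ 2 * x ^ 2)) (y * (x ^ 3 - 8 * k) / (u ^ 3 * x ^ 3)) := by
    intro P
    by_cases hP : P = 0
    · exact ⟨0, fun _ => rfl, fun x y h => absurd hP h.ne_zero⟩
    · obtain ⟨x, y, h⟩ := exists_coords hP
      have hx := x_ne_zero hk h
      have e := h.eq
      have hl : (l : ℚ) = -27 * k / u ^ 6 := by field_simp; linarith
      obtain ⟨Q, hQ⟩ := exists_isPt hl0 (x := (x ^ 3 + 4 * k) / (u ^ 2 * x ^ 2))
        (y := y * (x ^ 3 - 8 * k) / (u ^ 3 * x ^ 3)) (by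
          rw [hl, div_pow, mul_pow, e]; field_simp; ring)
      refine ⟨Q, fun h => absurd h hP, fun x' y' h' => ?_⟩
      obtain ⟨rfl, rfl⟩ := h.unique h'
      exact hQ
  choose f hf0 hf using hex
  refine ⟨AddMonoidHom.mk' f ?_, hf⟩
  intro P Q
  by_cases hP : P = 0
  · rw [hf0 P hP, hP]; simp
  by_cases hQ : Q = 0
  · rw [hf0 Q hQ, hQ]; simp
  obtain ⟨x₁, y₁, h₁⟩ := exists_coords hP
  obtain ⟨x₂, y₂, h₂⟩ := exists_coords hQ
  by_cases hS : P + Q = 0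
  · rw [hf0 _ hS]
    obtain ⟨rfl, rfl⟩ := (add_eq_zero_iff' h₁ h₂).1 hS
    symm
    rw [add_eq_zero_iff' (hf _ _ _ h₁) (hf _ _ _ h₂)]
    exact ⟨rfl, by ring⟩
  obtain ⟨x₃, y₃, h₃⟩ := exists_coords hS
  obtain ⟨l', m, l₁, l₂, l₃, v₁, v₂, v₃⟩ := vieta h₁ h₂ h₃
  have n1 := x_ne_zero hk h₁
  have n2 := x_ne_zero hk h₂
  have n3 := x_ne_zero hk h₃
  have hm : m ^ 2 - (k : ℚ) ≠ 0 := by rw [← v₃]; positivity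
  have a1 := line_X n1 hm h₁.eq l₁
  have a2 := line_X n2 hm h₂.eq l₂
  have a3 := line_X n3 hm h₃.neg.eq l₃
  have s1 := sum_X n1 n2 n3 v₁ v₂ v₃
  have s2 := sum_XX n1 n2 n3 v₁ v₂ v₃
  have s3 := prod_X n1 n2 n3 v₁ v₂ v₃
  have hl : (l : ℚ) = -27 * k / u ^ 6 := by field_simp; linarith
  symm
  set L := (l' * (m ^ 2 + 3 * k) / (m ^ 2 - k))
  set M := (m * (m ^ 2 - 9 * k) - 4 * l' ^ 3 * k) / (m ^ 2 - k)
  have cx : ∀ x : ℚ, (x ^ 3 + 4 * k) / (u ^ 2 * x ^ 2) = ((x ^ 3 + 4 * k) / x ^ 2) / u ^ 2 := by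
    intro x; rw [div_div]; ring
  have cy : ∀ x y : ℚ, y * (x ^ 3 - 8 * k) / (u ^ 3 * x ^ 3) =
      (y * (x ^ 3 - 8 * k) / x ^ 3) / u ^ 3 := by
    intro x y; rw [div_div]; ring
  refine add_eq_of_vieta hl0 (hf _ _ _ h₁) (hf _ _ _ h₂) (hf _ _ _ h₃) (l := L / u)
    (m := M / u ^ 3) ?_ ?_ ?_ ?_ ?_ ?_
  · rw [cx, cy, a1]; field_simp
  · rw [cx, cy, a2]; field_simp
  · rw [cx, cy]
    rw [← neg_div, ← neg_div, ← neg_mul, a3]; field_simp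
  · rw [cx, cx, cx]; rw [← add_div, ← add_div, s1]; field_simp
  · rw [cx, cx, cx]
    calc _ = ((x₁ ^ 3 + 4 * k) / x₁ ^ 2 * ((x₂ ^ 3 + 4 * k) / x₂ ^ 2)
      + (x₁ ^ 3 + 4 * k) / x₁ ^ 2 * ((x₃ ^ 3 + 4 * k) / x₃ ^ 2)
      + (x₂ ^ 3 + 4 * k) / x₂ ^ 2 * ((x₃ ^ 3 + 4 * k) / x₃ ^ 2)) / u ^ 4 := by
          field_simp
      _ = _ := by rw [s2]; field_simp
  · rw [cx, cx, cx, hl]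
    calc _ = ((x₁ ^ 3 + 4 * k) / x₁ ^ 2 * ((x₂ ^ 3 + 4 * k) / x₂ ^ 2)
      * ((x₃ ^ 3 + 4 * k) / x₃ ^ 2)) / u ^ 6 := by
          field_simp
      _ = _ := by rw [s3]; field_simp; ring

theorem isog_surj {k l : ℤ} {u : ℚ} (hu : u ≠ 0)
    (hkl : (l : ℚ) * u ^ 6 = -27 * k) (hk : k ≠ 0) {f : Pt k →+ Pt l} (hf : IsIsog u f)
    {Q : Pt l} {X Y t : ℚ} (hQ : IsPt Q X Y)
    (ht : t ^ 3 - 3 * (u ^ 2 * X) * t - 2 * (u ^ 3 * Y) = 0) : ∃ P, f P = Q := by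
  have hkQ : (k : ℚ) ≠ 0 := by exact_mod_cast hk
  have e := hQ.eq
  have e' : (u ^ 3 * Y) ^ 2 = (u ^ 2 * X) ^ 3 - 27 * k := by
    rw [mul_pow, e]; linear_combination hkl
  set X' := u ^ 2 * X with hX
  set Y' := u ^ 3 * Y with hY
  have hY' : Y' = (t ^ 3 - 3 * X' * t) / 2 := by linarith
  have e2 : ((t ^ 2 - X') / 3 * t / 2) ^ 2 = ((t ^ 2 - X') / 3) ^ 3 + k := by
    rw [hY'] at e'
    linear_combination (-1 / 27 : ℚ) * e'
  obtain ⟨P, hP⟩ := exists_isPt hk e2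
  refine ⟨P, ?_⟩
  have h := hf _ _ _ hP
  have hx : t ^ 2 - X' ≠ 0 := by
    intro h0
    rw [h0] at e2
    apply hkQ
    linarith
  have hXe : X = X' / u ^ 2 := by rw [hX]; field_simp
  have hYe : Y = Y' / u ^ 3 := by rw [hY]; field_simp
  have hkk : (k : ℚ) = ((t ^ 2 - X') / 3 * t / 2) ^ 2 - ((t ^ 2 - X') / 3) ^ 3 := by linarith
  rw [hXe, hYe, hY'] at hQ
  refine IsPt.inj h ?_
  rw [hkk]
  convert hQ using 1
  · field_simp; ring
  · field_simp; ring

theorem isog_comp {k l : ℤ} {u v : ℚ} (huv : u * v = 3)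
    (hkl : (l : ℚ) * u ^ 6 = -27 * k) (hk : ¬ IsSquare (k : ℚ)) (hl : ¬ IsSquare (l : ℚ))
    {f : Pt k →+ Pt l} (hf : IsIsog u f) {g : Pt l →+ Pt k} (hg : IsIsog v g) (P : Pt k) :
    g (f P) = 3 • P := by
  by_cases hP : P = 0
  · simp [hP]
  have hk0 : k ≠ 0 := by
    rintro rfl; exact hk ⟨0, by simp⟩
  obtain ⟨x, y, h⟩ := exists_coords hP
  have e := h.eq
  have hx := x_ne_zero hk h
  have hf1 := hf _ _ _ h
  have hX := x_ne_zero hl hf1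
  have hg1 := hg _ _ _ hf1
  have hu : u ≠ 0 := by rintro rfl; simp at huv
  have hX' : x ^ 3 + 4 * k ≠ 0 := by
    intro h0; apply hX; rw [h0]; simp
  have hv : v = 3 / u := by field_simp; linarith
  have hlu : (l : ℚ) = -27 * k / u ^ 6 := by field_simp; linarith
  have hkk : (k : ℚ) = y ^ 2 - x ^ 3 := by linarith
  rw [hv, hlu] at hg1
  rw [hkk] at hg1 hX'
  have hX2 : 4 * y ^ 2 - 3 * x ^ 3 ≠ 0 := by
    intro h0; apply hX'; linarith
  by_cases hy : y = 0
  · subst hy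
    have : P + P = 0 := (add_eq_zero_iff' h h).2 ⟨rfl, by simp⟩
    rw [show 3 • P = P + (P + P) by abel, this, add_zero]
    refine hg1.inj ?_
    convert h using 1
    · field_simp; ring
    · field_simp; ring
  have e2 : (-(3 * x ^ 2 / (2 * y) * ((3 * x ^ 2 / (2 * y)) ^ 2 - 2 * x) +
      (y - 3 * x ^ 2 / (2 * y) * x))) ^ 2 = ((3 * x ^ 2 / (2 * y)) ^ 2 - 2 * x) ^ 3 + k := by
    rw [hkk]; field_simp; ring
  obtain ⟨S, hS⟩ := exists_isPt hk0 e2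
  have h2 : P + P = S := by
    refine add_eq_of_vieta hk0 h h hS (l := 3 * x ^ 2 / (2 * y)) (m := y - 3 * x ^ 2 / (2 * y) * x)
      (by ring) (by ring) (by ring) (by ring) ?_ ?_
    · field_simp; ring
    · rw [hkk]; field_simp; ring
  rw [show 3 • P = P + P + P by abel, h2]
  symm
  have hden : (x * (4 * y ^ 2 - 3 * x ^ 3)) ≠ 0 := mul_ne_zero hx hX2
  have hXd : (x ^ 3 + 4 * (y ^ 2 - x ^ 3)) = 4 * y ^ 2 - 3 * x ^ 3 := by ring
  rw [hXd] at hg1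
  obtain ⟨d, hd⟩ : ∃ d, d = 4 * y ^ 2 - 3 * x ^ 3 := ⟨_, rfl⟩
  rw [← hd] at hg1 hX2
  have hL : ∃ L : ℚ, L = -(3 * x ^ 2 / (2 * y)) + 8 * y ^ 3 / (3 * x * d) :=
    ⟨_, rfl⟩
  obtain ⟨L, hL⟩ := hL
  refine add_eq_of_vieta hk0 hS h hg1 (l := L) (m := y - L * x) ?_ (by ring) ?_ ?_ ?_ ?_
  · rw [hL]; field_simp; rw [hd]; ring
  · rw [hL]; field_simp; rw [hd]; ring
  · rw [hL]; field_simp; rw [hd]; ring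
  · rw [hL]; field_simp; rw [hd]; ring
  · rw [hL, hkk]; field_simp; rw [hd]; ring

end MRank

namespace MRank

open WeierstrassCurve Height

/-- naive height -/
noncomputable def ht {k : ℤ} (P : Pt k) : ℝ := logHeight P.xRep

lemma isPt_xRep {k : ℤ} {P : Pt k} {x y : ℚ} (h : IsPt P x y) : P.xRep = ![x, 1] := by
  obtain ⟨h, rfl⟩ := h; simp

lemma mordell_isElliptic {k : ℤ} (hk : k ≠ 0) : (MordellCurve k).IsElliptic := by
  have hkQ : (k : ℚ) ≠ 0 := by exact_mod_cast hk
  refine ⟨?_⟩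
  simp [MordellCurve, WeierstrassCurve.Δ, WeierstrassCurve.b₂, WeierstrassCurve.b₄,
    WeierstrassCurve.b₆, WeierstrassCurve.b₈, hkQ]

lemma addSubMap_eval {k : ℤ} (s t u : ℚ) :
    (fun i ↦ ((MordellCurve k).addSubMap i).eval ![s, t, u]) =
      ![s ^ 2 - 4 * k * t * u, 2 * t * s + 4 * k * u ^ 2, t ^ 2 - 4 * s * u] := by
  ext i
  fin_cases i <;> simp [addSubMap, MordellCurve, WeierstrassCurve.b₂, WeierstrassCurve.b₄,
    WeierstrassCurve.b₆, WeierstrassCurve.b₈]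

lemma sym2_key {k : ℤ} (hk : k ≠ 0) (P Q : Pt k) : ∃ c : ℚ, c ≠ 0 ∧
    (fun i ↦ ((MordellCurve k).addSubMap i).eval (P.sym2x Q)) = c • (P + Q).sym2x (P - Q) := by
  have hkQ : (k : ℚ) ≠ 0 := by exact_mod_cast hk
  by_cases hP : P = 0
  · subst hP
    by_cases hQ : Q = 0
    · subst hQ
      refine ⟨1, one_ne_zero, ?_⟩
      simp [addSubMap_eval]
    · obtain ⟨x, y, hQ⟩ := exists_coords hQ
      refine ⟨1, one_ne_zero, ?_⟩
      have e := isPt_xRep hQ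
      have e' := isPt_xRep hQ.neg
      rw [zero_add, zero_sub]
      simp only [Affine.Point.sym2x, e, e', Affine.Point.xRep_zero]
      rw [addSubMap_eval]
      ext i; fin_cases i <;> simp <;> ring
  by_cases hQ : Q = 0
  · subst hQ
    obtain ⟨x, y, hQ⟩ := exists_coords hP
    refine ⟨1, one_ne_zero, ?_⟩
    have e := isPt_xRep hQ
    rw [add_zero, sub_zero]
    simp only [Affine.Point.sym2x, e, Affine.Point.xRep_zero]
    rw [addSubMap_eval]
    ext i; fin_cases i <;> simp <;> ring
  obtain ⟨x₁, y₁, h₁⟩ := exists_coords hP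
  obtain ⟨x₂, y₂, h₂⟩ := exists_coords hQ
  have e₁ := h₁.eq
  have e₂ := h₂.eq
  -- doubling
  have dbl : ∀ (P : Pt k) (x y : ℚ), IsPt P x y → ∃ c : ℚ, c ≠ 0 ∧
      (fun i ↦ ((MordellCurve k).addSubMap i).eval (P.sym2x P)) = c • (P + P).sym2x 0 := by
    intro P x y h
    have e := h.eq
    simp only [Affine.Point.sym2x, isPt_xRep h, Affine.Point.xRep_zero]
    by_cases hy : y = 0
    · have h0 : P + P = 0 := (add_eq_zero_iff' h h).2 ⟨rfl, by simp [hy]⟩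
      have hx : x ≠ 0 := by
        rintro rfl
        apply hkQ; rw [hy] at e; linarith
      refine ⟨9 * x ^ 4, by positivity, ?_⟩
      rw [h0]
      simp only [Affine.Point.xRep_zero]
      have : (k : ℚ) = - x ^ 3 := by rw [hy] at e; linarith
      rw [addSubMap_eval, this]
      ext i; fin_cases i <;> simp <;> ring
    · have h0 : P + P ≠ 0 := by
        rw [Ne, add_eq_zero_iff' h h]; rintro ⟨-, h'⟩; apply hy; linarith
      obtain ⟨x', y', h'⟩ := exists_coords h0
      obtain ⟨l, m, l₁, l₂, l₃, v₁, v₂, v₃⟩ := vieta h h h'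
      refine ⟨4 * y ^ 2, by positivity, ?_⟩
      simp only [isPt_xRep h']
      rw [addSubMap_eval]
      have hl : 2 * l * y = 3 * x ^ 2 := by rw [l₁]; linear_combination v₂ - 2 * x * v₁
      have hx' : x' * (4 * y ^ 2) = x ^ 4 - 8 * k * x := by
        have : x' = l ^ 2 - 2 * x := by linarith
        rw [this]
        linear_combination (2 * l * y + 3 * x ^ 2) * hl - 8 * x * e
      ext i; fin_cases i
      · simp; linear_combination -hx'
      · simp; linear_combination -4 * e
      · simp; ring
  by_cases hx : x₁ = x₂
  · have : P = Q ∨ P = -Q := by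
      subst hx
      have : (y₁ - y₂) * (y₁ + y₂) = 0 := by linear_combination e₁ - e₂
      rcases mul_eq_zero.1 this with h | h
      · left
        obtain rfl : y₁ = y₂ := by linarith
        exact h₁.inj h₂
      · right
        obtain rfl : y₁ = -y₂ := by linarith
        exact h₁.inj h₂.neg
    rcases this with rfl | rfl
    · simpa using dbl P _ _ h₁
    · obtain ⟨c, hc, h⟩ := dbl (-Q) _ _ h₁
      refine ⟨c, hc, ?_⟩
      rw [Affine.Point.sym2x_neg_right] at h
      rw [h, neg_add_cancel, Affine.Point.sym2x_comm, sub_eq_add_neg]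
  · have hS : P + Q ≠ 0 := by
      rw [Ne, add_eq_zero_iff' h₁ h₂]; exact fun h => hx h.1
    have hD : P + -Q ≠ 0 := by
      rw [Ne, add_eq_zero_iff' h₁ h₂.neg]; exact fun h => hx h.1
    obtain ⟨x₃, y₃, h₃⟩ := exists_coords hS
    obtain ⟨x₄, y₄, h₄⟩ := exists_coords hD
    obtain ⟨l, m, l₁, l₂, l₃, v₁, v₂, v₃⟩ := vieta h₁ h₂ h₃
    obtain ⟨l', m', l₁', l₂', l₃', v₁', v₂', v₃'⟩ := vieta h₁ h₂.neg h₄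
    have hd : x₁ - x₂ ≠ 0 := sub_ne_zero.2 hx
    refine ⟨(x₁ - x₂) ^ 2, by positivity, ?_⟩
    rw [← sub_eq_add_neg] at h₄
    simp only [Affine.Point.sym2x, isPt_xRep h₁, isPt_xRep h₂, isPt_xRep h₃, isPt_xRep h₄]
    rw [addSubMap_eval]
    have a : l * (x₁ - x₂) = y₁ - y₂ := by rw [l₁, l₂]; ring
    have b : l' * (x₁ - x₂) = y₁ + y₂ := by linear_combination -l₁' + l₂'
    have X3 : x₃ * (x₁ - x₂) ^ 2 = (y₁ - y₂) ^ 2 - (x₁ + x₂) * (x₁ - x₂) ^ 2 := by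
      rw [← a, show x₃ = l ^ 2 - x₁ - x₂ by linarith]; ring
    have X4 : x₄ * (x₁ - x₂) ^ 2 = (y₁ + y₂) ^ 2 - (x₁ + x₂) * (x₁ - x₂) ^ 2 := by
      rw [← b, show x₄ = l' ^ 2 - x₁ - x₂ by linarith]; ring
    have hk1 : (k : ℚ) = y₁ ^ 2 - x₁ ^ 3 := by linarith
    ext i; fin_cases i
    · simp
      have : (x₁ - x₂) ^ 2 * (((x₁ * x₂) ^ 2 - 4 * k * (x₁ + x₂)) -
        (x₁ - x₂) ^ 2 * (x₃ * x₄)) = 0 := by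
        have : (x₁ - x₂) ^ 2 * ((x₁ - x₂) ^ 2 * (x₃ * x₄)) =
          ((y₁ - y₂) ^ 2 - (x₁ + x₂) * (x₁ - x₂) ^ 2) *
          ((y₁ + y₂) ^ 2 - (x₁ + x₂) * (x₁ - x₂) ^ 2) := by rw [← X3, ← X4]; ring
        rw [mul_sub, this]
        have E : ((y₁ - y₂) ^ 2 - (x₁ + x₂) * (x₁ - x₂) ^ 2) *
          ((y₁ + y₂) ^ 2 - (x₁ + x₂) * (x₁ - x₂) ^ 2) = (y₁ ^ 2 - y₂ ^ 2) ^ 2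
            - 2 * (y₁ ^ 2 + y₂ ^ 2) * ((x₁ + x₂) * (x₁ - x₂) ^ 2) +
            ((x₁ + x₂) * (x₁ - x₂) ^ 2) ^ 2 := by ring
        rw [E, e₁, e₂]; ring
      rcases mul_eq_zero.1 this with h | h
      · exact absurd h (by positivity)
      · linear_combination h
    · simp
      linear_combination -X3 - X4 - 2 * e₁ - 2 * e₂
    · simp; ring

lemma ht_nonneg {k : ℤ} (P : Pt k) : 0 ≤ ht P := by
  unfold ht
  positivity

theorem parallelogram {k : ℤ} (hk : k ≠ 0) : ∃ C : ℝ, ∀ P Q : Pt k,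
    |ht (P + Q) + ht (P - Q) - 2 * (ht P + ht Q)| ≤ C := by
  have := mordell_isElliptic hk
  obtain ⟨C₁, h₁⟩ := abs_logHeight_addSubMap_sub_two_mul_logHeight_le (MordellCurve k)
  have S : ∃ C₂ : ℝ, ∀ P Q : Pt k, |logHeight (P.sym2x Q) - (ht P + ht Q)| ≤ C₂ := by
    obtain ⟨C, hC⟩ := abs_logHeight_sym2_sub_le ℚ
    refine ⟨C, fun P Q => ?_⟩
    have e : ∀ P : Pt k, ![P.xRep 0, P.xRep 1] = P.xRep := by
      intro P; ext i; fin_cases i <;> rfl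
    have := hC (a := P.xRep 0) (b := P.xRep 1) (c := Q.xRep 0) (d := Q.xRep 1)
      (by rw [e]; exact P.xRep_ne_zero) (by rw [e]; exact Q.xRep_ne_zero)
    rw [e, e] at this
    exact this
  obtain ⟨C₂, h₂⟩ := S
  refine ⟨C₁ + 3 * C₂, fun P Q => ?_⟩
  obtain ⟨c, hc, e⟩ := sym2_key hk P Q
  have a := h₁ (P.sym2x Q)
  rw [e, logHeight_smul_eq_logHeight _ hc] at a
  have b := h₂ P Q
  have d := h₂ (P + Q) (P - Q)
  rw [abs_le] at *
  constructor <;> linarith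

instance northcott_ht {k : ℤ} : Northcott (ht (k := k)) where
  finite_le B := by
    have hf : {x : ℚ | logHeight₁ x ≤ B}.Finite := NumberField.finite_setOfPred_logHeight₁_le (K := ℚ) B
    have h2 : ((fun x : ℚ => ![x, 1]) '' {x : ℚ | logHeight₁ x ≤ B} ∪ {![1, 0]}).Finite :=
      (hf.image _).union (Set.finite_singleton _)
    refine Set.Finite.of_finite_fibers (fun P : Pt k => P.xRep) (h2.subset ?_) ?_
    · rintro _ ⟨P, hP, rfl⟩
      by_cases h : P = 0
      · right; simp [h]
      · left
        obtain ⟨x, y, h⟩ := exists_coords h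
        refine ⟨x, ?_, (isPt_xRep h).symm⟩
        simp only [Set.mem_ofPred_eq, ht, isPt_xRep h] at hP ⊢
        rwa [logHeight₁_eq_logHeight]
    · rintro _ ⟨P, hP, rfl⟩
      refine (Set.toFinite {P, -P}).subset ?_
      rintro Q ⟨-, hQ⟩
      exact Affine.Point.eq_or_eq_neg_of_xRep_eq_xRep hQ

theorem fg_of_finite {k : ℤ} (hk : k ≠ 0)
    (H : (nsmulAddMonoidHom (α := Pt k) 3).range.FiniteIndex) : AddGroup.FG (Pt k) := by
  obtain ⟨C, hC⟩ := parallelogram hk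
  refine AddCommGroup.fg_of_descent (n := 3) (h := ht) (a := 2) (b := 9)
    (c := fun g => 2 * ht g + C) (c₀ := 3 * C + 2 * ht (0 : Pt k)) (by norm_num) (by norm_num) H ?_ ?_
  · intro g x
    have := (abs_le.1 (hC (g + x) g)).2
    have h0 := ht_nonneg (g + x + g)
    rw [add_sub_cancel_left] at this
    linarith
  · intro x
    have a := (abs_le.1 (hC (x + x) x)).1
    have b := (abs_le.1 (hC x x)).1
    rw [add_sub_cancel_right] at a
    rw [sub_self] at b
    rw [show 3 • x = x + x + x by abel]
    linarith

end MRank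

namespace MRank

lemma pow_rank_dvd (G : Type*) [AddCommGroup G] [AddGroup.FG G] :
    3 ^ Module.finrank ℤ G ∣ (nsmulAddMonoidHom (α := G) 3).range.index := by
  have : Module.Finite ℤ G := Module.Finite.iff_addGroup_fg.2 inferInstance
  let T := Submodule.torsion ℤ G
  have hfr : Module.finrank ℤ (G ⧸ T) = Module.finrank ℤ G := by
    exact finrank_quotient_eq_of_le_torsion (le_refl T)
  let b := Module.finBasis ℤ (G ⧸ T)
  let n := Module.finrank ℤ (G ⧸ T)
  let f : G →+ (Fin n → ZMod 3) :=
    { toFun := fun g i => ((b.repr (T.mkQ g) i : ℤ) : ZMod 3)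
      map_zero' := by ext i; simp
      map_add' := fun x y => by ext i; simp }
  have hs : Function.Surjective f := by
    intro v
    obtain ⟨g, hg⟩ := T.mkQ_surjective (b.equivFun.symm (fun i => ((v i).val : ℤ)))
    refine ⟨g, ?_⟩
    ext i
    simp only [f, AddMonoidHom.coe_mk, ZeroHom.coe_mk]
    rw [hg]
    have := congrFun (b.equivFun.apply_symm_apply (fun i => ((v i).val : ℤ))) i
    rw [Module.Basis.equivFun_apply] at this
    rw [this]
    simp
  have hle : (nsmulAddMonoidHom (α := G) 3).range ≤ f.ker := by
    rintro _ ⟨g, rfl⟩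
    rw [AddMonoidHom.mem_ker, nsmulAddMonoidHom_apply, map_nsmul]
    ext i
    simp only [Pi.smul_apply, nsmul_eq_mul, Pi.zero_apply]
    rw [show ((3 : ℕ) : ZMod 3) = 0 from rfl, zero_mul]
  have := AddSubgroup.index_dvd_of_le hle
  rw [AddSubgroup.index_ker, AddMonoidHom.range_eq_top.2 hs] at this
  simpa [n, hfr] using this

theorem rank_bound {k l : ℤ} (hk : k ≠ 0) (f : Pt k →+ Pt l) (g : Pt l →+ Pt k)
    (hgf : ∀ P, g (f P) = 3 • P) {a b : ℕ}
    (hg0 : g.range.index ≠ 0) (hg : g.range.index ≤ 3 ^ a)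
    (hf0 : f.range.index ≠ 0) (hf : f.range.index ≤ 3 ^ b) :
    mordellRank k ≤ a + b := by
  have hr : (nsmulAddMonoidHom (α := Pt k) 3).range = f.range.map g := by
    ext P; constructor
    · rintro ⟨Q, rfl⟩; exact ⟨f Q, ⟨Q, rfl⟩, hgf Q⟩
    · rintro ⟨_, ⟨Q, rfl⟩, rfl⟩; exact ⟨Q, (hgf Q).symm⟩
  have hle : f.range.map g ≤ g.range := AddMonoidHom.range_eq_map g ▸ AddSubgroup.map_mono le_top
  have h1 := AddSubgroup.relIndex_mul_index hle
  have h2 : (f.range.map g).relIndex g.range ∣ f.range.index := by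
    rw [AddMonoidHom.range_eq_map g, AddSubgroup.relIndex_map_map]
    simp only [top_sup_eq, AddSubgroup.relIndex_top_right]
    exact AddSubgroup.index_dvd_of_le le_sup_left
  have h3 : (f.range.map g).relIndex g.range ≤ 3 ^ b :=
    (Nat.le_of_dvd (Nat.pos_of_ne_zero hf0) h2).trans hf
  have h4 : (f.range.map g).index ≠ 0 := by
    rw [← h1]
    exact mul_ne_zero (fun h => hf0 (by rw [h] at h2; exact zero_dvd_iff.1 h2)) hg0
  have h5 : (f.range.map g).index ≤ 3 ^ (a + b) := by
    rw [← h1, pow_add, mul_comm]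
    exact Nat.mul_le_mul hg h3
  rw [← hr] at h4 h5
  have : AddGroup.FG (Pt k) := fg_of_finite hk ⟨h4⟩
  have h6 := Nat.le_of_dvd (Nat.pos_of_ne_zero h4) (pow_rank_dvd (Pt k))
  exact (Nat.pow_le_pow_iff_right (by norm_num)).1 (h6.trans h5)

end MRank

namespace MRank
open Polynomial NumberField

lemma rat_int_of_sqfree {k0 : ℤ} (hsf : Squarefree k0) {r : ℚ} {n : ℤ} (h : k0 * r ^ 2 = n) :
    ∃ u : ℤ, r = u := by
  have h1 : k0 * r.num ^ 2 = n * (r.den : ℤ) ^ 2 := by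
    have hd : (r.den : ℚ) ≠ 0 := by exact_mod_cast r.den_ne_zero
    rw [← Rat.num_div_den r] at h
    field_simp at h
    rw [mul_comm n]; exact_mod_cast h
  have h2 : ((r.den : ℤ) ^ 2) ∣ k0 := by
    have hc : IsCoprime ((r.den : ℤ) ^ 2) (r.num ^ 2) := by
      apply IsCoprime.pow
      rw [Int.isCoprime_iff_gcd_eq_one, Int.gcd_comm]
      exact r.reduced
    exact hc.dvd_of_dvd_mul_right (Dvd.intro_left _ h1.symm)
  have h3 := hsf _ (by rwa [pow_two] at h2)
  have h4 : r.den = 1 := by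
    have := Int.isUnit_iff_natAbs_eq.1 h3
    simpa using this
  exact ⟨r.num, by rw [← Rat.num_div_den r, h4]; simp⟩

lemma k0_ne_sq {k0 : ℤ} (h4 : k0 % 4 = 3) (n : ℤ) : k0 ≠ n * n := by
  intro h
  have : n % 4 = 0 ∨ n % 4 = 1 ∨ n % 4 = 2 ∨ n % 4 = 3 := by omega
  rcases this with h' | h' | h' | h' <;> simp [h, Int.mul_emod, h'] at h4

theorem exists_equiv {k0 : ℤ} (hsf : Squarefree k0) (h4 : k0 % 4 = 3) (c : ℂ) (hc : c ^ 2 = (k0 : ℂ)) :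
    Nonempty (ℤ√k0 ≃+* 𝓞 ℚ⟮c⟯) := by
  have hInteg : IsIntegral ℚ c := by
    refine ⟨X ^ 2 - C (k0 : ℚ), by monicity!, ?_⟩
    rw [eval₂_sub, eval₂_X_pow, eval₂_C, hc]; simp
  set g : ℚ⟮c⟯ := IntermediateField.AdjoinSimple.gen ℚ c with hg
  have hg2 : g ^ 2 = (k0 : ℚ⟮c⟯) := by
    apply Subtype.ext
    simpa [hg] using hc
  have hgi : IsIntegral ℤ g := by
    refine ⟨X ^ 2 - C (k0 : ℤ), by monicity!, ?_⟩
    rw [eval₂_sub, eval₂_X_pow, eval₂_C, hg2]; simp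
  let w : 𝓞 ℚ⟮c⟯ := ⟨g, hgi⟩
  have hw : w * w = (k0 : 𝓞 ℚ⟮c⟯) := by
    apply RingOfIntegers.ext
    change algebraMap (𝓞 ℚ⟮c⟯) ℚ⟮c⟯ (w * w) = algebraMap (𝓞 ℚ⟮c⟯) ℚ⟮c⟯ _
    rw [map_mul, map_intCast, ← hg2, pow_two]; rfl
  have hr : ∀ n : ℤ, k0 ≠ n * n := k0_ne_sq h4
  refine ⟨RingEquiv.ofBijective (Zsqrtd.lift ⟨w, hw⟩) ⟨Zsqrtd.lift_injective _ hr, ?_⟩⟩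
  intro z
  suffices h : ∃ x y : ℤ, (z : ℚ⟮c⟯) = x + y * g by
    obtain ⟨x, y, h⟩ := h
    refine ⟨⟨x, y⟩, ?_⟩
    apply RingOfIntegers.ext
    rw [h, Zsqrtd.lift_apply_apply]
    change algebraMap (𝓞 ℚ⟮c⟯) ℚ⟮c⟯ _ = _
    rw [map_add, map_mul, map_intCast, map_intCast]; rfl
  obtain ⟨a, b, hab⟩ : ∃ a b : ℚ, (z : ℚ⟮c⟯) = algebraMap ℚ _ a + algebraMap ℚ _ b * g := by
    obtain ⟨f, hf, hz⟩ := (IntermediateField.adjoin.powerBasis hInteg).exists_eq_aeval (z : ℚ⟮c⟯)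
    have hd : (IntermediateField.adjoin.powerBasis hInteg).dim ≤ 2 := by
      rw [IntermediateField.adjoin.powerBasis_dim]
      have h1 : (X ^ 2 - C (k0 : ℚ)) ≠ 0 := by
        apply Monic.ne_zero; monicity!
      have := natDegree_le_of_dvd (minpoly.dvd ℚ c (p := X ^ 2 - C (k0 : ℚ)) (by simp [hc])) h1
      refine this.trans ?_
      compute_degree
    obtain ⟨b, a, rfl⟩ := exists_eq_X_add_C_of_natDegree_le_one (p := f) (by omega)
    refine ⟨a, b, ?_⟩
    rw [hz, IntermediateField.adjoin.powerBasis_gen]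
    simp [hg, add_comm]
  have hzi : IsIntegral ℤ (z : ℚ⟮c⟯) := RingOfIntegers.isIntegral_coe z
  by_cases hb : b = 0
  · subst hb
    have h1 : IsIntegral ℤ a := by
      rw [hab] at hzi
      simp only [map_zero, zero_mul, add_zero] at hzi
      exact (isIntegral_algebraMap_iff (algebraMap ℚ ℚ⟮c⟯).injective).1 hzi
    obtain ⟨n, hn⟩ := IsIntegrallyClosed.isIntegral_iff.1 h1
    refine ⟨n, 0, ?_⟩
    rw [hab, ← hn]; simp
  · have hnr : (z : ℚ⟮c⟯) ∉ (algebraMap ℚ ℚ⟮c⟯).range := by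
      rintro ⟨q, hq⟩
      have h1 : g = algebraMap ℚ _ ((q - a) / b) := by
        have hb' : algebraMap ℚ ℚ⟮c⟯ b ≠ 0 := by simpa using hb
        rw [map_div₀, map_sub, eq_div_iff hb', hq, hab]; ring
      have h2 : ((q - a) / b) ^ 2 = (k0 : ℚ) := by
        apply (algebraMap ℚ ℚ⟮c⟯).injective
        rw [map_pow, ← h1, hg2]; simp
      obtain ⟨u, hu⟩ := rat_int_of_sqfree (k0 := 1) squarefree_one (r := (q - a) / b) (n := k0)
        (by push_cast; rw [h2]; ring)
      rw [hu] at h2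
      exact hr u (by rw [← pow_two]; exact_mod_cast h2.symm)
    have hzq : IsIntegral ℚ (z : ℚ⟮c⟯) := hzi.tower_top
    set q : ℚ[X] := X ^ 2 + (- C (2 * a) * X + C (a ^ 2 - k0 * b ^ 2)) with hq
    have hqm : q.Monic := by rw [hq]; monicity!
    have hqd : q.natDegree = 2 := by rw [hq]; compute_degree!
    have hqz : aeval (z : ℚ⟮c⟯) q = 0 := by
      rw [hq, hab]
      simp only [map_add, map_mul, map_neg, map_sub, aeval_C, aeval_X, map_pow, map_intCast,
        map_ofNat]
      linear_combination (algebraMap ℚ ℚ⟮c⟯ b) ^ 2 * hg2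
    have hmin : minpoly ℚ (z : ℚ⟮c⟯) = q := by
      apply (eq_of_monic_of_dvd_of_natDegree_le (minpoly.monic hzq) hqm (minpoly.dvd _ _ hqz) _).symm
      rw [hqd]
      exact (minpoly.two_le_natDegree_iff hzq).2 hnr
    rw [minpoly.isIntegrallyClosed_eq_field_fractions' ℚ hzi] at hmin
    have h0 : ∃ n : ℤ, a ^ 2 - k0 * b ^ 2 = n := by
      refine ⟨(minpoly ℤ (z : ℚ⟮c⟯)).coeff 0, ?_⟩
      have := congrArg (fun p => coeff p 0) hmin
      simp only [hq, coeff_map, coeff_add, coeff_X_pow, coeff_C, ← C_neg, coeff_C_mul, coeff_X] at this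
      simp at this
      exact this.symm
    have h1 : ∃ n : ℤ, 2 * a = n := by
      refine ⟨-(minpoly ℤ (z : ℚ⟮c⟯)).coeff 1, ?_⟩
      have := congrArg (fun p => coeff p 1) hmin
      simp only [hq, coeff_map, coeff_add, coeff_X_pow, coeff_C, ← C_neg, coeff_C_mul, coeff_X] at this
      simp at this
      push_cast
      linarith
    obtain ⟨n, hn⟩ := h0
    obtain ⟨m, hm⟩ := h1
    obtain ⟨u, hu⟩ := rat_int_of_sqfree hsf (r := 2 * b) (n := m ^ 2 - 4 * n) (by
      push_cast; rw [← hm, ← hn]; ring)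
    have h5 : m ^ 2 - k0 * u ^ 2 = 4 * n := by
      have : (m : ℚ) ^ 2 - k0 * u ^ 2 = 4 * n := by rw [← hm, ← hu, ← hn]; ring
      exact_mod_cast this
    have h6 : m % 2 = 0 ∧ u % 2 = 0 := by
      have h7 : (m ^ 2 - k0 * u ^ 2) % 4 = 0 := by omega
      have hm4 : m % 4 = 0 ∨ m % 4 = 1 ∨ m % 4 = 2 ∨ m % 4 = 3 := by omega
      have hu4 : u % 4 = 0 ∨ u % 4 = 1 ∨ u % 4 = 2 ∨ u % 4 = 3 := by omega
      rcases hm4 with h | h | h | h <;> rcases hu4 with h' | h' | h' | h' <;>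
        first
        | omega
        | (simp [pow_two, Int.sub_emod, Int.mul_emod, h, h', h4] at h7)
    obtain ⟨m', rfl⟩ : 2 ∣ m := by omega
    obtain ⟨u', rfl⟩ : 2 ∣ u := by omega
    refine ⟨m', u', ?_⟩
    have ha : a = m' := by push_cast at hm; linarith
    have hb' : b = u' := by push_cast at hu; linarith
    rw [hab, ha, hb']; simp

end MRank

namespace MRank
open NumberField UniqueFactorizationMonoid

section
variable {K : Type*} [Field K] [NumberField K] {k0 : ℤ} (e : ℤ√k0 ≃+* 𝓞 K)

/-- conjugation on the ring of integers -/
noncomputable def cj : 𝓞 K ≃+* 𝓞 K := (e.symm.trans starRingAut).trans e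

/-- the square root of `k0` -/
noncomputable def ww : 𝓞 K := e Zsqrtd.sqrtd

lemma ww_sq : ww e ^ 2 = (k0 : 𝓞 K) := by
  rw [ww, ← map_pow, pow_two, Zsqrtd.dmuld, map_intCast]

lemma e_mk (x y : ℤ) : e ⟨x, y⟩ = x + y * ww e := by
  rw [Zsqrtd.decompose, map_add, map_mul, map_intCast, map_intCast, ww, mul_comm]

lemma exists_xy (z : 𝓞 K) : ∃ x y : ℤ, z = x + y * ww e :=
  ⟨(e.symm z).re, (e.symm z).im, by
    rw [← e_mk]; exact (e.apply_symm_apply z).symm⟩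

lemma cj_mk (x y : ℤ) : cj e (x + y * ww e) = x - y * ww e := by
  rw [← e_mk]
  have h : cj e (e ⟨x, y⟩) = e (star (⟨x, y⟩ : ℤ√k0)) := by simp [cj]
  rw [h, Zsqrtd.star_mk, e_mk]; push_cast; ring

lemma cj_ww : cj e (ww e) = - ww e := by
  have := cj_mk e 0 1
  simpa using this

lemma cj_cj (z : 𝓞 K) : cj e (cj e z) = z := by simp [cj]

lemma xy_eq_zero {x y : ℤ} (h : (x + y * ww e : 𝓞 K) = 0) : x = 0 ∧ y = 0 := by
  rw [← e_mk, map_eq_zero_iff e e.injective, Zsqrtd.ext_iff] at h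
  simpa using h

lemma int_of_cj_fix {z : 𝓞 K} (h : cj e z = z) : ∃ x : ℤ, z = x := by
  obtain ⟨x, y, rfl⟩ := exists_xy e z
  rw [cj_mk] at h
  have : ((0 : ℤ) + (2 * y : ℤ) * ww e : 𝓞 K) = 0 := by push_cast; linear_combination -h
  have := (xy_eq_zero e this).2
  exact ⟨x, by have : y = 0 := by omega
               simp [this]⟩

lemma mul_cj (x y : ℤ) : (x + y * ww e : 𝓞 K) * (x - y * ww e) = ((x ^ 2 - k0 * y ^ 2 : ℤ) : 𝓞 K) := by
  push_cast; linear_combination (-(y : 𝓞 K) ^ 2) * ww_sq e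

lemma cj_mem_of_mem {p : Ideal (𝓞 K)} (h : 2 * ww e ∈ p) {z : 𝓞 K} (hz : z ∈ p) : cj e z ∈ p := by
  obtain ⟨x, y, rfl⟩ := exists_xy e z
  rw [cj_mk]
  have := p.sub_mem hz (p.mul_mem_left (y : 𝓞 K) h)
  convert this using 1; ring

lemma map_cj_pow {p : Ideal (𝓞 K)} (h : 2 * ww e ∈ p) (n : ℕ) : Ideal.map (cj e) (p ^ n) ≤ p ^ n := by
  rw [Ideal.map_pow]
  apply Ideal.pow_right_mono
  rw [Ideal.map_le_iff_le_comap]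
  intro z hz
  exact cj_mem_of_mem e h hz

lemma exists_cube {I : Ideal (𝓞 K)} (hI : I ≠ ⊥)
    (h : ∀ p : Ideal (𝓞 K), p.IsPrime → p ≠ ⊥ → ∀ n : ℕ, emultiplicity p I = n → 3 ∣ n) :
    ∃ J, I = J ^ 3 := by
  classical
  have hI' : I ≠ 0 := hI
  obtain ⟨t, ht⟩ := Multiset.exists_smul_of_dvd_count (normalizedFactors I) (k := 3) (by
    intro p hp
    have hpp := prime_of_normalized_factor p hp
    have := emultiplicity_eq_count_normalizedFactors hpp.irreducible hI'
    rw [normalize_eq] at this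
    exact h p (Ideal.isPrime_of_prime hpp) hpp.ne_zero _ this)
  refine ⟨t.prod, ?_⟩
  rw [← Multiset.prod_nsmul, ← ht, Ideal.prod_normalizedFactors_eq_self hI']

lemma eta_cube {b E a : ℤ} (hab : b ^ 2 - k0 * E ^ 2 = a ^ 3)
    (ha : a ≠ 0)
    (hq : ∀ q : ℕ, q.Prime → (q : ℤ) ∣ a → (q : ℤ) ∣ b → (q : ℤ) ∣ E → (q : ℤ) ∣ k0) :
    ∃ J, Ideal.span {(b + E * ww e : 𝓞 K)} = J ^ 3 := by
  set η : 𝓞 K := b + E * ww e with hη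
  set η' : 𝓞 K := b - E * ww e with hη'
  have hcj : cj e η = η' := cj_mk e b E
  have hmul : η * η' = (a : 𝓞 K) ^ 3 := by
    rw [hη, hη', mul_cj, hab]; push_cast; rfl
  have ha' : (a : 𝓞 K) ≠ 0 := by exact_mod_cast ha
  have hη0 : η ≠ 0 := fun h => ha' (by rw [h, zero_mul] at hmul; exact pow_eq_zero_iff (by norm_num) |>.1 hmul.symm)
  have hη0' : η' ≠ 0 := fun h => ha' (by rw [h, mul_zero] at hmul; exact pow_eq_zero_iff (by norm_num) |>.1 hmul.symm)
  apply exists_cube (by simpa using hη0)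
  intro p hp hp0 n hn
  have hprime : Prime p := Ideal.prime_of_isPrime hp0 hp
  have hfin : ∀ z : 𝓞 K, z ≠ 0 → ∃ m : ℕ, emultiplicity p (Ideal.span {z}) = m := by
    intro z hz
    have : FiniteMultiplicity p (Ideal.span {z}) :=
      FiniteMultiplicity.of_prime_left hprime (by simpa using hz)
    exact ⟨_, this.emultiplicity_eq_multiplicity⟩
  obtain ⟨n', hn'⟩ := hfin η' hη0'
  obtain ⟨m, hm⟩ := hfin a ha'
  have hsum : n + n' = 3 * m := by
    have h1 : emultiplicity p (Ideal.span {η} * Ideal.span {η'}) = emultiplicity p (Ideal.span {(a : 𝓞 K)} ^ 3) := by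
      rw [Ideal.span_singleton_mul_span_singleton, hmul, Ideal.span_singleton_pow]
    rw [emultiplicity_mul hprime, hn, hn', emultiplicity_pow hprime, hm] at h1
    exact_mod_cast h1
  by_cases h2w : 2 * ww e ∈ p
  · have : emultiplicity p (Ideal.span {η}) = emultiplicity p (Ideal.span {η'}) := by
      rw [emultiplicity_eq_emultiplicity_iff]
      intro j
      rw [Ideal.dvd_span_singleton, Ideal.dvd_span_singleton]
      constructor
      · intro h
        rw [← hcj]
        exact map_cj_pow e h2w j (Ideal.mem_map_of_mem _ h)
      · intro h
        have := map_cj_pow e h2w j (Ideal.mem_map_of_mem (cj e) h)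
        rwa [← hcj, cj_cj] at this
    rw [hn, hn'] at this
    have : n = n' := by exact_mod_cast this
    omega
  · by_cases h1 : η ∈ p
    · by_cases h1' : η' ∈ p
      · exfalso
        have h3 : (E : 𝓞 K) ∈ p := by
          have : 2 * ww e * E ∈ p := by
            have := p.sub_mem h1 h1'
            convert this using 1; rw [hη, hη']; ring
          exact (hp.mem_or_mem this).resolve_left h2w
        have h4 : (b : 𝓞 K) ∈ p := by
          have := p.sub_mem h1 (p.mul_mem_right (ww e) h3)
          convert this using 1; rw [hη]; ring
        have h5 : (a : 𝓞 K) ∈ p := by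
          have := p.mul_mem_right η' h1
          rw [hmul] at this
          exact hp.mem_of_pow_mem _ this
        -- the rational prime below
        have hpn : Ideal.absNorm p ≠ 1 := by
          rw [Ne, Ideal.absNorm_eq_one_iff]; exact hp.ne_top
        have hchar : ∃ q : ℕ, q.Prime ∧ (q : 𝓞 K) ∈ p := by
          have hmem := Ideal.absNorm_mem p
          have h0 : Ideal.absNorm p ≠ 0 := by
            rw [Ne, Ideal.absNorm_eq_zero_iff]; exact hp0
          have : ((Ideal.absNorm p).primeFactorsList.map (fun q : ℕ => (q : 𝓞 K))).prod ∈ p := by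
            rw [← Nat.cast_list_prod, Nat.prod_primeFactorsList h0]; exact hmem
          obtain ⟨z, hz, hzp⟩ := (Ideal.IsPrime.multiset_prod_mem_iff_exists_mem hp
            (((Ideal.absNorm p).primeFactorsList.map (fun q : ℕ => (q : 𝓞 K))) : Multiset (𝓞 K))).1
            (by simpa using this)
          simp only [Multiset.mem_coe, List.mem_map] at hz
          obtain ⟨q, hq, rfl⟩ := hz
          exact ⟨q, Nat.prime_of_mem_primeFactorsList hq, hzp⟩
        obtain ⟨q, hqp, hqm⟩ := hchar
        have hdvd : ∀ x : ℤ, (x : 𝓞 K) ∈ p → (q : ℤ) ∣ x := by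
          intro x hx
          by_contra hc
          have : IsCoprime (q : ℤ) x := (Nat.prime_iff_prime_int.1 hqp).coprime_iff_not_dvd.2 hc
          obtain ⟨u, v, huv⟩ := this
          apply hp.ne_top
          rw [Ideal.eq_top_iff_one]
          have h6 := p.add_mem (p.mul_mem_left (u : 𝓞 K) hqm) (p.mul_mem_left (v : 𝓞 K) hx)
          have h7 : (u : 𝓞 K) * q + v * x = 1 := by exact_mod_cast congrArg (Int.cast : ℤ → 𝓞 K) huv
          rwa [h7] at h6
        obtain ⟨j, hj⟩ := hq q hqp (hdvd _ h5) (hdvd _ h4) (hdvd _ h3)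
        apply h2w
        apply p.mul_mem_left
        apply hp.mem_of_pow_mem 2
        rw [ww_sq, hj]
        push_cast
        exact p.mul_mem_right _ hqm
      · have : n' = 0 := by
          have := emultiplicity_eq_zero.2 (fun h => h1' (Ideal.dvd_span_singleton.1 h))
          rw [hn'] at this; exact_mod_cast this
        omega
    · have : n = 0 := by
        have := emultiplicity_eq_zero.2 (fun h => h1 (Ideal.dvd_span_singleton.1 h))
        rw [hn] at this; exact_mod_cast this
      omega

end
end MRank

namespace MRank
open NumberField UniqueFactorizationMonoid

lemma not_sq_neg3 {k0 : ℤ} (h3 : ¬ (3 : ℤ) ∣ k0) {r : ℚ} (h : r ^ 2 = -3 * k0) : False := by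
  obtain ⟨n, hn⟩ := rat_int_of_sqfree (k0 := 1) squarefree_one (r := r) (n := -3 * k0)
    (by push_cast; rw [h]; ring)
  rw [hn] at h
  have h1 : n ^ 2 = -3 * k0 := by exact_mod_cast h
  have h2 : (3 : ℤ) ∣ n := Int.prime_three.dvd_of_dvd_pow (n := 2) (by rw [h1]; exact ⟨-k0, by ring⟩)
  obtain ⟨m, rfl⟩ := h2
  exact h3 ⟨-m ^ 2, by linarith [show (3 * m) ^ 2 = 9 * m ^ 2 by ring]⟩

section
variable {K : Type*} [Field K] [NumberField K] {k0 : ℤ}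

lemma finrank_le_two (e : ℤ√k0 ≃+* 𝓞 K) : Module.finrank ℚ K ≤ 2 := by
  rw [← RingOfIntegers.rank]
  classical
  have h : Submodule.span ℤ (({1, ww e} : Finset (𝓞 K)) : Set (𝓞 K)) = ⊤ := by
    rw [eq_top_iff]
    intro z _
    obtain ⟨x, y, rfl⟩ := exists_xy e z
    apply Submodule.add_mem
    · rw [← mul_one (x : 𝓞 K), ← zsmul_eq_mul]
      exact Submodule.smul_mem _ _ (Submodule.subset_span (by simp))
    · rw [← zsmul_eq_mul]
      exact Submodule.smul_mem _ _ (Submodule.subset_span (by simp))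
  have h2 := finrank_span_finset_le_card (R := ℤ) ({1, ww e} : Finset (𝓞 K))
  unfold Set.finrank at h2
  rw [h, finrank_top] at h2
  exact h2.trans Finset.card_le_two

lemma unit_cube_one (e : ℤ√k0 ≃+* 𝓞 K) (h3 : ¬ (3 : ℤ) ∣ k0) (u : (𝓞 K)ˣ) (hu : u ^ 3 = 1) : u = 1 := by
  obtain ⟨x, y, hxy⟩ := exists_xy e (u : 𝓞 K)
  have h1 : (u : 𝓞 K) ^ 3 = 1 := by
    rw [← Units.val_pow_eq_pow_val, hu, Units.val_one]
  have h2 : (((x ^ 3 + 3 * x * y ^ 2 * k0 - 1 : ℤ) : 𝓞 K) +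
      ((3 * x ^ 2 * y + y ^ 3 * k0 : ℤ) : 𝓞 K) * ww e) = 0 := by
    rw [hxy] at h1
    push_cast
    linear_combination h1 - (3 * x * y ^ 2 + y ^ 3 * ww e : 𝓞 K) * ww_sq e
  obtain ⟨h4, h5⟩ := xy_eq_zero e h2
  have hy : y = 0 := by
    by_contra hy
    apply not_sq_neg3 h3 (r := 3 * x / y)
    have hy' : (y : ℚ) ≠ 0 := by exact_mod_cast hy
    have h6 : 3 * x ^ 2 + y ^ 2 * k0 = 0 := by
      have : y * (3 * x ^ 2 + y ^ 2 * k0) = 0 := by linear_combination h5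
      exact (mul_eq_zero.1 this).resolve_left hy
    have h7 : 3 * (x : ℚ) ^ 2 + y ^ 2 * k0 = 0 := by exact_mod_cast h6
    field_simp
    linear_combination h7
  subst hy
  have hx : x = 1 := by
    have h6 : x ^ 3 = 1 := by linarith [h4]
    have : (x - 1) * (x ^ 2 + x + 1) = 0 := by linear_combination h6
    rcases mul_eq_zero.1 this with h | h
    · omega
    · nlinarith [sq_nonneg (2 * x + 1)]
  apply Units.ext
  rw [hxy, hx]; simp

lemma units_mod_cubes (e : ℤ√k0 ≃+* 𝓞 K) (h3 : ¬ (3 : ℤ) ∣ k0) :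
    ∃ ε : (𝓞 K)ˣ, ∀ u : (𝓞 K)ˣ, ∃ j : Fin 3, ∃ v : (𝓞 K)ˣ, u = ε ^ (j : ℕ) * v ^ 3 := by
  have htor : ∀ ζ : Units.torsion K, ∃ v : (𝓞 K)ˣ, (ζ : (𝓞 K)ˣ) = v ^ 3 := by
    intro ζ
    have hc : Function.Injective (fun z : Units.torsion K => z ^ 3) := by
      intro a b hab
      have : ((a * b⁻¹ : Units.torsion K) : (𝓞 K)ˣ) ^ 3 = 1 := by
        have h : (a * b⁻¹) ^ 3 = 1 := by
          simp only at hab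
          rw [mul_pow, inv_pow, hab]; simp
        exact_mod_cast congrArg Subtype.val h
      have := unit_cube_one e h3 _ this
      have h2 : a * b⁻¹ = 1 := Subtype.ext this
      exact mul_inv_eq_one.1 h2
    obtain ⟨v, hv⟩ := Finite.surjective_of_injective hc ζ
    exact ⟨v, by rw [← hv]; simp⟩
  have hr : Units.rank K ≤ 1 := by
    have h1 := finrank_le_two e
    have h2 := InfinitePlace.card_add_two_mul_card_eq_rank K
    have h3 := InfinitePlace.card_eq_nrRealPlaces_add_nrComplexPlaces K
    unfold Units.rank
    omega
  have key : ∃ ε : (𝓞 K)ˣ, ∀ u : (𝓞 K)ˣ, ∃ n : ℤ, ∃ v : (𝓞 K)ˣ, u = ε ^ n * v ^ 3 := by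
    interval_cases hrr : Units.rank K
    · refine ⟨1, fun u => ⟨0, ?_⟩⟩
      obtain ⟨⟨ζ, f⟩, h, -⟩ := Units.exist_unique_eq_mul_prod K u
      obtain ⟨v, hv⟩ := htor ζ
      refine ⟨v, ?_⟩
      rw [h]
      have : IsEmpty (Fin (Units.rank K)) := by rw [hrr]; infer_instance
      simp [hv]
    · have hpos : 0 < Units.rank K := by omega
      refine ⟨Units.fundSystem K ⟨0, hpos⟩, fun u => ?_⟩
      obtain ⟨⟨ζ, f⟩, h, -⟩ := Units.exist_unique_eq_mul_prod K u
      obtain ⟨v, hv⟩ := htor ζ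
      refine ⟨f ⟨0, hpos⟩, v, ?_⟩
      rw [h, ← hv, mul_comm]
      congr 1
      apply Fintype.prod_eq_single
      intro i hi
      exact absurd (Fin.ext (by have := i.2; simp; omega)) hi
  obtain ⟨ε, hε⟩ := key
  refine ⟨ε, fun u => ?_⟩
  obtain ⟨n, v, rfl⟩ := hε u
  refine ⟨⟨(n % 3).toNat, by omega⟩, ε ^ (n / 3) * v, ?_⟩
  have : n = (n % 3) + (n / 3) * 3 := by omega
  rw [mul_pow, ← mul_assoc]
  congr 1
  conv_lhs => rw [this, zpow_add, zpow_mul]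
  congr 1
  have h2 : ((n % 3).toNat : ℤ) = n % 3 := by omega
  conv_lhs => rw [← h2]
  rw [zpow_natCast]

end
end MRank

namespace MRank
open NumberField UniqueFactorizationMonoid

/-- units modulo cubes -/
abbrev CK (K : Type*) [Field K] := Kˣ ⧸ (powMonoidHom 3 : Kˣ →* Kˣ).range

lemma ck_eq {K : Type*} [Field K] {u v : Kˣ} {z₁ z₂ : K} (h1 : z₁ ≠ 0) (h2 : z₂ ≠ 0)
    (h : (u : K) * z₁ ^ 3 = v * z₂ ^ 3) : (QuotientGroup.mk u : CK K) = QuotientGroup.mk v := by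
  rw [QuotientGroup.eq]
  refine ⟨Units.mk0 (z₁ / z₂) (div_ne_zero h1 h2), ?_⟩
  apply Units.ext
  have hu := u.ne_zero
  simp
  field_simp
  linear_combination h

section
variable {K : Type*} [Field K] [NumberField K] {k0 : ℤ}

/-- the class of an element whose ideal is the cube of an ideal in the class `c` -/
def RC (x : CK K) (c : ClassGroup (𝓞 K)) : Prop :=
  ∃ (η : 𝓞 K) (J : nonZeroDivisors (Ideal (𝓞 K))) (κ : Kˣ), Ideal.span {η} = (J : Ideal (𝓞 K)) ^ 3 ∧
    (κ : K) = η ∧ x = QuotientGroup.mk κ ∧ ClassGroup.mk0 J = c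

lemma RC.cube {x : CK K} {c : ClassGroup (𝓞 K)} (h : RC x c) : c ^ 3 = 1 := by
  obtain ⟨η, J, κ, h1, h2, -, rfl⟩ := h
  rw [← map_pow, ClassGroup.mk0_eq_one_iff]
  rw [SubmonoidClass.coe_pow, ← h1]
  exact ⟨η, rfl⟩

lemma RC.rel {ε : (𝓞 K)ˣ}
    (hε : ∀ u : (𝓞 K)ˣ, ∃ j : Fin 3, ∃ v : (𝓞 K)ˣ, u = ε ^ (j : ℕ) * v ^ 3) {x y : CK K}
    {c : ClassGroup (𝓞 K)} (hx : RC x c) (hy : RC y c) :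
    ∃ j : Fin 3, x = y * QuotientGroup.mk (Units.map (algebraMap (𝓞 K) K).toMonoidHom ε) ^ (j : ℕ) := by
  obtain ⟨η, J, κ, h1, h2, rfl, h3⟩ := hx
  obtain ⟨η', J', κ', h1', h2', rfl, h3'⟩ := hy
  obtain ⟨a, b, ha, hb, hab⟩ := ClassGroup.mk0_eq_mk0_iff.1 (h3'.trans h3.symm)
  have h4 : Ideal.span {a ^ 3 * η'} = Ideal.span {b ^ 3 * η} := by
    rw [← Ideal.span_singleton_mul_span_singleton, ← Ideal.span_singleton_mul_span_singleton,
      ← Ideal.span_singleton_pow, ← Ideal.span_singleton_pow, h1, h1', ← mul_pow, ← mul_pow, hab]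
  obtain ⟨u, hu⟩ := Ideal.span_singleton_eq_span_singleton.1 h4
  obtain ⟨j, v, rfl⟩ := hε u
  refine ⟨j, ?_⟩
  rw [← QuotientGroup.mk_pow, ← QuotientGroup.mk_mul]
  apply ck_eq (z₁ := (b : K)) (z₂ := (a : K) * (v : 𝓞 K))
  · simpa using hb
  · simpa using ha
  · have := congrArg (algebraMap (𝓞 K) K) hu
    simp only [map_mul, map_pow, Units.val_mul, Units.val_pow_eq_pow_val] at this
    simp only [Units.val_mul, Units.val_pow_eq_pow_val, h2, h2', Units.coe_map]
    simp only [RingHom.toMonoidHom_eq_coe, MonoidHom.coe_coe]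
    linear_combination -this

lemma RC_finite (e : ℤ√k0 ≃+* 𝓞 K) (h3 : ¬ (3 : ℤ) ∣ k0) :
    {x : CK K | ∃ c, RC x c}.Finite ∧
    {x : CK K | ∃ c, RC x c}.ncard ≤ 3 * Nat.card {x : ClassGroup (𝓞 K) // x ^ 3 = 1} := by
  classical
  obtain ⟨ε, hε⟩ := units_mod_cubes e h3
  let base : {x : ClassGroup (𝓞 K) // x ^ 3 = 1} → CK K := fun c =>
    if h : ∃ x, RC x c.1 then h.choose else 1
  let F : {x : ClassGroup (𝓞 K) // x ^ 3 = 1} × Fin 3 → CK K := fun p =>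
    base p.1 * QuotientGroup.mk (Units.map (algebraMap (𝓞 K) K).toMonoidHom ε) ^ (p.2 : ℕ)
  have hsub : {x : CK K | ∃ c, RC x c} ⊆ Set.range F := by
    rintro x ⟨c, hx⟩
    have hex : ∃ x, RC x c := ⟨x, hx⟩
    obtain ⟨j, hj⟩ := hx.rel hε hex.choose_spec
    refine ⟨(⟨c, hx.cube⟩, j), ?_⟩
    simp only [F, base]
    rw [dif_pos hex]
    exact hj.symm
  have hfin : (Set.range F).Finite := Set.finite_range F
  refine ⟨hfin.subset hsub, (Set.ncard_le_ncard hsub hfin).trans ?_⟩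
  rw [← Set.image_univ]
  refine (Set.ncard_image_le (Set.finite_univ)).trans ?_
  rw [Set.ncard_univ, Nat.card_prod, Nat.card_fin, mul_comm]

/-- the descent map on coordinates -/
noncomputable def dl {k : ℤ} (s : K) : Pt k → K
  | .zero => 1
  | .some _ y _ => algebraMap ℚ K y + s

lemma dl_zero {k : ℤ} (s : K) : dl s (0 : Pt k) = 1 := rfl

lemma dl_of {k : ℤ} (s : K) {P : Pt k} {x y : ℚ} (h : IsPt P x y) : dl s P = algebraMap ℚ K y + s := by
  obtain ⟨h, rfl⟩ := h; rfl

lemma s_lin {k : ℤ} {s : K} (hs : s ^ 2 = k) (hk : ¬ IsSquare (k : ℚ)) {p q : ℚ}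
    (h : algebraMap ℚ K p + algebraMap ℚ K q * s = 0) : p = 0 ∧ q = 0 := by
  have hq : q = 0 := by
    by_contra hq
    apply hk
    refine ⟨p / q, ?_⟩
    have hq' : algebraMap ℚ K q ≠ 0 := by simpa using hq
    have : s = - algebraMap ℚ K (p / q) := by
      rw [map_div₀]; field_simp; linear_combination h
    apply (algebraMap ℚ K).injective
    rw [map_intCast, ← hs, this, map_mul]; ring
  subst hq
  simpa using h

lemma dl_ne_zero {k : ℤ} {s : K} (hs : s ^ 2 = k) (hk : ¬ IsSquare (k : ℚ)) (P : Pt k) : dl s P ≠ 0 := by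
  by_cases hP : P = 0
  · subst hP; simp [dl_zero]
  · obtain ⟨x, y, hxy⟩ := exists_coords hP
    rw [dl_of s hxy]
    intro h
    have := (s_lin hs hk (p := y) (q := 1) (by simpa using h)).2
    norm_num at this

/-- the descent map -/
noncomputable def dq {k : ℤ} {s : K} (hs : s ^ 2 = k) (hk : ¬ IsSquare (k : ℚ)) (P : Pt k) : CK K :=
  QuotientGroup.mk (Units.mk0 (dl s P) (dl_ne_zero hs hk P))

lemma dq_add {k : ℤ} {s : K} (hs : s ^ 2 = k) (hk : ¬ IsSquare (k : ℚ)) (P Q : Pt k) :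
    dq hs hk (P + Q) = dq hs hk P * dq hs hk Q := by
  unfold dq
  rw [← QuotientGroup.mk_mul]
  by_cases hP : P = 0
  · subst hP
    apply ck_eq (z₁ := 1) (z₂ := 1) one_ne_zero one_ne_zero
    simp [dl_zero]
  by_cases hQ : Q = 0
  · subst hQ
    apply ck_eq (z₁ := 1) (z₂ := 1) one_ne_zero one_ne_zero
    simp [dl_zero]
  obtain ⟨x₁, y₁, h1⟩ := exists_coords hP
  obtain ⟨x₂, y₂, h2⟩ := exists_coords hQ
  have n1 := dl_ne_zero hs hk P
  have n2 := dl_ne_zero hs hk Q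
  have hkm : (k : K) = algebraMap ℚ K k := by simp
  by_cases hPQ : P + Q = 0
  · obtain ⟨rfl, rfl⟩ := (add_eq_zero_iff' h1 h2).1 hPQ
    have h := h2.eq
    have hx : algebraMap ℚ K x₁ ≠ 0 := by
      intro h0
      have : x₁ = 0 := by simpa using h0
      rw [dl_of s h1] at n1
      rw [dl_of s h2] at n2
      apply mul_ne_zero n1 n2
      have h' := congrArg (algebraMap ℚ K) h
      rw [this] at h'
      simp only [map_pow, map_add, ← hkm, map_zero] at h'
      simp only [map_neg]
      linear_combination -h' + hs
    apply ck_eq (z₁ := - algebraMap ℚ K x₁) (z₂ := 1) (neg_ne_zero.2 hx) one_ne_zero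
    have h' := congrArg (algebraMap ℚ K) h
    simp only [map_pow, map_add, ← hkm] at h'
    simp only [Units.val_mk0, Units.val_mul, dl_of s h1, dl_of s h2, hPQ, dl_zero, map_neg]
    linear_combination -hs + h'
  · obtain ⟨x₃, y₃, h3⟩ := exists_coords hPQ
    have n3 := dl_ne_zero hs hk (P + Q)
    obtain ⟨l, m, e1, e2, e3, v1, v2, v3⟩ := vieta h1 h2 h3
    have n3' : - algebraMap ℚ K y₃ + s ≠ 0 := by
      intro h
      have := (s_lin hs hk (p := -y₃) (q := 1) (by simpa using h)).2
      norm_num at this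
    have hv : (algebraMap ℚ K y₁ + s) * (algebraMap ℚ K y₂ + s) * (- algebraMap ℚ K y₃ + s) =
        (algebraMap ℚ K m + s) ^ 3 := by
      have e3' : - algebraMap ℚ K y₃ = algebraMap ℚ K l * algebraMap ℚ K x₃ + algebraMap ℚ K m := by
        rw [← map_neg, e3]; simp
      have v1' := congrArg (algebraMap ℚ K) v1
      have v2' := congrArg (algebraMap ℚ K) v2
      have v3' := congrArg (algebraMap ℚ K) v3
      rw [e3', e1, e2]
      simp only [map_add, map_mul, map_pow, map_neg, map_sub, ← hkm, map_ofNat] at v1' v2' v3' ⊢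
      linear_combination (algebraMap ℚ K l) ^ 3 * v3' +
        (algebraMap ℚ K l) ^ 2 * (algebraMap ℚ K m + s) * v2' +
        (algebraMap ℚ K l) * (algebraMap ℚ K m + s) ^ 2 * v1' + (algebraMap ℚ K l) ^ 3 * hs
    have he : (algebraMap ℚ K y₃ + s) * (- algebraMap ℚ K y₃ + s) = (- algebraMap ℚ K x₃) ^ 3 := by
      have h' := congrArg (algebraMap ℚ K) h3.eq
      simp only [map_pow, map_add, ← hkm] at h'
      linear_combination hs - h'
    rw [dl_of s h3] at n3
    rw [dl_of s h1] at n1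
    rw [dl_of s h2] at n2
    have hz2 : - algebraMap ℚ K x₃ ≠ 0 := by
      intro h0
      rw [h0] at he
      exact mul_ne_zero n3 n3' (by simpa using he)
    have hz1 : algebraMap ℚ K m + s ≠ 0 := by
      intro h0
      rw [h0] at hv
      exact mul_ne_zero (mul_ne_zero n1 n2) n3' (by simpa using hv)
    apply ck_eq hz1 hz2
    simp only [Units.val_mk0, Units.val_mul, dl_of s h1, dl_of s h2, dl_of s h3]
    rw [← hv, ← he]; ring

/-- the descent homomorphism -/
noncomputable def dlh {k : ℤ} {s : K} (hs : s ^ 2 = k) (hk : ¬ IsSquare (k : ℚ)) :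
    Pt k →+ Additive (CK K) :=
  AddMonoidHom.mk' (fun P => Additive.ofMul (dq hs hk P)) (fun P Q => dq_add hs hk P Q)

end
end MRank

namespace MRank
open NumberField UniqueFactorizationMonoid

lemma int_coords {k : ℤ} {x y : ℚ} (h : y ^ 2 = x ^ 3 + k) :
    ∃ a b c : ℤ, 0 < c ∧ x = a / (c : ℚ) ^ 2 ∧ y = b / (c : ℚ) ^ 3 ∧ IsCoprime a c ∧ IsCoprime b c ∧
      b ^ 2 = a ^ 3 + k * c ^ 6 := by
  have hd : (x.den : ℚ) ≠ 0 := by exact_mod_cast x.den_ne_zero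
  have hf : (y.den : ℚ) ≠ 0 := by exact_mod_cast y.den_ne_zero
  have h1 : y.num ^ 2 * (x.den : ℤ) ^ 3 = (y.den : ℤ) ^ 2 * (x.num ^ 3 + k * (x.den : ℤ) ^ 3) := by
    have h' := h
    rw [← Rat.num_div_den x, ← Rat.num_div_den y] at h'
    field_simp at h'
    have : (y.num : ℚ) ^ 2 * (x.den : ℚ) ^ 3 = (y.den : ℚ) ^ 2 * (x.num ^ 3 + k * (x.den : ℚ) ^ 3) := by
      linear_combination h'
    exact_mod_cast this
  have cx : IsCoprime x.num (x.den : ℤ) := by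
    rw [Int.isCoprime_iff_gcd_eq_one]; exact x.reduced
  have cy : IsCoprime y.num (y.den : ℤ) := by
    rw [Int.isCoprime_iff_gcd_eq_one]; exact y.reduced
  have d1 : (x.den : ℤ) ^ 3 ∣ (y.den : ℤ) ^ 2 := by
    have : IsCoprime ((x.den : ℤ) ^ 3) (x.num ^ 3 + k * (x.den : ℤ) ^ 3) :=
      (mul_comm k ((x.den : ℤ) ^ 3)) ▸ (cx.symm.pow (m := 3) (n := 3)).add_mul_left_right k
    exact this.dvd_of_dvd_mul_right ⟨y.num ^ 2, by rw [← h1]; ring⟩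
  have d2 : (y.den : ℤ) ^ 2 ∣ (x.den : ℤ) ^ 3 :=
    (cy.symm.pow (m := 2) (n := 2)).dvd_of_dvd_mul_left ⟨_, h1⟩
  have e1 : x.den ^ 3 = y.den ^ 2 :=
    Nat.dvd_antisymm (by exact_mod_cast d1) (by exact_mod_cast d2)
  obtain ⟨c, hc⟩ : x.den ∣ y.den := by
    rw [← Nat.pow_dvd_pow_iff (n := 2) (by norm_num), ← e1]
    exact pow_dvd_pow _ (by norm_num)
  have hdp : 0 < x.den := x.den_pos
  have e2 : x.den = c ^ 2 := by
    rw [hc] at e1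
    have : x.den ^ 2 * x.den = x.den ^ 2 * c ^ 2 := by linear_combination e1
    exact Nat.eq_of_mul_eq_mul_left (by positivity) this
  have e3 : y.den = c ^ 3 := by rw [hc, e2]; ring
  have hc0 : 0 < c := by
    rcases Nat.eq_zero_or_pos c with h0 | h0
    · rw [h0] at e2; simp at e2
    · exact h0
  have hx : x = x.num / ((c : ℤ) : ℚ) ^ 2 := by
    conv_lhs => rw [← Rat.num_div_den x, e2]
    push_cast; rfl
  have hy : y = y.num / ((c : ℤ) : ℚ) ^ 3 := by
    conv_lhs => rw [← Rat.num_div_den y, e3]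
    push_cast; rfl
  refine ⟨x.num, y.num, c, by exact_mod_cast hc0, hx, hy, ?_, ?_, ?_⟩
  · rw [e2] at cx; push_cast at cx
    exact (IsCoprime.pow_right_iff (by norm_num)).1 cx
  · rw [e3] at cy; push_cast at cy
    exact (IsCoprime.pow_right_iff (by norm_num)).1 cy
  · rw [hx, hy] at h
    have hcq : ((c : ℤ) : ℚ) ≠ 0 := by exact_mod_cast hc0.ne'
    have : (y.num : ℚ) ^ 2 = x.num ^ 3 + k * ((c : ℤ) : ℚ) ^ 6 := by
      generalize (y.num : ℚ) = Y at *
      generalize (x.num : ℚ) = X at *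
      field_simp at h
      linear_combination h
    exact_mod_cast this

lemma card_range_ofMul {A B : Type*} [AddGroup A] [Group B] (f : A →+ Additive B) (h : A → B)
    (hf : ∀ a, f a = Additive.ofMul (h a)) : Nat.card f.range = (Set.range h).ncard := by
  have : (f.range : Set (Additive B)) = Set.range h := by
    ext b; constructor
    · rintro ⟨a, rfl⟩; exact ⟨a, (hf a).symm⟩
    · rintro ⟨a, rfl⟩; exact ⟨a, hf a⟩
  rw [← this]; rfl

section
variable {K : Type*} [Field K] [NumberField K] {k0 : ℤ}

lemma exists_pq (e : ℤ√k0 ≃+* 𝓞 K) (z : K) :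
    ∃ p q : ℚ, z = algebraMap ℚ K p + algebraMap ℚ K q * (ww e : K) := by
  obtain ⟨r, t, ht, rfl⟩ := IsFractionRing.div_surjective (𝓞 K) z
  have ht0 : t ≠ 0 := nonZeroDivisors.ne_zero ht
  obtain ⟨x, y, hxy⟩ := exists_xy e (r * cj e t)
  obtain ⟨n, hn⟩ : ∃ n : ℤ, t * cj e t = n := by
    obtain ⟨u, v, huv⟩ := exists_xy e t
    exact ⟨u ^ 2 - k0 * v ^ 2, by rw [huv, cj_mk, mul_cj]⟩
  have hcj : cj e t ≠ 0 := by simpa using ht0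
  have hn0 : (n : K) ≠ 0 := by
    have : (n : 𝓞 K) ≠ 0 := by rw [← hn]; exact mul_ne_zero ht0 hcj
    exact_mod_cast fun h => this (by have h' : n = 0 := by exact_mod_cast h
                                     simp [h'])
  refine ⟨x / n, y / n, ?_⟩
  have h1 := congrArg (algebraMap (𝓞 K) K) hxy
  have h2 := congrArg (algebraMap (𝓞 K) K) hn
  simp only [map_mul, map_add, map_intCast] at h1 h2
  have ht0' : algebraMap (𝓞 K) K t ≠ 0 := by simpa using ht0
  have hcj' : algebraMap (𝓞 K) K (cj e t) ≠ 0 := by simpa using hcj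
  rw [map_div₀, map_div₀, map_intCast, map_intCast, map_intCast]
  field_simp
  apply mul_right_cancel₀ hcj'
  linear_combination (n : K) * h1 - (x + y * algebraMap (𝓞 K) K (ww e) : K) * h2

lemma dq_zero {k : ℤ} {s : K} (hs : s ^ 2 = k) (hns : ¬ IsSquare (k : ℚ)) : dq hs hns (0 : Pt k) = 1 :=
  (dlh hs hns).map_zero

lemma dlh_ker {k : ℤ} {s : K} (hs : s ^ 2 = k) (hns : ¬ IsSquare (k : ℚ)) {P : Pt k}
    (hP : P ∈ (dlh hs hns).ker) : dq hs hns P = 1 := (dlh hs hns).mem_ker.1 hP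

lemma selK_ker (e : ℤ√k0 ≃+* 𝓞 K) {D k : ℤ} (hD0 : D ≠ 0)
    (hns : ¬ IsSquare (k : ℚ)) {g : Pt (-27 * k) →+ Pt k} (hg : IsIsog 3 g) (hk0 : k ≠ 0)
    {s : K} (hs_def : s = D * (ww e : K)) (hs : s ^ 2 = k) :
    (dlh hs hns).ker ≤ g.range := by
  intro P hP
  by_cases hP0 : P = 0
  · subst hP0; exact zero_mem _
  obtain ⟨x, y, hxy⟩ := exists_coords hP0
  have h1 := dlh_ker hs hns hP
  rw [dq, QuotientGroup.eq_one_iff] at h1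
  obtain ⟨z, hz⟩ := h1
  have h2 : (z : K) ^ 3 = algebraMap ℚ K y + s := by
    have := congrArg Units.val hz
    simpa [dl_of s hxy] using this
  obtain ⟨p, q', hpq⟩ := exists_pq e (z : K)
  set q := q' / D with hq
  have hpq' : (z : K) = algebraMap ℚ K p + algebraMap ℚ K q * s := by
    rw [hpq, hq, hs_def, map_div₀, map_intCast]
    have : (D : K) ≠ 0 := by exact_mod_cast hD0
    field_simp
  have h4 := s_lin hs hns (p := p ^ 3 + 3 * p * q ^ 2 * k - y) (q := 3 * p ^ 2 * q + q ^ 3 * k - 1) (by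
    rw [hpq'] at h2
    simp only [map_add, map_mul, map_pow, map_sub, map_intCast, map_ofNat, map_one]
    generalize algebraMap ℚ K p = p' at *
    generalize algebraMap ℚ K q = q'' at *
    linear_combination h2 - (3 * p' * q'' ^ 2 + q'' ^ 3 * s) * hs)
  have hX : x = p ^ 2 - q ^ 2 * k := by
    have : x ^ 3 = (p ^ 2 - q ^ 2 * k) ^ 3 := by
      have h5 := hxy.eq
      have h6 : y = p ^ 3 + 3 * p * q ^ 2 * k := by linarith [h4.1]
      have h7 : 3 * p ^ 2 * q + q ^ 3 * k = 1 := by linarith [h4.2]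
      have : x ^ 3 = y ^ 2 - k * 1 ^ 2 := by linarith
      rw [this, ← h7, h6]; ring
    exact (Odd.strictMono_pow (by decide : Odd 3)).injective this
  refine isog_surj (t := 6 * p) (u := 3) (by norm_num) (by push_cast; ring) (by omega) hg hxy ?_
  rw [hX]
  linear_combination 54 * h4.1

lemma selK_range (e : ℤ√k0 ≃+* 𝓞 K) {D k : ℤ} (hD : D ∣ k0) (hD0 : D ≠ 0)
    (hk : k = k0 * D ^ 2) (hns : ¬ IsSquare (k : ℚ))
    {s : K} (hs_def : s = D * (ww e : K)) (hs : s ^ 2 = k) :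
    ∀ P, ∃ c, RC (dq hs hns P) c := by
  intro P
  by_cases hP0 : P = 0
  · subst hP0
    refine ⟨_, 1, 1, 1, by simp [Ideal.one_eq_top, Ideal.top_pow], by simp, ?_, rfl⟩
    rw [dq_zero]; rfl
  obtain ⟨x, y, hxy⟩ := exists_coords hP0
  obtain ⟨a, b, c, hc, hx, hy, hac, hbc, hab⟩ := int_coords hxy.eq
  have ha : a ≠ 0 := by
    rintro rfl
    exact x_ne_zero hns hxy (by rw [hx]; simp)
  obtain ⟨J, hJ⟩ := eta_cube e (b := b) (E := c ^ 3 * D) (a := a) (by rw [hab, hk]; ring) ha (by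
    intro q hq h1 h2 h3
    rcases (Nat.prime_iff_prime_int.1 hq).dvd_or_dvd h3 with h | h
    · have h := (Nat.prime_iff_prime_int.1 hq).dvd_of_dvd_pow h
      have := hac.isUnit_of_dvd' h1 h
      exact absurd this (Nat.prime_iff_prime_int.1 hq).not_isUnit
    · exact h.trans hD)
  have hη : ((b : 𝓞 K) + ((c ^ 3 * D : ℤ) : 𝓞 K) * ww e) ≠ 0 := by
    intro h
    have := (xy_eq_zero e h).2
    rcases mul_eq_zero.1 this with h | h
    · have := pow_eq_zero_iff (by norm_num) |>.1 h; omega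
    · exact hD0 h
  have hJ0 : J ≠ 0 := by
    rintro rfl
    rw [zero_pow (by norm_num), Ideal.zero_eq_bot, Ideal.span_singleton_eq_bot] at hJ
    exact hη hJ
  refine ⟨_, _, ⟨J, mem_nonZeroDivisors_of_ne_zero hJ0⟩,
    Units.mk0 (((b : 𝓞 K) + ((c ^ 3 * D : ℤ) : 𝓞 K) * ww e : 𝓞 K) : K) (RingOfIntegers.coe_ne_zero_iff.2 hη),
    hJ, rfl, ?_, rfl⟩
  unfold dq
  have hcK : (c : K) ≠ 0 := by exact_mod_cast hc.ne'
  apply ck_eq (z₁ := (c : K)) (z₂ := 1) hcK one_ne_zero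
  simp only [Units.val_mk0]
  rw [dl_of s hxy, hy, hs_def]
  simp only [map_div₀, map_pow, map_intCast, map_add, map_mul]
  push_cast
  field_simp

lemma selK_fin {A B : Type*} [AddGroup A] [Group B] (f : A →+ Additive B) (H : AddSubgroup A)
    (hker : f.ker ≤ H) (h : A → B)
    (hf : ∀ a, f a = Additive.ofMul (h a)) (S : Set B) (hS : S.Finite) (hr : ∀ a, h a ∈ S) {n : ℕ}
    (hn : S.ncard ≤ n) : H.index ≠ 0 ∧ H.index ≤ n := by
  have hidx : f.ker.index = Nat.card f.range := AddSubgroup.index_ker _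
  have hsub : Set.range h ⊆ S := by
    rintro _ ⟨P, rfl⟩; exact hr P
  have hrn := card_range_ofMul f h hf
  have hle : f.ker.index ≤ n := by
    rw [hidx, hrn]
    exact (Set.ncard_le_ncard hsub hS).trans hn
  have hpos : f.ker.index ≠ 0 := by
    rw [hidx, hrn]
    have := (Set.ncard_pos (hS.subset hsub)).2 (Set.range_nonempty _)
    omega
  have hdvd := AddSubgroup.index_dvd_of_le hker
  refine ⟨fun h => hpos (by rw [h] at hdvd; exact zero_dvd_iff.1 hdvd), ?_⟩
  exact (Nat.le_of_dvd (Nat.pos_of_ne_zero hpos) hdvd).trans hle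

theorem selK (e : ℤ√k0 ≃+* 𝓞 K) (h3 : ¬ (3 : ℤ) ∣ k0) {D k : ℤ} (hD : D ∣ k0) (hD0 : D ≠ 0)
    (hk : k = k0 * D ^ 2)
    (hns : ¬ IsSquare (k : ℚ)) {g : Pt (-27 * k) →+ Pt k} (hg : IsIsog 3 g) :
    g.range.index ≠ 0 ∧ g.range.index ≤ 3 * Nat.card {x : ClassGroup (𝓞 K) // x ^ 3 = 1} := by
  obtain ⟨s, hs_def⟩ : ∃ s : K, s = D * (ww e : K) := ⟨_, rfl⟩
  have hw2 : (ww e : K) ^ 2 = k0 := by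
    have := congrArg (algebraMap (𝓞 K) K) (ww_sq e)
    simpa using this
  have hs : s ^ 2 = k := by
    rw [hs_def, hk, mul_pow, hw2]; push_cast; ring
  have hk0 : k ≠ 0 := by
    rintro rfl; apply hns; exact ⟨0, by simp⟩
  have hker := selK_ker e hD0 hns hg hk0 hs_def hs
  have hrange := selK_range e hD hD0 hk hns hs_def hs
  obtain ⟨hfin, hcard⟩ := RC_finite e h3 (K := K)
  exact selK_fin (dlh hs hns) g.range hker (dq hs hns) (fun _ => rfl) _ hfin hrange hcard

end
end MRank

namespace MRank

open ArithmeticFunction.vonMangoldt Filter Topology in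
lemma not_summable_inv_primes (q : ℕ) [NeZero q] :
    ¬ Summable fun n : ℕ ↦ (if n.Prime ∧ (n : ZMod q) = 1 then (1 : ℝ) / n else 0) := by
  intro H
  have h1 : IsUnit (1 : ZMod q) := isUnit_one
  obtain ⟨C, hC⟩ := LSeries_residueClass_lower_bound (q := q) h1
  have hs := (summable_residueClass_non_primes_div (q := q) 1).add H
  have key : Tendsto (fun x : ℝ ↦ ∑' n : ℕ, (x - 1) * (residueClass (1 : ZMod q) n / (n : ℝ) ^ x))
      (𝓝[>] 1) (𝓝 (∑' n : ℕ, (0 : ℝ))) := by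
    refine tendsto_tsum_of_dominated_convergence hs ?_ ?_
    · intro n
      apply tendsto_nhdsWithin_of_tendsto_nhds
      rcases Nat.eq_zero_or_pos n with rfl | hn
      · simp
      have hc : ContinuousAt (fun x : ℝ ↦ (x - 1) * (residueClass (1 : ZMod q) n / (n : ℝ) ^ x)) 1 := by
        have : (n : ℝ) ≠ 0 := by positivity
        refine ContinuousAt.mul (by fun_prop) (ContinuousAt.div (by fun_prop) ?_ (by simpa using this))
        exact Real.continuousAt_const_rpow this
      simpa [ContinuousAt] using hc
    · have : Set.Ioc (1 : ℝ) 2 ∈ 𝓝[>] (1 : ℝ) := Ioc_mem_nhdsGT (by norm_num)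
      filter_upwards [this] with x hx n
      have hx1 : 0 < x - 1 := by linarith [hx.1]
      rcases Nat.eq_zero_or_pos n with rfl | hn
      · simp
      have hn1 : (1 : ℝ) ≤ n := by exact_mod_cast hn
      have hn0 : (0 : ℝ) < n := by linarith
      have hr := residueClass_nonneg (1 : ZMod q) n
      rw [Real.norm_of_nonneg (by positivity)]
      by_cases hp : n.Prime
      · by_cases hm : (n : ZMod q) = 1
        · simp only [hp, hm, if_true, true_and, zero_div, zero_add]
          have : residueClass (1 : ZMod q) n = Real.log n := by
            rw [residueClass, Set.indicator_of_mem (by simpa using hm)]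
            exact ArithmeticFunction.vonMangoldt_apply_prime hp
          rw [this]
          have e1 : (n : ℝ) ^ x = n * Real.exp (Real.log n * (x - 1)) := by
            rw [← Real.rpow_def_of_pos hn0]
            nth_rewrite 2 [← Real.rpow_one (n : ℝ)]
            rw [← Real.rpow_add hn0]; congr 1; ring
          rw [e1, ← mul_div_assoc, div_le_div_iff₀ (by positivity) hn0, one_mul]
          have := Real.add_one_le_exp (Real.log n * (x - 1))
          nlinarith
        · have : residueClass (1 : ZMod q) n = 0 := by
            rw [residueClass, Set.indicator_of_notMem (by simpa using hm)]
          simp [this, hp, hm]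
      · simp only [hp, if_false, false_and, add_zero]
        calc (x - 1) * (residueClass (1 : ZMod q) n / (n : ℝ) ^ x)
            ≤ 1 * (residueClass (1 : ZMod q) n / (n : ℝ) ^ x) := by
              apply mul_le_mul_of_nonneg_right (by linarith [hx.2]) (by positivity)
          _ ≤ _ := by
              rw [one_mul]
              refine div_le_div_of_nonneg_left hr hn0 ?_
              conv_lhs => rw [← Real.rpow_one n]
              exact Real.rpow_le_rpow_of_exponent_le hn1 hx.1.le
  rw [tsum_zero] at key
  have hl : Tendsto (fun x : ℝ ↦ (q.totient : ℝ)⁻¹ - C * (x - 1)) (𝓝[>] 1)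
      (𝓝 ((q.totient : ℝ)⁻¹)) := by
    apply tendsto_nhdsWithin_of_tendsto_nhds
    have hc : ContinuousAt (fun x : ℝ ↦ (q.totient : ℝ)⁻¹ - C * (x - 1)) 1 := by fun_prop
    simpa [ContinuousAt] using hc
  have hle : (q.totient : ℝ)⁻¹ ≤ 0 := by
    refine le_of_tendsto_of_tendsto hl key ?_
    have : Set.Ioc (1 : ℝ) 2 ∈ 𝓝[>] (1 : ℝ) := Ioc_mem_nhdsGT (by norm_num)
    filter_upwards [this] with x hx
    have hx1 : 0 < x - 1 := by linarith [hx.1]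
    rw [tsum_mul_left]
    have := mul_le_mul_of_nonneg_left (hC hx) hx1.le
    rw [mul_sub, mul_div_cancel₀ _ hx1.ne'] at this
    linarith
  have hq : 0 < (q.totient : ℝ)⁻¹ := inv_pos.mpr (mod_cast q.totient.pos_of_neZero)
  linarith

/-- Finite sets of primes `≡ 1 mod q` with large `∏ (1+1/p)`. -/
lemma exists_primes_prod (q : ℕ) [NeZero q] (N : ℕ) (C : ℝ) :
    ∃ S : Finset ℕ, (∀ p ∈ S, p.Prime ∧ (p : ZMod q) = 1 ∧ N < p) ∧
      C ≤ ∏ p ∈ S, (1 + 1 / (p : ℝ)) := by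
  classical
  by_contra hcon
  push Not at hcon
  apply not_summable_inv_primes q
  set f : ℕ → ℝ := fun n : ℕ ↦ (if n.Prime ∧ (n : ZMod q) = 1 then (1 : ℝ) / n else 0) with hf
  rw [← summable_nat_add_iff (N + 1)]
  refine summable_of_sum_le (c := C) (fun n => by simp only [hf]; split_ifs <;> positivity) ?_
  intro u
  let S := (u.image (fun n => n + (N + 1))).filter (fun n : ℕ => n.Prime ∧ (n : ZMod q) = 1)
  have h := hcon S (by
    intro p hp
    simp only [S, Finset.mem_filter, Finset.mem_image] at hp
    obtain ⟨⟨n, _, rfl⟩, h1, h2⟩ := hp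
    exact ⟨h1, h2, by omega⟩)
  have e : ∑ x ∈ u, f (x + (N + 1)) = ∑ p ∈ S, 1 / (p : ℝ) := by
    rw [Finset.sum_filter, Finset.sum_image (by intro a _ b _ h; simpa using h)]
  rw [e]
  have hb : ∀ T : Finset ℕ, ∑ p ∈ T, 1 / (p : ℝ) ≤ ∏ p ∈ T, (1 + 1 / (p : ℝ)) := by
    intro T
    have : ∀ T : Finset ℕ, 1 + ∑ p ∈ T, 1 / (p : ℝ) ≤ ∏ p ∈ T, (1 + 1 / (p : ℝ)) := by
      intro T
      induction T using Finset.induction_on with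
      | empty => simp
      | insert a s ha ih =>
        rw [Finset.sum_insert ha, Finset.prod_insert ha]
        have h0 : (0 : ℝ) ≤ 1 / (a : ℝ) := by positivity
        have h1 : (0 : ℝ) ≤ ∑ p ∈ s, 1 / (p : ℝ) := Finset.sum_nonneg (fun _ _ => by positivity)
        nlinarith
    linarith [this T]
  exact (hb S).trans h.le

end MRank

namespace MRank

open Filter Topology in
lemma counting_contra {F : Type*} [Field F] [NumberField F] (B : ℕ) (hB : 0 < B) (q : ℕ) [NeZero q]
    (P Q : ℕ → Ideal (NumberField.RingOfIntegers F))
    (hP : ∀ p, p.Prime → ¬ p ∣ B → (P p).IsPrime ∧ Ideal.absNorm (P p) = p)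
    (hQ : ∀ p, p.Prime → ¬ p ∣ B → (p : ZMod q) = 1 →
      (Q p).IsPrime ∧ Ideal.absNorm (Q p) = p ∧ Q p ≠ P p) : False := by
  classical
  have hlim := NumberField.Ideal.tendsto_norm_le_div_atTop F
  set κ := (2 ^ NumberField.InfinitePlace.nrRealPlaces F * (2 * Real.pi) ^
    NumberField.InfinitePlace.nrComplexPlaces F * NumberField.Units.regulator F *
    NumberField.classNumber F : ℝ) / (NumberField.Units.torsionOrder F *
    Real.sqrt |(NumberField.discr F : ℤ)|) with hκ
  obtain ⟨S, hS, hSC⟩ := exists_primes_prod q B (B * (κ + 1))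
  have hSB : ∀ p ∈ S, ¬ p ∣ B := fun p hp hd =>
    absurd (Nat.le_of_dvd hB hd) (by have := (hS p hp).2.2; omega)
  have hpp : ∀ {I : Ideal (NumberField.RingOfIntegers F)} {p : ℕ}, p.Prime → I.IsPrime →
      Ideal.absNorm I = p → Prime I := by
    intro I p hp h1 h2
    refine (Ideal.prime_iff_isPrime ?_).2 h1
    rintro rfl
    simp at h2; exact hp.ne_zero h2.symm
  have heq : ∀ {I J : Ideal (NumberField.RingOfIntegers F)}, Prime I → Prime J → I ∣ J → I = J :=
    fun h1 h2 h => associated_iff_eq.1 (h1.dvd_prime_iff_associated h2 |>.1 h)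
  let In : ℕ → Ideal (NumberField.RingOfIntegers F) := fun n => (n.primeFactorsList.map P).prod
  let J : (Σ _ : Finset ℕ, ℕ) → Ideal (NumberField.RingOfIntegers F) :=
    fun x => In (B * x.2 + 1) * ∏ p ∈ x.1, Q p
  have hnB : ∀ j p, p ∈ (B * j + 1).primeFactorsList → ¬ p ∣ B := by
    intro j p hp hd
    have h1 := Nat.prime_of_mem_primeFactorsList hp
    have h2 := Nat.dvd_of_mem_primeFactorsList hp
    have : p ∣ 1 := (Nat.dvd_add_right (hd.mul_right j)).1 h2
    exact h1.one_lt.ne' (Nat.dvd_one.1 this)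
  have hInorm : ∀ j, Ideal.absNorm (In (B * j + 1)) = B * j + 1 := by
    intro j
    simp only [In]
    rw [map_list_prod, List.map_map]
    conv_rhs => rw [← Nat.prod_primeFactorsList (n := B * j + 1) (by omega)]
    congr 1
    conv_rhs => rw [← List.map_id (B * j + 1).primeFactorsList]
    apply List.map_congr_left
    intro p hp
    simpa using (hP p (Nat.prime_of_mem_primeFactorsList hp) (hnB j p hp)).2
  have hJnorm : ∀ T ⊆ S, ∀ j, Ideal.absNorm (J ⟨T, j⟩) = (B * j + 1) * ∏ p ∈ T, p := by
    intro T hT j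
    simp only [J]
    rw [map_mul, hInorm, map_prod]
    congr 1
    apply Finset.prod_congr rfl
    intro p hp
    have := hS p (hT hp)
    exact (hQ p this.1 (hSB p (hT hp)) this.2.1).2.1
  have hQJ : ∀ T ⊆ S, ∀ j, ∀ p ∈ S, (Q p ∣ J ⟨T, j⟩ ↔ p ∈ T) := by
    intro T hT j p hp
    have hp1 := hS p hp
    have hp2 := hQ p hp1.1 (hSB p hp) hp1.2.1
    have hpr := hpp hp1.1 hp2.1 hp2.2.1
    constructor
    · intro h
      simp only [J] at h
      rcases hpr.dvd_or_dvd h with h | h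
      · simp only [In] at h
        obtain ⟨I, hI, hd⟩ := (Prime.dvd_prod_iff hpr).1 h
        obtain ⟨p', hp', rfl⟩ := List.mem_map.1 hI
        have hp's := Nat.prime_of_mem_primeFactorsList hp'
        have h3 := hP p' hp's (hnB j p' hp')
        have h4 := heq hpr (hpp hp's h3.1 h3.2) hd
        have : p = p' := by rw [← hp2.2.1, ← h3.2, h4]
        subst this
        exact absurd h4 hp2.2.2
      · obtain ⟨p', hp', hd⟩ := (Prime.dvd_finsetProd_iff hpr _).1 h
        have h1' := hS p' (hT hp')
        have h2' := hQ p' h1'.1 (hSB p' (hT hp')) h1'.2.1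
        have h4 := heq hpr (hpp h1'.1 h2'.1 h2'.2.1) hd
        have : p = p' := by rw [← hp2.2.1, ← h2'.2.1, h4]
        exact this ▸ hp'
    · intro h
      exact (Finset.dvd_prod_of_mem Q h).mul_left _
  have hinj : ∀ T₁ ⊆ S, ∀ T₂ ⊆ S, ∀ j₁ j₂, J ⟨T₁, j₁⟩ = J ⟨T₂, j₂⟩ → T₁ = T₂ ∧ j₁ = j₂ := by
    intro T₁ h1 T₂ h2 j₁ j₂ h
    have hT : T₁ = T₂ := by
      ext p
      constructor
      · intro hp; rw [← hQJ T₂ h2 j₂ p (h1 hp), ← h, hQJ T₁ h1 j₁ p (h1 hp)]; exact hp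
      · intro hp; rw [← hQJ T₁ h1 j₁ p (h2 hp), h, hQJ T₂ h2 j₂ p (h2 hp)]; exact hp
    subst hT
    refine ⟨rfl, ?_⟩
    have := congrArg Ideal.absNorm h
    rw [hJnorm _ h1, hJnorm _ h1] at this
    have hpos : 0 < ∏ p ∈ T₁, p := Finset.prod_pos fun p hp => (hS p (h1 hp)).1.pos
    have := Nat.eq_of_mul_eq_mul_right hpos this
    have := Nat.eq_of_mul_eq_mul_left hB (Nat.succ.inj this)
    exact this
  have hSpos : 0 < ∏ p ∈ S, p := Finset.prod_pos fun p hp => (hS p hp).1.pos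
  have hcount : ∀ m : ℕ, m * ∏ p ∈ S, (1 + p) ≤
      Nat.card {I : Ideal (NumberField.RingOfIntegers F) //
        (Ideal.absNorm I : ℝ) ≤ ((m * (B * ∏ p ∈ S, p) : ℕ) : ℝ)} := by
    intro m
    let X : Finset (Σ _ : Finset ℕ, ℕ) :=
      S.powerset.sigma fun T => Finset.range (m * ∏ p ∈ S \ T, p)
    have hX : X.card = m * ∏ p ∈ S, (1 + p) := by
      simp only [X, Finset.card_sigma, Finset.card_range]
      rw [← Finset.mul_sum, Finset.prod_add]
      simp
    rw [← hX, ← Set.ncard_coe_finset, ← Set.InjOn.ncard_image (f := J) (s := (X : Set _))]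
    · have : Nat.card {I : Ideal (NumberField.RingOfIntegers F) //
        (Ideal.absNorm I : ℝ) ≤ ((m * (B * ∏ p ∈ S, p) : ℕ) : ℝ)} =
        Set.ncard {I : Ideal (NumberField.RingOfIntegers F) |
          Ideal.absNorm I ≤ m * (B * ∏ p ∈ S, p)} := by
        rw [← Nat.card_coe_set_eq]
        congr 1
        simp only [Nat.cast_le]
        rfl
      rw [this]
      apply Set.ncard_le_ncard
      · rintro _ ⟨⟨T, j⟩, hx, rfl⟩
        simp only [X, Finset.coe_sigma, Set.mem_sigma_iff, Finset.mem_coe, Finset.mem_powerset,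
          Finset.mem_range] at hx
        rw [Set.mem_ofPred_eq, hJnorm T hx.1]
        calc (B * j + 1) * ∏ p ∈ T, p ≤ (B * (m * ∏ p ∈ S \ T, p)) * ∏ p ∈ T, p := by
              apply Nat.mul_le_mul_right
              have : B * (j + 1) ≤ B * (m * ∏ p ∈ S \ T, p) := Nat.mul_le_mul_left _ hx.2
              nlinarith
          _ = m * (B * ((∏ p ∈ S \ T, p) * ∏ p ∈ T, p)) := by ring
          _ = _ := by rw [Finset.prod_sdiff hx.1]
      · exact Ideal.finite_setOfPred_absNorm_le _
    · rintro ⟨T₁, j₁⟩ h1 ⟨T₂, j₂⟩ h2 h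
      simp only [X, Finset.coe_sigma, Set.mem_sigma_iff, Finset.mem_coe, Finset.mem_powerset,
          Finset.mem_range] at h1 h2
      obtain ⟨rfl, rfl⟩ := hinj T₁ h1.1 T₂ h2.1 j₁ j₂ h
      rfl
  have hBS : (0 : ℝ) < ((B * ∏ p ∈ S, p : ℕ) : ℝ) := by exact_mod_cast Nat.mul_pos hB hSpos
  have ht : Tendsto (fun m : ℕ => ((m * (B * ∏ p ∈ S, p) : ℕ) : ℝ)) atTop atTop := by
    push_cast
    push_cast at hBS
    exact tendsto_natCast_atTop_atTop.atTop_mul_const hBS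
  have hlim2 := hlim.comp ht
  have hge : (∏ p ∈ S, (1 + p) : ℕ) / ((B * ∏ p ∈ S, p : ℕ) : ℝ) ≤ κ := by
    refine ge_of_tendsto hlim2 ?_
    filter_upwards [eventually_gt_atTop 0] with m hm
    have hm' : (0 : ℝ) < m := by exact_mod_cast hm
    simp only [Function.comp]
    rw [le_div_iff₀ (by rw [Nat.cast_mul]; positivity)]
    have := hcount m
    have h2 : ((m * ∏ p ∈ S, (1 + p) : ℕ) : ℝ) ≤ _ := Nat.cast_le.2 this
    refine le_trans (le_of_eq ?_) h2
    rw [Nat.cast_mul m, Nat.cast_mul m]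
    field_simp
  have : ((∏ p ∈ S, (1 + p) : ℕ) : ℝ) / ((B * ∏ p ∈ S, p : ℕ) : ℝ) =
      (∏ p ∈ S, (1 + 1 / (p : ℝ))) / B := by
    push_cast
    rw [mul_comm, ← div_div, ← Finset.prod_div_distrib]
    congr 1
    apply Finset.prod_congr rfl
    intro p hp
    have : (p : ℝ) ≠ 0 := by exact_mod_cast (hS p hp).1.ne_zero
    field_simp
    ring
  rw [this] at hge
  have hB' : (0 : ℝ) < B := by exact_mod_cast hB
  rw [div_le_iff₀ hB'] at hge
  nlinarith

end MRank

namespace MRank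

open Polynomial NumberField in
lemma exponent_ne_zero' {F : Type*} [Field F] [NumberField F] (θ : 𝓞 F)
    (h : ∀ x : F, ∃ g : ℚ[X], aeval (θ : F) g = x) : RingOfIntegers.exponent θ ≠ 0 := by
  classical
  have h1 : ∀ x : 𝓞 F, ∃ n : ℤ, n ≠ 0 ∧ (n : 𝓞 F) * x ∈ Algebra.adjoin ℤ {θ} := by
    intro x
    obtain ⟨g, hg⟩ := h x
    obtain ⟨b, hb0, hb⟩ := IsLocalization.integerNormalization_spec (nonZeroDivisors ℤ) g
    refine ⟨b, nonZeroDivisors.ne_zero hb0, ?_⟩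
    have : (b : 𝓞 F) * x =
        aeval θ (IsLocalization.integerNormalization (nonZeroDivisors ℤ) g) := by
      apply FaithfulSMul.algebraMap_injective (𝓞 F) F
      rw [← aeval_algebraMap_apply, ← aeval_map_algebraMap ℚ, hb]
      simp only [map_mul, map_intCast]
      rw [map_zsmul, zsmul_eq_mul]
      congr 1
      exact hg.symm
    rw [this]
    exact aeval_mem_adjoin_singleton ℤ θ
  choose n hn0 hn using h1
  obtain ⟨s, hs⟩ := (Module.Finite.fg_top : (⊤ : Submodule ℤ (𝓞 F)).FG)
  let N : ℤ := ∏ x ∈ s, n x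
  have hN : N ≠ 0 := Finset.prod_ne_zero_iff.2 fun x _ => hn0 x
  have hall : ∀ x : 𝓞 F, (N : 𝓞 F) * x ∈ Algebra.adjoin ℤ {θ} := by
    intro x
    have hx : x ∈ Submodule.span ℤ (s : Set (𝓞 F)) := by rw [hs]; trivial
    induction hx using Submodule.span_induction with
    | mem x hx =>
      have : N = (∏ y ∈ s.erase x, n y) * n x := by
        rw [mul_comm]; exact (Finset.mul_prod_erase s n hx).symm
      rw [this, Int.cast_mul, mul_assoc]
      exact Subalgebra.mul_mem _ (intCast_mem _ _) (hn x)
    | zero => simp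
    | add x y _ _ hx hy => rw [mul_add]; exact Subalgebra.add_mem _ hx hy
    | smul a x _ hx => rw [mul_smul_comm]; exact Subalgebra.smul_mem _ hx a
  have hmem : N ∈ Ideal.under ℤ (conductor ℤ θ) := by
    rw [Ideal.under_def, Ideal.mem_comap, mem_conductor_iff]
    intro b
    simpa using hall b
  rw [RingOfIntegers.exponent, Ne, Ideal.absNorm_eq_zero_iff]
  intro h0
  rw [h0] at hmem
  exact hN (by simpa using hmem)

open Polynomial NumberField in
lemma exists_numberField (g : ℚ[X]) (hirr : Irreducible g) :
    ∃ (F : Type) (_ : Field F) (_ : NumberField F) (θ : F), aeval θ g = 0 ∧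
      ∀ x : F, ∃ h : ℚ[X], aeval θ h = x := by
  haveI : Fact (Irreducible g) := ⟨hirr⟩
  have h2 : FiniteDimensional ℚ (AdjoinRoot g) := (AdjoinRoot.powerBasis hirr.ne_zero).finite
  have he : ∀ (x : AdjoinRoot g) (h : ℚ[X]), @aeval ℚ (AdjoinRoot g) _ _ DivisionRing.toRatAlgebra x h
      = h.eval₂ (AdjoinRoot.of g) x := by
    intro x h
    rw [aeval_def]
    congr 1
  refine ⟨AdjoinRoot g, inferInstance, ?_, AdjoinRoot.root g, ?_, ?_⟩
  · haveI : CharZero (AdjoinRoot g) := inferInstance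
    refine { to_finiteDimensional := ?_ }
    convert! h2
  · rw [he]; exact AdjoinRoot.eval₂_root g
  · intro x
    obtain ⟨h, rfl⟩ := AdjoinRoot.mk_surjective x
    refine ⟨h, ?_⟩
    rw [he, ← AdjoinRoot.aeval_eq, aeval_def]
    rfl

open Polynomial NumberField RingOfIntegers in
lemma cubic_has_root (a b : ℤ) (B : ℕ) (hB : 0 < B) (q : ℕ) [NeZero q]
    (h1 : ∀ p : ℕ, p.Prime → ¬ p ∣ B → ∃ t : ZMod p, t ^ 3 - 3 * (a : ZMod p) * t - 2 * b = 0)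
    (h2 : ∀ p : ℕ, p.Prime → ¬ p ∣ B → (p : ZMod q) = 1 → ∃ t s : ZMod p, t ≠ s ∧
      t ^ 3 - 3 * (a : ZMod p) * t - 2 * b = 0 ∧ s ^ 3 - 3 * (a : ZMod p) * s - 2 * b = 0) :
    ∃ t : ℚ, t ^ 3 - 3 * a * t - 2 * b = 0 := by
  classical
  by_contra hcon
  push Not at hcon
  let f : ℤ[X] := X ^ 3 - C (3 * a) * X - C (2 * b)
  have hfm : f.Monic := by simp only [f]; monicity!
  have hfd : f.natDegree = 3 := by simp only [f]; compute_degree!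
  have hev : ∀ {R : Type} [CommRing R] (t : R),
      aeval t f = t ^ 3 - 3 * (a : R) * t - 2 * b := by
    intro R _ t
    simp only [f, map_sub, map_mul, map_pow, aeval_X, aeval_C]
    simp
  let g : ℚ[X] := f.map (Int.castRingHom ℚ)
  have hgm : g.Monic := hfm.map _
  have hgd : g.natDegree = 3 := by rw [hfm.natDegree_map, hfd]
  have hirr : Irreducible g := by
    apply irreducible_of_degree_le_three_of_not_isRoot
    · rw [hgd]; decide
    · intro x hx
      apply hcon x
      rw [← hev, aeval_def, ← eval_map]
      exact hx
  obtain ⟨F, _, _, θ0, hroot, hgen⟩ := exists_numberField g hirr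
  have hroot' : aeval θ0 f = 0 := by
    rw [← hroot]
    exact (aeval_map_algebraMap ℚ θ0 f).symm
  have hInteg : IsIntegral ℤ θ0 := ⟨f, hfm, by rw [← aeval_def]; exact hroot'⟩
  let θ : 𝓞 F := ⟨θ0, hInteg⟩
  have hmin : minpoly ℤ θ = f := by
    have e1 : minpoly ℤ θ = minpoly ℤ θ0 :=
      (minpoly.algebraMap_eq (FaithfulSMul.algebraMap_injective (𝓞 F) F) θ).symm
    have e2 := minpoly.isIntegrallyClosed_eq_field_fractions' ℚ hInteg
    have e3 : minpoly ℚ θ0 = g := (minpoly.eq_of_irreducible_of_monic hirr hroot hgm).symm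
    rw [e3] at e2
    rw [e1]
    exact (map_injective (algebraMap ℤ ℚ) (FaithfulSMul.algebraMap_injective ℤ ℚ) e2).symm
  have hexp : RingOfIntegers.exponent θ ≠ 0 := exponent_ne_zero' θ hgen
  have key : ∀ p : ℕ, ∀ [Fact p.Prime], ¬ p ∣ RingOfIntegers.exponent θ →
      ∃ I : {t : ZMod p // t ^ 3 - 3 * (a : ZMod p) * t - 2 * b = 0} → Ideal (𝓞 F),
        Function.Injective I ∧ ∀ t, (I t).IsPrime ∧ Ideal.absNorm (I t) = p := by
    intro p _ hp
    have hmem : ∀ t : {t : ZMod p // t ^ 3 - 3 * (a : ZMod p) * t - 2 * b = 0},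
        (X - C t.1) ∈ monicFactorsMod θ p := by
      rintro ⟨t, ht⟩
      rw [monicFactorsMod, Multiset.mem_toFinset, hmin,
        Polynomial.mem_normalizedFactors_iff (hfm.map _).ne_zero]
      refine ⟨irreducible_X_sub_C t, monic_X_sub_C t, ?_⟩
      rw [dvd_iff_isRoot, IsRoot, eval_map]
      have := hev t
      rw [ht, aeval_def] at this
      exact this
    let E := NumberField.Ideal.primesOverSpanEquivMonicFactorsMod hp
    refine ⟨fun t => (E.symm ⟨_, hmem t⟩).1, ?_, ?_⟩
    · intro t s h
      have h3 := E.symm.injective (Subtype.ext h)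
      have h4 : (X - C t.1 : (ZMod p)[X]) = X - C s.1 := congrArg Subtype.val h3
      exact Subtype.ext (by simpa using h4)
    · intro t
      have hd := NumberField.Ideal.inertiaDeg_primesOverSpanEquivMonicFactorsMod_symm_apply' hp
        (hmem t)
      rw [natDegree_X_sub_C] at hd
      set I := (E.symm ⟨_, hmem t⟩) with hI
      haveI : (I.1).LiesOver (Ideal.span {(p : ℤ)}) := I.2.2
      haveI : (I.1).IsPrime := I.2.1
      refine ⟨I.2.1, ?_⟩
      have h5 := Ideal.absNorm_eq_pow_inertiaDeg I.1 (p := (p : ℤ))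
        (Nat.prime_iff_prime_int.1 Fact.out)
      haveI := Int.ideal_span_isMaximal_of_prime p
      haveI : (I.1).IsMaximal := Ideal.primesOver.isMaximal I
      rw [Ideal.inertiaDeg'_eq_inertiaDeg, hd] at h5
      simpa using h5
  have hx : ∀ p : ℕ, ∃ PQ : Ideal (𝓞 F) × Ideal (𝓞 F), p.Prime →
      ¬ p ∣ B * RingOfIntegers.exponent θ → (PQ.1.IsPrime ∧ Ideal.absNorm PQ.1 = p) ∧
      ((p : ZMod q) = 1 → PQ.2.IsPrime ∧ Ideal.absNorm PQ.2 = p ∧ PQ.2 ≠ PQ.1) := by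
    intro p
    by_cases hp : p.Prime
    swap
    · exact ⟨(⊥, ⊥), fun h => absurd h hp⟩
    by_cases hd : p ∣ B * RingOfIntegers.exponent θ
    · exact ⟨(⊥, ⊥), fun _ h => absurd hd h⟩
    haveI : Fact p.Prime := ⟨hp⟩
    have hd1 : ¬ p ∣ B := fun h => hd (h.mul_right _)
    obtain ⟨I, hI, hI2⟩ := key p (fun h => hd (h.mul_left _))
    by_cases hq : (p : ZMod q) = 1
    · obtain ⟨t, s, hts, ht, hs⟩ := h2 p hp hd1 hq
      refine ⟨(I ⟨t, ht⟩, I ⟨s, hs⟩), fun _ _ => ⟨hI2 _, fun _ => ⟨(hI2 _).1, (hI2 _).2, ?_⟩⟩⟩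
      intro h
      exact hts (congrArg Subtype.val (hI h)).symm
    · obtain ⟨t, ht⟩ := h1 p hp hd1
      exact ⟨(I ⟨t, ht⟩, ⊥), fun _ _ => ⟨hI2 _, fun h => absurd h hq⟩⟩
  choose PQ hPQ using hx
  exact counting_contra (B * RingOfIntegers.exponent θ) (Nat.mul_pos hB (Nat.pos_of_ne_zero hexp)) q
    (fun p => (PQ p).1) (fun p => (PQ p).2) (fun p hp hd => (hPQ p hp hd).1)
    (fun p hp hd => (hPQ p hp hd).2)

end MRank

namespace MRank

section c3
variable {k : Type*} [CommRing k]

open Classical in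
/-- Cubic residue symbol (additively written) of `x` in a finite field `k` with respect to the
cube root of unity `w`. -/
noncomputable def c3 (w x : k) : ZMod 3 :=
  if x ^ ((Nat.card k - 1) / 3) = w then 1
  else if x ^ ((Nat.card k - 1) / 3) = w ^ 2 then 2 else 0

variable [IsDomain k] {w : k}

lemma w_cube (hw : w ^ 2 + w + 1 = 0) : w ^ 3 = 1 := by
  linear_combination (w - 1) * hw

lemma w_pow_mod (hw : w ^ 2 + w + 1 = 0) (n : ℕ) : w ^ n = w ^ (n % 3) := by
  conv_lhs => rw [← Nat.div_add_mod n 3]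
  rw [pow_add, pow_mul, w_cube hw, one_pow, one_mul]

lemma w_pow_inj (hw : w ^ 2 + w + 1 = 0) (h1 : w ≠ 1) {m n : ℕ} (h : w ^ m = w ^ n) :
    (m : ZMod 3) = n := by
  have h0 : w ≠ 0 := by rintro rfl; simp at hw
  have h12 : w ≠ w ^ 2 := fun h => h1 (mul_left_cancel₀ h0 (by linear_combination -h))
  have h02 : (1 : k) ≠ w ^ 2 := fun h => h12 (by
    have := w_cube hw
    have : w * 1 = w * w ^ 2 := by rw [← h]
    linear_combination this + w_cube hw + h)
  rw [w_pow_mod hw m, w_pow_mod hw n] at h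
  rw [ZMod.natCast_eq_natCast_iff']
  have hm := Nat.mod_lt m (show 3 > 0 by norm_num)
  have hn := Nat.mod_lt n (show 3 > 0 by norm_num)
  generalize m % 3 = m' at *
  generalize n % 3 = n' at *
  interval_cases m' <;> interval_cases n' <;> first | rfl | (exfalso; simp only [pow_zero, pow_one] at h; first | exact h1 h | exact h1 h.symm | exact h12 h | exact h12 h.symm | exact h02 h | exact h02 h.symm)

variable [Finite k]

lemma pow_card' {x : k} (hx : x ≠ 0) : x ^ (Nat.card k - 1) = 1 := by
  classical
  letI := Fintype.ofFinite k
  letI := Fintype.fieldOfDomain k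
  rw [Nat.card_eq_fintype_card]
  exact FiniteField.pow_card_sub_one_eq_one x hx

lemma three_dvd (hw : w ^ 2 + w + 1 = 0) (h1 : w ≠ 1) : 3 ∣ Nat.card k - 1 := by
  have h0 : w ≠ 0 := by rintro rfl; simp at hw
  have h := pow_card' h0
  have h2 := w_pow_inj hw h1 (m := Nat.card k - 1) (n := 0) (by simpa using h)
  rw [ZMod.natCast_eq_natCast_iff'] at h2
  omega

lemma c3_spec (hw : w ^ 2 + w + 1 = 0) (h1 : w ≠ 1) {x : k} (hx : x ≠ 0) :
    x ^ ((Nat.card k - 1) / 3) = w ^ (c3 w x).val := by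
  have h3 := three_dvd hw h1
  set y := x ^ ((Nat.card k - 1) / 3) with hy
  have hy3 : y ^ 3 = 1 := by
    rw [hy, ← pow_mul, Nat.div_mul_cancel h3, pow_card' hx]
  have : (y - 1) * ((y - w) * (y - w ^ 2)) = 0 := by
    linear_combination hy3 + (-y ^ 2 + y) * hw + (y - 1) * w_cube hw
  have e2 : (2 : ZMod 3).val = 2 := rfl
  have e1 : (1 : ZMod 3).val = 1 := rfl
  unfold c3
  rw [← hy]
  split_ifs with ha hb
  · rw [ha, e1, pow_one]
  · rw [hb, e2]
  · rcases mul_eq_zero.1 this with h | h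
    · rw [sub_eq_zero.1 h]; simp
    · rcases mul_eq_zero.1 h with h | h
      · exact absurd (sub_eq_zero.1 h) ha
      · exact absurd (sub_eq_zero.1 h) hb

lemma c3_eq (hw : w ^ 2 + w + 1 = 0) (h1 : w ≠ 1) {x : k} (hx : x ≠ 0) {n : ℕ}
    (h : x ^ ((Nat.card k - 1) / 3) = w ^ n) : c3 w x = n := by
  rw [c3_spec hw h1 hx] at h
  have := w_pow_inj hw h1 h
  rw [← this]; simp

lemma c3_mul (hw : w ^ 2 + w + 1 = 0) (h1 : w ≠ 1) {x y : k} (hx : x ≠ 0) (hy : y ≠ 0) :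
    c3 w (x * y) = c3 w x + c3 w y := by
  rw [c3_eq hw h1 (mul_ne_zero hx hy) (n := (c3 w x).val + (c3 w y).val)]
  · simp
  · rw [mul_pow, c3_spec hw h1 hx, c3_spec hw h1 hy, pow_add]

lemma c3_cube (hw : w ^ 2 + w + 1 = 0) (h1 : w ≠ 1) {x : k} (hx : x ≠ 0) :
    c3 w (x ^ 3) = 0 := by
  rw [pow_succ, pow_two, c3_mul hw h1 (mul_ne_zero hx hx) hx, c3_mul hw h1 hx hx]
  generalize c3 w x = s
  revert s; decide

lemma c3_map {k' : Type*} [CommRing k'] [IsDomain k'] [Finite k'] (f : k ≃+* k')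
    (hw : w ^ 2 + w + 1 = 0) (h1 : w ≠ 1) {x : k} (hx : x ≠ 0) :
    c3 (f w) (f x) = c3 w x := by
  have hw' : (f w) ^ 2 + f w + 1 = 0 := by
    rw [← map_pow, ← map_add, ← map_one f, ← map_add, hw, map_zero]
  have h1' : f w ≠ 1 := fun h => h1 (f.injective (by rw [h, map_one]))
  rw [c3_eq hw' h1' (x := f x) (n := (c3 w x).val) ((map_ne_zero_iff f f.injective).2 hx)]
  · simp
  · rw [← Nat.card_congr f.toEquiv, ← map_pow, ← map_pow, c3_spec hw h1 hx]

lemma c3_inv (hw : w ^ 2 + w + 1 = 0) (h1 : w ≠ 1) {x : k} (hx : x ≠ 0) :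
    c3 (w ^ 2) x = - c3 w x := by
  have hw' : (w ^ 2) ^ 2 + w ^ 2 + 1 = 0 := by linear_combination hw + w * w_cube hw
  have h1' : w ^ 2 ≠ 1 := by
    intro h
    have := w_cube hw
    exact h1 (by linear_combination this - w * h)
  rw [c3_eq hw' h1' hx (n := 2 * (c3 w x).val)]
  · push_cast
    simp only [ZMod.natCast_val, ZMod.cast_id', id]
    generalize c3 w x = s
    revert s; decide
  · rw [← pow_mul, ← mul_assoc, pow_mul w (2 * 2), c3_spec hw h1 hx]
    congr 1
    linear_combination -w * w_cube hw

lemma exists_cube_root (hw : w ^ 2 + w + 1 = 0) (h1 : w ≠ 1) {x : k} (hx : x ≠ 0)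
    (h : c3 w x = 0) : ∃ z : k, z ^ 3 = x := by
  classical
  have h3 := three_dvd hw h1
  have hs := c3_spec hw h1 hx
  rw [h] at hs
  letI := Fintype.ofFinite k
  letI := Fintype.fieldOfDomain k
  obtain ⟨g, hg⟩ := IsCyclic.exists_generator (α := kˣ)
  obtain ⟨i, hi⟩ := hg (Units.mk0 x hx)
  have ho : orderOf g = Nat.card k - 1 := by
    rw [orderOf_eq_card_of_forall_mem_zpowers hg, Nat.card_eq_fintype_card,
      Fintype.card_units, Nat.card_eq_fintype_card]
  have h5 : (g ^ i) ^ ((Nat.card k - 1) / 3) = 1 := by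
    simp only at hi
    rw [hi]
    ext
    simpa using hs
  rw [← zpow_natCast, ← zpow_mul] at h5
  have h6 := orderOf_dvd_iff_zpow_eq_one.2 h5
  rw [ho] at h6
  obtain ⟨m, hm⟩ := h3
  have hm0 : 0 < m := by
    have : 0 < orderOf g := orderOf_pos g
    omega
  rw [hm, Nat.mul_div_cancel_left _ (by norm_num)] at h6
  have h7 : (3 : ℤ) ∣ i := by
    push_cast at h6
    exact Int.dvd_of_mul_dvd_mul_right (by positivity) h6
  obtain ⟨j, rfl⟩ := h7
  refine ⟨((g ^ j : kˣ) : k), ?_⟩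
  simp only at hi
  rw [mul_comm, zpow_mul] at hi
  have := congrArg (Units.val) hi
  simpa using this

end c3

end MRank

namespace MRank

open UniqueFactorizationMonoid

/-- The ring of Eisenstein integers. -/
abbrev Om := QuadraticAlgebra ℤ (-1) (-1)

/-- The cube root of unity. -/
def om : Om := ⟨0, 1⟩

lemma om_eq : om ^ 2 + om + 1 = 0 := by
  rw [om, pow_two]; ext <;> simp [QuadraticAlgebra.re_one, QuadraticAlgebra.im_one]

lemma om_cube : om ^ 3 = 1 := by linear_combination (om - 1) * om_eq

lemma Om_eta (z : Om) : z = (z.re : Om) + (z.im : Om) * om := by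
  rw [om]; ext <;> simp

/-- Complex conjugation. -/
noncomputable def cO : Om ≃+* Om := starRingAut

lemma cO_om : cO om = -1 - om := by
  rw [cO, starRingAut_apply, om]
  ext <;> simp [QuadraticAlgebra.re_one, QuadraticAlgebra.im_one]

lemma cO_om' : cO om = om ^ 2 := by rw [cO_om]; linear_combination -om_eq

lemma cO_cO (z : Om) : cO (cO z) = z := by
  simp only [cO, starRingAut_apply, star_star]

/-- Norm. -/
def nm (z : Om) : ℤ := z.re ^ 2 - z.re * z.im + z.im ^ 2

lemma nm_mul (z w : Om) : nm (z * w) = nm z * nm w := by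
  simp only [nm, QuadraticAlgebra.re_mul, QuadraticAlgebra.im_mul]; ring

lemma mul_cO (z : Om) : z * cO z = (nm z : Om) := by
  rw [cO, starRingAut_apply]
  ext
  · rw [QuadraticAlgebra.re_intCast, nm]; simp; ring
  · simp; ring

lemma nm_nonneg (z : Om) : 0 ≤ nm z := by
  unfold nm; nlinarith [sq_nonneg (z.re - z.im), sq_nonneg z.re, sq_nonneg z.im]

lemma nm_eq_zero {z : Om} (h : nm z = 0) : z = 0 := by
  unfold nm at h
  have h1 : z.im = 0 := by nlinarith [sq_nonneg (2 * z.re - z.im), sq_nonneg z.im]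
  have h2 : z.re = 0 := by rw [h1] at h; nlinarith
  ext <;> simp [h1, h2]

lemma nm_pos {z : Om} (h : z ≠ 0) : 0 < nm z :=
  lt_of_le_of_ne (nm_nonneg z) (fun h' => h (nm_eq_zero h'.symm))

instance : NoZeroDivisors Om where
  eq_zero_or_eq_zero_of_mul_eq_zero := by
    intro a b h
    have : nm a * nm b = 0 := by rw [← nm_mul, h]; rfl
    rcases mul_eq_zero.1 this with h | h
    · exact Or.inl (nm_eq_zero h)
    · exact Or.inr (nm_eq_zero h)

instance : IsDomain Om := NoZeroDivisors.to_isDomain Om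

lemma exists_round (t n : ℤ) (hn : 0 < n) : ∃ x : ℤ, 2 * |t - n * x| ≤ n := by
  refine ⟨round ((t : ℚ) / n), ?_⟩
  have h := abs_sub_round ((t : ℚ) / n)
  have hn' : (0 : ℚ) < n := by exact_mod_cast hn
  have : 2 * |(t : ℚ) - n * (round ((t : ℚ) / n) : ℤ)| ≤ n := by
    rw [show (t : ℚ) - n * (round ((t : ℚ) / n) : ℤ)
      = n * ((t : ℚ) / n - (round ((t : ℚ) / n) : ℤ)) by field_simp, abs_mul, abs_of_pos hn']
    nlinarith
  exact_mod_cast this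

lemma Om_div (a b : Om) (hb : b ≠ 0) : ∃ q : Om, nm (a - b * q) < nm b := by
  have hn := nm_pos hb
  set n := nm b with hnd
  set t := a * cO b with ht
  obtain ⟨x, hx⟩ := exists_round t.re n hn
  obtain ⟨y, hy⟩ := exists_round t.im n hn
  refine ⟨⟨x, y⟩, ?_⟩
  have h1 : nm (a - b * ⟨x, y⟩) * n = nm (t - (n : Om) * ⟨x, y⟩) := by
    have : t - (n : Om) * ⟨x, y⟩ = (a - b * ⟨x, y⟩) * cO b := by
      rw [hnd, ← mul_cO, ht]; ring
    rw [this, nm_mul]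
    congr 1
    rw [hnd, nm, cO, starRingAut_apply, nm]
    simp; ring
  have h2 : nm (t - (n : Om) * ⟨x, y⟩) = (t.re - n * x) ^ 2 - (t.re - n * x) * (t.im - n * y)
      + (t.im - n * y) ^ 2 := by
    simp [nm]
  generalize t.re - n * x = u at *
  generalize t.im - n * y = v at *
  have h3 : 4 * (u ^ 2 - u * v + v ^ 2) ≤ 3 * n ^ 2 := by
    rcases abs_le.1 (show |u| ≤ |u| from le_rfl) with _
    have hu := abs_nonneg u
    have hv := abs_nonneg v
    have h4 : u ^ 2 = |u| ^ 2 := (sq_abs u).symm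
    have h5 : v ^ 2 = |v| ^ 2 := (sq_abs v).symm
    have h6 : -(u * v) ≤ |u| * |v| := by rw [← abs_mul]; exact neg_le_abs _
    nlinarith
  by_contra hcon
  push Not at hcon
  nlinarith

noncomputable abbrev instEOm : EuclideanDomain Om :=
  { (inferInstance : CommRing Om), (inferInstance : Nontrivial Om) with
    quotient := fun a b => open Classical in if h : b = 0 then 0 else (Om_div a b h).choose
    quotient_zero := fun a => by simp
    remainder := fun a b => open Classical in
      a - b * (if h : b = 0 then 0 else (Om_div a b h).choose)
    quotient_mul_add_remainder_eq := fun a b => by ring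
    r := fun a b => (nm a).toNat < (nm b).toNat
    r_wellFounded := (measure fun a : Om => (nm a).toNat).wf
    remainder_lt := fun a {b} hb => by
      have h := (Om_div a b hb).choose_spec
      have h2 := nm_nonneg (a - b * (Om_div a b hb).choose)
      simp only [hb, dif_neg, not_false_eq_true]
      omega
    mul_left_not_lt := fun a {b} hb => by
      have h1 := nm_pos hb
      have h2 := nm_nonneg a
      rw [nm_mul]
      have : nm a ≤ nm a * nm b := by nlinarith
      omega }

instance Om_pid : IsPrincipalIdealRing Om :=
  @EuclideanDomain.to_principal_ideal_domain Om instEOm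

instance Om_ded : IsDedekindDomain Om := inferInstance

end MRank

namespace MRank

open UniqueFactorizationMonoid

lemma Om_quot_finite {P : Ideal Om} (h : P ≠ ⊥) : Finite (Om ⧸ P) :=
  Ideal.finiteQuotientOfFreeOfNeBot P h

/-- cubic residue symbol at a prime ideal -/
noncomputable def sym (P : Ideal Om) (β : Om) : ZMod 3 :=
  c3 (Ideal.Quotient.mk P om) (Ideal.Quotient.mk P β)

lemma mk_om_eq (P : Ideal Om) : (Ideal.Quotient.mk P om) ^ 2 + Ideal.Quotient.mk P om + 1 = 0 := by
  rw [← map_pow, ← map_add, ← map_one (Ideal.Quotient.mk P), ← map_add, om_eq, map_zero]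

lemma mk_om_ne {P : Ideal Om} (h3 : (3 : Om) ∉ P) : Ideal.Quotient.mk P om ≠ 1 := by
  intro h
  rw [← map_one (Ideal.Quotient.mk P), Ideal.Quotient.eq] at h
  apply h3
  have : (3 : Om) = (om - 1) * (-om - 2) := by linear_combination om_eq
  rw [this]
  exact P.mul_mem_right _ h

lemma mk_ne {P : Ideal Om} {β : Om} (h : β ∉ P) : Ideal.Quotient.mk P β ≠ 0 := by
  rwa [Ne, Ideal.Quotient.eq_zero_iff_mem]

lemma sym_mul {P : Ideal Om} [hP : P.IsPrime] (h0 : P ≠ ⊥) (h3 : (3 : Om) ∉ P) {β γ : Om}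
    (hb : β ∉ P) (hg : γ ∉ P) : sym P (β * γ) = sym P β + sym P γ := by
  haveI := Om_quot_finite h0
  rw [sym, map_mul, c3_mul (mk_om_eq P) (mk_om_ne h3) (mk_ne hb) (mk_ne hg)]; rfl

lemma sym_congr {P : Ideal Om} {β γ : Om} (h : β - γ ∈ P) : sym P β = sym P γ := by
  rw [sym, Ideal.Quotient.eq.2 h]; rfl

lemma sym_conj {P : Ideal Om} [hP : P.IsPrime] (h0 : P ≠ ⊥) (h3 : (3 : Om) ∉ P) {β : Om}
    (hb : β ∉ P) : sym (P.map cO) (cO β) = - sym P β := by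
  haveI := Om_quot_finite h0
  let f : Om ⧸ P ≃+* Om ⧸ (P.map cO) := Ideal.quotientEquiv P (P.map cO) cO rfl
  haveI : (P.map cO).IsPrime := Ideal.map_isPrime_of_equiv cO
  have h0' : P.map cO ≠ ⊥ := by
    intro h
    exact h0 ((Ideal.map_eq_bot_iff_of_injective cO.injective).1 h)
  haveI := Om_quot_finite h0'
  have hf : ∀ z, Ideal.Quotient.mk (P.map cO) (cO z) = f (Ideal.Quotient.mk P z) := fun z => rfl
  have hb' : cO β ∉ P.map cO := fun h => hb ((Ideal.mem_map_of_equiv cO _).1 h |>.elim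
    fun x hx => cO.injective hx.2 ▸ hx.1)
  have h3' : (3 : Om) ∉ P.map cO := fun h => h3 ((Ideal.mem_map_of_equiv cO _).1 h |>.elim
    fun x hx => by
      have : x = 3 := cO.injective (hx.2.trans (map_ofNat cO 3).symm)
      exact this ▸ hx.1)
  have e := c3_map f (mk_om_eq P) (mk_om_ne h3) (mk_ne hb)
  rw [← hf, ← hf, cO_om', map_pow, c3_inv (mk_om_eq _) (mk_om_ne h3') (mk_ne hb')] at e
  rw [sym, sym, ← e, neg_neg]

/-- `cub β γ`: the cubic residue symbol, additively written. -/
noncomputable def cub (β γ : Om) : ZMod 3 :=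
  ((normalizedFactors (Ideal.span {γ})).map (fun P => sym P β)).sum

lemma nf_facts {γ : Om} (hg : γ ≠ 0) {P : Ideal Om} (h : P ∈ normalizedFactors (Ideal.span {γ})) :
    P.IsPrime ∧ P ≠ ⊥ ∧ γ ∈ P := by
  have h1 := prime_of_normalized_factor P h
  have h2 := dvd_of_mem_normalizedFactors h
  refine ⟨Ideal.isPrime_of_prime h1, h1.ne_zero, ?_⟩
  exact Ideal.le_of_dvd h2 (Ideal.mem_span_singleton_self γ)

lemma notMem_of_coprime {β γ : Om} {P : Ideal Om} (hP : P.IsPrime) (h : IsCoprime β γ)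
    (hg : γ ∈ P) : β ∉ P := by
  intro hb
  obtain ⟨u, v, huv⟩ := h
  apply hP.ne_top
  rw [Ideal.eq_top_iff_one, ← huv]
  exact P.add_mem (P.mul_mem_left _ hb) (P.mul_mem_left _ hg)

lemma cub_mul {β β' γ : Om} (hg : γ ≠ 0) (h3 : IsCoprime 3 γ) (hb : IsCoprime β γ)
    (hb' : IsCoprime β' γ) : cub (β * β') γ = cub β γ + cub β' γ := by
  rw [cub, cub, cub, ← Multiset.sum_map_add]
  congr 1
  apply Multiset.map_congr rfl
  intro P hP
  obtain ⟨h1, h2, h4⟩ := nf_facts hg hP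
  exact sym_mul h2 (notMem_of_coprime h1 h3 h4) (notMem_of_coprime h1 hb h4)
    (notMem_of_coprime h1 hb' h4)

lemma cub_mul_right (β : Om) {γ γ' : Om} (hg : γ ≠ 0) (hg' : γ' ≠ 0) :
    cub β (γ * γ') = cub β γ + cub β γ' := by
  rw [cub, ← Ideal.span_singleton_mul_span_singleton, normalizedFactors_mul (by simpa using hg)
    (by simpa using hg'), Multiset.map_add, Multiset.sum_add]
  rfl

lemma cub_congr {β β' γ : Om} (hg : γ ≠ 0) (h : γ ∣ β - β') : cub β γ = cub β' γ := by
  rw [cub, cub]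
  congr 1
  apply Multiset.map_congr rfl
  intro P hP
  obtain ⟨h1, h2, h4⟩ := nf_facts hg hP
  exact sym_congr (Ideal.mem_of_dvd P h h4)

lemma cub_assoc (β : Om) {γ γ' : Om} (h : Associated γ γ') : cub β γ = cub β γ' := by
  rw [cub, Ideal.span_singleton_eq_span_singleton.2 h]; rfl

lemma cub_unit (β : Om) {γ : Om} (h : IsUnit γ) : cub β γ = 0 := by
  rw [cub, Ideal.span_singleton_eq_top.2 h]
  simp [← Ideal.one_eq_top]

lemma nf_map {R : Type*} [CommRing R] [IsDedekindDomain R] (f : R ≃+* R) (I : Ideal R)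
    (hI : I ≠ ⊥) :
    normalizedFactors (I.map f) = (normalizedFactors I).map (Ideal.map f) := by
  have h1 : I.map f = ((normalizedFactors I).map (Ideal.map f)).prod := by
    conv_lhs => rw [← Ideal.prod_normalizedFactors_eq_self hI]
    exact map_multiset_prod (Ideal.mapHom f) _
  rw [h1]
  apply normalizedFactors_prod_of_prime
  intro p hp
  obtain ⟨q, hq, rfl⟩ := Multiset.mem_map.1 hp
  have hq1 := prime_of_normalized_factor q hq
  haveI := Ideal.isPrime_of_prime hq1
  refine (Ideal.prime_iff_isPrime ?_).2 (Ideal.map_isPrime_of_equiv f)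
  intro h
  exact hq1.ne_zero ((Ideal.map_eq_bot_iff_of_injective f.injective).1 h)

lemma cub_conj {β γ : Om} (hg : γ ≠ 0) (h3 : IsCoprime 3 γ) (hb : IsCoprime β γ) :
    cub (cO β) (cO γ) = - cub β γ := by
  have e : Ideal.span {cO γ} = (Ideal.span {γ}).map cO := by
    rw [Ideal.map_span, Set.image_singleton]
  rw [cub, e, nf_map cO _ (by simpa using hg), Multiset.map_map, cub, ← Multiset.sum_map_neg]
  congr 1
  apply Multiset.map_congr rfl
  intro P hP
  obtain ⟨h1, h2, h4⟩ := nf_facts hg hP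
  exact sym_conj h2 (notMem_of_coprime h1 h3 h4) (notMem_of_coprime h1 hb h4)

lemma isCoprime_cast {m n : ℤ} (h : IsCoprime m n) : IsCoprime (m : Om) (n : Om) :=
  h.map (Int.castRingHom Om)

lemma cast_ne_zero {n : ℤ} (h : n ≠ 0) : (n : Om) ≠ 0 := by
  intro h'
  have := congrArg QuadraticAlgebra.re h'
  simp at this; exact h this

lemma three_coprime {n : ℤ} (h : ¬ (3 : ℤ) ∣ n) : IsCoprime (3 : ℤ) n :=
  (Int.prime_three.coprime_iff_not_dvd).2 h

lemma three_coprime' {n : ℤ} (h : ¬ (3 : ℤ) ∣ n) : IsCoprime (3 : Om) (n : Om) := by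
  simpa using isCoprime_cast (three_coprime h)

lemma ne_zero_of_not_three_dvd {n : ℤ} (h : ¬ (3 : ℤ) ∣ n) : n ≠ 0 := by
  rintro rfl; simp at h

lemma cub_int {m n : ℤ} (h3 : ¬ (3 : ℤ) ∣ n) (h : IsCoprime m n) : cub (m : Om) (n : Om) = 0 := by
  have := cub_conj (cast_ne_zero (ne_zero_of_not_three_dvd h3)) (three_coprime' h3)
    (isCoprime_cast h)
  rw [map_intCast, map_intCast] at this
  generalize cub (m : Om) (n : Om) = s at *
  revert this s; decide

lemma cub_one {γ : Om} (hg : γ ≠ 0) (h3 : IsCoprime 3 γ) : cub 1 γ = 0 := by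
  have := cub_mul hg h3 (isCoprime_one_left (x := γ)) (isCoprime_one_left (x := γ))
  simpa using this

lemma cub_pow {β γ : Om} (hg : γ ≠ 0) (h3 : IsCoprime 3 γ) (hb : IsCoprime β γ) (n : ℕ) :
    cub (β ^ n) γ = n * cub β γ := by
  induction n with
  | zero => simp [cub_one hg h3]
  | succ n ih =>
    rw [pow_succ, cub_mul hg h3 hb.pow_left hb, ih]; push_cast; ring

lemma cub_cube {β γ : Om} (hg : γ ≠ 0) (h3 : IsCoprime 3 γ) (hb : IsCoprime β γ) :
    cub (β ^ 3) γ = 0 := by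
  rw [cub_pow hg h3 hb]
  generalize cub β γ = s
  revert s; decide

lemma cub_neg_one {γ : Om} (hg : γ ≠ 0) (h3 : IsCoprime 3 γ) : cub (-1) γ = 0 := by
  have := cub_cube (β := -1) hg h3 (isCoprime_one_left.neg_left)
  rwa [show (-1 : Om) ^ 3 = -1 by ring] at this

lemma cub_neg {β γ : Om} (hg : γ ≠ 0) (h3 : IsCoprime 3 γ) (hb : IsCoprime β γ) :
    cub (-β) γ = cub β γ := by
  rw [show -β = (-1) * β by ring, cub_mul hg h3 (isCoprime_one_left.neg_left) hb,
    cub_neg_one hg h3, zero_add]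

end MRank

namespace MRank

section cubchar
variable {k : Type} [Field k] [Fintype k] {w : k}

/-- The cubic residue character with values in the Eisenstein integers. -/
noncomputable def cchar (hw : w ^ 2 + w + 1 = 0) (h1 : w ≠ 1) : MulChar k Om := by
  classical
  exact
  { toFun := fun x => if x = 0 then 0 else om ^ (c3 w x).val
    map_one' := by
      have : c3 w (1 : k) = ((0 : ℕ) : ZMod 3) := c3_eq hw h1 one_ne_zero (by simp)
      simp [this]
    map_mul' := by
      intro x y
      by_cases hx : x = 0
      · simp [hx]
      by_cases hy : y = 0
      · simp [hy]
      simp only [hx, hy, mul_eq_zero, or_self, if_false]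
      rw [c3_mul hw h1 hx hy, ← pow_add, w_pow_mod om_eq ((c3 w x).val + _), ZMod.val_add]
    map_nonunit' := by
      intro x hx
      have : x = 0 := by simpa using hx
      simp [this] }

lemma cchar_apply (hw : w ^ 2 + w + 1 = 0) (h1 : w ≠ 1) {x : k} (hx : x ≠ 0) :
    cchar hw h1 x = om ^ (c3 w x).val := by
  classical
  show (if x = 0 then 0 else om ^ (c3 w x).val) = _
  rw [if_neg hx]

lemma cchar_cube (hw : w ^ 2 + w + 1 = 0) (h1 : w ≠ 1) : (cchar hw h1) ^ 3 = 1 := by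
  ext1 x
  rw [MulChar.pow_apply' _ three_ne_zero, cchar_apply hw h1 x.ne_zero, MulChar.one_apply_coe,
    ← pow_mul, mul_comm, pow_mul, om_cube, one_pow]

lemma cchar_red (hw : w ^ 2 + w + 1 = 0) (h1 : w ≠ 1) (r : Om →+* k) (hr : r om = w) (x : k) :
    r (cchar hw h1 x) = x ^ ((Fintype.card k - 1) / 3) := by
  have h3 := three_dvd hw h1
  rw [Nat.card_eq_fintype_card] at h3
  have hc := Fintype.one_lt_card (α := k)
  by_cases hx : x = 0
  · rw [hx, MulChar.map_zero, map_zero, zero_pow]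
    omega
  · rw [cchar_apply hw h1 hx, map_pow, hr, ← c3_spec hw h1 hx, Nat.card_eq_fintype_card]

lemma om_ne_one : om ≠ 1 := by
  intro h
  have := congrArg QuadraticAlgebra.im h
  simp [om, QuadraticAlgebra.im_one] at this

lemma om_prim : IsPrimitiveRoot om 3 := by
  have : Fact (Nat.Prime 3) := ⟨Nat.prime_three⟩
  exact IsPrimitiveRoot.of_map_of_injective (f := RingHom.id Om)
    (by rw [RingHom.id_apply, IsPrimitiveRoot.iff_orderOf]
        exact orderOf_eq_prime om_cube om_ne_one) Function.injective_id

lemma cchar_ne_one (hw : w ^ 2 + w + 1 = 0) (h1 : w ≠ 1) (r : Om →+* k) (hr : r om = w) :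
    cchar hw h1 ≠ 1 := by
  intro h
  have h3 := three_dvd hw h1
  rw [Nat.card_eq_fintype_card] at h3
  have hc := Fintype.one_lt_card (α := k)
  obtain ⟨g, hg⟩ := IsCyclic.exists_ofOrder_eq_natCard (α := kˣ)
  rw [Nat.card_units, Nat.card_eq_fintype_card] at hg
  have h2 := cchar_red hw h1 r hr g
  rw [h, MulChar.one_apply_coe, map_one] at h2
  have h4 : g ^ ((Fintype.card k - 1) / 3) = 1 := by
    ext; push_cast; exact h2.symm
  have h5 := orderOf_dvd_of_pow_eq_one h4
  rw [hg] at h5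
  have := Nat.le_of_dvd (by omega) h5
  omega

lemma cchar_neg_one (hw : w ^ 2 + w + 1 = 0) (h1 : w ≠ 1) : cchar hw h1 (-1) = 1 := by
  have h := cchar_cube hw h1
  have h2 : (cchar hw h1 ^ 3) (-1) = (1 : MulChar k Om) (-1) := by rw [h]
  rw [MulChar.pow_apply' _ three_ne_zero, ← map_pow, MulChar.one_apply (by simp),
    show (-1 : k) ^ 3 = -1 by ring] at h2
  exact h2

/-- The Jacobi sum. -/
noncomputable def jac (hw : w ^ 2 + w + 1 = 0) (h1 : w ≠ 1) : Om :=
  jacobiSum (cchar hw h1) (cchar hw h1)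

lemma jac_primary (hw : w ^ 2 + w + 1 = 0) (h1 : w ≠ 1) : (3 : Om) ∣ jac hw h1 + 1 := by
  have h3 := three_dvd hw h1
  rw [Nat.card_eq_fintype_card] at h3
  obtain ⟨z, -, hz⟩ := exists_jacobiSum_eq_neg_one_add (by norm_num) (cchar_cube hw h1)
    (cchar_cube hw h1) h3 om_prim
  refine ⟨-z * om, ?_⟩
  rw [jac, hz]
  linear_combination z * om_eq

lemma jac_red (hw : w ^ 2 + w + 1 = 0) (h1 : w ≠ 1) (r : Om →+* k) (hr : r om = w) :
    r (jac hw h1) = 0 := by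
  have h3 := three_dvd hw h1
  rw [Nat.card_eq_fintype_card] at h3
  have hc := Fintype.one_lt_card (α := k)
  rw [jac, jacobiSum, map_sum]
  simp_rw [map_mul, cchar_red hw h1 r hr]
  set n := (Fintype.card k - 1) / 3 with hn
  simp_rw [sub_eq_add_neg, add_comm (1 : k), add_pow, one_pow, mul_one, Finset.mul_sum]
  rw [Finset.sum_comm]
  apply Finset.sum_eq_zero
  intro i hi
  have hi' : i ≤ n := by simpa [Nat.lt_succ_iff] using hi
  have e : ∀ x : k, x ^ n * ((-x) ^ i * ((n.choose i : ℕ) : k))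
      = x ^ (n + i) * ((-1) ^ i * ((n.choose i : ℕ) : k)) := by
    intro x
    rw [neg_pow, pow_add]; ring
  simp_rw [e]
  rw [← Finset.sum_mul, FiniteField.sum_pow_lt_card_sub_one k _ (by omega), zero_mul]

lemma jac_norm (hw : w ^ 2 + w + 1 = 0) (h1 : w ≠ 1) (r : Om →+* k) (hr : r om = w) :
    nm (jac hw h1) = Fintype.card k := by
  have hne := cchar_ne_one hw h1 r hr
  have h3 := cchar_cube hw h1
  set χ := cchar hw h1 with hχ
  have hinj : Function.Injective (algebraMap Om (FractionRing Om)) :=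
    IsFractionRing.injective Om (FractionRing Om)
  have hne2 : χ * χ ≠ 1 := by
    intro h
    apply hne
    rw [← h3, pow_succ, pow_two, h, one_mul]
  let j := algebraMap Om (FractionRing Om)
  have inj' := MulChar.injective_ringHomComp (R := k) hinj
  have hA : χ.ringHomComp j ≠ 1 := fun h => hne (inj' (h.trans (MulChar.ringHomComp_one j).symm))
  have hB : χ.ringHomComp j * χ.ringHomComp j ≠ 1 := by
    rw [← MulChar.ringHomComp_mul]
    exact fun h => hne2 (inj' (h.trans (MulChar.ringHomComp_one j).symm))
  have hc : ringChar (FractionRing Om) ≠ ringChar k := by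
    haveI : CharZero Om := ⟨fun a b h => by
      have := congrArg QuadraticAlgebra.re h
      simpa using this⟩
    haveI : CharZero (FractionRing Om) := ⟨fun a b h => by
      have : j a = j b := by simpa using h
      exact_mod_cast hinj this⟩
    rw [ringChar.eq_zero]
    exact (CharP.char_ne_zero_of_finite k (ringChar k)).symm
  have key := jacobiSum_mul_jacobiSum_inv hc hA hA hB
  have hinv : χ⁻¹ = χ.ringHomComp cO.toRingHom := by
    rw [inv_eq_iff_mul_eq_one]
    ext1 x
    rw [MulChar.mul_apply, MulChar.ringHomComp_apply, hχ, cchar_apply hw h1 x.ne_zero,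
      MulChar.one_apply_coe]
    simp only [RingEquiv.toRingHom_eq_coe, RingHom.coe_coe, map_pow]
    rw [cO_om', ← mul_pow, ← pow_succ', om_cube, one_pow]
  rw [MulChar.ringHomComp_inv, jacobiSum_ringHomComp, jacobiSum_ringHomComp, ← map_mul, hinv,
    jacobiSum_ringHomComp] at key
  have key2 : jac hw h1 * cO (jac hw h1) = ((Fintype.card k : ℕ) : Om) := by
    apply hinj
    rw [map_natCast]; exact key
  rw [mul_cO] at key2
  have := congrArg QuadraticAlgebra.re key2
  simpa using this

lemma jac_gauss (hw : w ^ 2 + w + 1 = 0) (h1 : w ≠ 1) (r : Om →+* k) (hr : r om = w)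
    {L : Type} [Field L] [Fintype L] (s : Om →+* L) (hs : s om ≠ 1)
    (hc : ringChar L ≠ ringChar k) :
    (s ((Fintype.card k : Om) * jac hw h1)) ^ ((Fintype.card L - 1) / 3)
      * s (cchar hw h1 (Fintype.card L : k)) = 1 := by
  have hsw : (s om) ^ 2 + s om + 1 = 0 := by
    rw [← map_pow, ← map_add, ← map_one s, ← map_add, om_eq, map_zero]
  have hd := three_dvd hsw hs
  rw [Nat.card_eq_fintype_card] at hd
  have h3 := cchar_cube hw h1
  have hm1 := cchar_neg_one hw h1
  let ψ := AddChar.FiniteField.primitiveChar k L hc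
  let FF := CyclotomicField ψ.n L
  let j : Om →+* FF := (algebraMap L FF).comp s
  have hjinj : Function.Injective (algebraMap L FF) := (algebraMap L FF).injective
  have hjw : (j om) ^ 2 + j om + 1 = 0 := by
    rw [← map_pow, ← map_add, ← map_one j, ← map_add, om_eq, map_zero]
  have hj1 : j om ≠ 1 := fun h => hs (hjinj (by rw [map_one]; exact h))
  set χ := cchar hw h1 with hχ
  have hA : χ.ringHomComp j ≠ 1 := by
    intro h
    apply cchar_ne_one hw h1 r hr
    ext1 x
    have h2 : (χ.ringHomComp j) x = 1 := by rw [h, MulChar.one_apply_coe]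
    rw [MulChar.ringHomComp_apply, hχ, cchar_apply hw h1 x.ne_zero, map_pow] at h2
    have h4 := w_pow_inj hjw hj1 (m := (c3 w (x : k)).val) (n := 0) (by simpa using h2)
    rw [cchar_apply hw h1 x.ne_zero, MulChar.one_apply_coe]
    simp at h4
    rw [h4]; simp
  have hC : (χ.ringHomComp j) ^ 3 = 1 := by
    rw [MulChar.ringHomComp_pow, h3, MulChar.ringHomComp_one]
  haveI : Fact (Nat.Prime 3) := ⟨Nat.prime_three⟩
  have hord : orderOf (χ.ringHomComp j) = 3 := orderOf_eq_prime hC hA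
  have hg3 := gaussSum_pow_eq_prod_jacobiSum (χ := χ.ringHomComp j) (ψ := ψ.char)
    (by rw [hord]; norm_num) ψ.prim
  rw [hord] at hg3
  simp only [Nat.add_one_sub_one, Nat.reduceSub, Finset.prod_Ico_succ_top, Finset.Ico_self,
    Nat.Ico_succ_singleton, Finset.prod_singleton, pow_one, jacobiSum_ringHomComp,
    MulChar.ringHomComp_apply, hm1, map_one, one_mul] at hg3
  obtain ⟨p, hp⟩ := CharP.exists L
  obtain ⟨m, hpp, hcard⟩ := FiniteField.card L p
  haveI : Fact p.Prime := ⟨hpp⟩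
  haveI : CharP FF p := charP_of_injective_algebraMap hjinj p
  set g := gaussSum (χ.ringHomComp j) ψ.char with hg
  have hfrob : ∀ n : ℕ, g ^ (p ^ n)
      = gaussSum ((χ.ringHomComp j) ^ (p ^ n)) (ψ.char ^ (p ^ n)) := by
    intro n
    induction n with
    | zero => simp [hg]
    | succ n ih => rw [pow_succ, pow_mul, ih, gaussSum_frob, ← pow_mul, ← pow_mul]
  have hf := hfrob m
  rw [← hcard] at hf
  have hunit : (Fintype.card L : k) ≠ 0 := by
    intro h
    rw [hcard] at h
    push_cast at h
    have h5 : (p : k) = 0 := by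
      exact pow_eq_zero_iff (PNat.ne_zero m) |>.1 h
    apply hc
    have h6 : ringChar k ∣ p := (ringChar.spec k p).1 h5
    have h7 : ringChar k ≠ 1 := CharP.ringChar_ne_one
    rw [ringChar.eq L p]
    exact ((Nat.dvd_prime hpp).1 h6 |>.resolve_left h7).symm
  have hmod : (χ.ringHomComp j) ^ (Fintype.card L) = χ.ringHomComp j := by
    have h8 : Fintype.card L = 3 * ((Fintype.card L - 1) / 3) + 1 := by
      have := Fintype.one_lt_card (α := L)
      omega
    rw [h8, pow_succ, pow_mul, hC, one_pow, one_mul]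
  rw [hmod, AddChar.pow_mulShift] at hf
  have hsh := gaussSum_mulShift (χ.ringHomComp j) ψ.char (Units.mk0 _ hunit)
  rw [Units.val_mk0, ← hf, ← hg, MulChar.ringHomComp_apply] at hsh
  have hg0 : g ≠ 0 := by
    apply gaussSum_ne_zero_of_nontrivial _ hA ψ.prim
    intro h
    have h9 : ringChar FF = ringChar L := by rw [ringChar.eq FF p, ringChar.eq L p]
    obtain ⟨n, hn1, hn2⟩ := FiniteField.card k (ringChar k)
    rw [hn2] at h
    push_cast at h
    have h5 : ((ringChar k : ℕ) : FF) = 0 := pow_eq_zero_iff (PNat.ne_zero n) |>.1 h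
    have h6 : ringChar FF ∣ ringChar k := (ringChar.spec FF _).1 h5
    rw [h9] at h6
    exact hc ((Nat.dvd_prime hn1).1 h6 |>.resolve_left CharP.ringChar_ne_one)
  apply hjinj
  have hL := Fintype.one_lt_card (α := L)
  have e1 : g ^ Fintype.card L = (g ^ 3) ^ ((Fintype.card L - 1) / 3) * g := by
    rw [← pow_mul, Nat.mul_div_cancel' hd, ← pow_succ]
    congr 1; omega
  rw [e1, hg3] at hsh
  have e2 : (j (χ (Fintype.card L : k)) * ((Fintype.card k : FF) * j (jacobiSum χ χ)) ^
      ((Fintype.card L - 1) / 3) - 1) * g = 0 := by linear_combination hsh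
  have e3 := (mul_eq_zero.1 e2).resolve_right hg0
  rw [map_one, map_mul, map_pow, map_mul, map_mul, map_natCast, map_natCast]
  have e4 : j (jacobiSum χ χ) = (algebraMap L FF) (s (jac hw h1)) := rfl
  have e5 : j (χ (Fintype.card L : k)) = (algebraMap L FF) (s (χ (Fintype.card L : k))) := rfl
  rw [e4, e5] at e3
  linear_combination e3

end cubchar

end MRank

namespace MRank

open UniqueFactorizationMonoid

lemma absNorm_span (z : Om) : Ideal.absNorm (Ideal.span {z}) = (nm z).natAbs := by
  rw [Ideal.absNorm_span_singleton, Algebra.norm_apply]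
  congr 1
  have := QuadraticAlgebra.det_toLinearMap_eq_norm (R := ℤ) (a := -1) (b := -1) z
  rw [nm]
  have e : (DistribSMul.toLinearMap ℤ Om z) = (LinearMap.mul ℤ Om) z := by
    ext x <;> simp
  rw [e] at this
  refine Eq.trans this ?_
  rw [QuadraticAlgebra.norm_def]; ring

lemma card_quot (P : Ideal Om) : Nat.card (Om ⧸ P) = Ideal.absNorm P := by
  rw [Ideal.absNorm_apply, Submodule.cardQuot_apply]

lemma nm_int (n : ℤ) : nm (n : Om) = n ^ 2 := by simp [nm]

lemma nm_natCast (n : ℕ) : nm (n : Om) = n ^ 2 := by simp [nm]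

lemma sym_prod {P : Ideal Om} [hP : P.IsPrime] (h0 : P ≠ ⊥) (h3 : (3 : Om) ∉ P)
    {ι : Type*} (s : Multiset ι) (f : ι → Om) (hf : ∀ i ∈ s, f i ∉ P) :
    sym P (s.map f).prod = (s.map (fun i => sym P (f i))).sum ∧ (s.map f).prod ∉ P := by
  induction s using Multiset.induction_on with
  | empty =>
    refine ⟨?_, ?_⟩
    · have h1 : (1 : Om) ∉ P := fun h => hP.ne_top ((Ideal.eq_top_iff_one _).2 h)
      have := sym_mul h0 h3 h1 h1
      simpa using this
    · simpa using fun h => hP.ne_top ((Ideal.eq_top_iff_one _).2 h)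
  | cons a s ih =>
    obtain ⟨h1, h2⟩ := ih (fun i hi => hf i (Multiset.mem_cons_of_mem hi))
    have ha := hf a (Multiset.mem_cons_self a s)
    simp only [Multiset.map_cons, Multiset.prod_cons, Multiset.sum_cons]
    refine ⟨by rw [sym_mul h0 h3 ha h2, h1], fun h => ?_⟩
    rcases hP.mem_or_mem h with h | h
    · exact ha h
    · exact h2 h

lemma cub_prime {π : Om} (hπ : Prime π) (β : Om) : cub β π = sym (Ideal.span {π}) β := by
  have : Prime (Ideal.span {π}) := (Ideal.prime_span_singleton_iff).2 hπ
  rw [cub, normalizedFactors_irreducible this.irreducible]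
  simp

/-- the existence of a primary generator satisfying reciprocity -/
lemma jac_exists {Q : Ideal Om} [hQ : Q.IsMaximal] (hQ0 : Q ≠ ⊥) (hQ3 : (3 : Om) ∉ Q) {q : ℕ}
    (hq : q.Prime) (hqQ : (q : Om) ∈ Q) :
    ∃ J : Om, (3 : Om) ∣ J + 1 ∧ J ∈ Q ∧ nm J = Ideal.absNorm Q ∧
      ∀ P : Ideal Om, P.IsPrime → P ≠ ⊥ → (3 : Om) ∉ P → ∀ p : ℕ, p.Prime → p ≠ q →
        (p : Om) ∈ P → J ∉ P →
        sym P (Ideal.absNorm Q * J) + sym Q (Ideal.absNorm P) = 0 := by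
  letI := Ideal.Quotient.field Q
  haveI := Om_quot_finite hQ0
  letI := Fintype.ofFinite (Om ⧸ Q)
  have hcQ : Fintype.card (Om ⧸ Q) = Ideal.absNorm Q := by
    rw [← card_quot, Nat.card_eq_fintype_card]
  refine ⟨jac (mk_om_eq Q) (mk_om_ne hQ3), jac_primary _ _,
    Ideal.Quotient.eq_zero_iff_mem.1 (jac_red _ _ (Ideal.Quotient.mk Q) rfl),
    by rw [jac_norm _ _ (Ideal.Quotient.mk Q) rfl, hcQ], ?_⟩
  intro P hP hP0 hP3 p hp hpq hpP hJ
  haveI : P.IsMaximal := hP.isMaximal hP0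
  letI := Ideal.Quotient.field P
  haveI := Om_quot_finite hP0
  letI := Fintype.ofFinite (Om ⧸ P)
  have hcP : Fintype.card (Om ⧸ P) = Ideal.absNorm P := by
    rw [← card_quot, Nat.card_eq_fintype_card]
  have r1 : ringChar (Om ⧸ P) = p := by
    have h : ((p : ℕ) : Om ⧸ P) = 0 := by
      rw [← map_natCast (Ideal.Quotient.mk P)]; exact Ideal.Quotient.eq_zero_iff_mem.2 hpP
    exact ((Nat.dvd_prime hp).1 ((ringChar.spec _ _).1 h)).resolve_left CharP.ringChar_ne_one
  have r2 : ringChar (Om ⧸ Q) = q := by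
    have h : ((q : ℕ) : Om ⧸ Q) = 0 := by
      rw [← map_natCast (Ideal.Quotient.mk Q)]; exact Ideal.Quotient.eq_zero_iff_mem.2 hqQ
    exact ((Nat.dvd_prime hq).1 ((ringChar.spec _ _).1 h)).resolve_left CharP.ringChar_ne_one
  have key := jac_gauss (mk_om_eq Q) (mk_om_ne hQ3) (Ideal.Quotient.mk Q) rfl
    (Ideal.Quotient.mk P) (mk_om_ne hP3) (by rw [r1, r2]; exact hpq)
  have n1 : ((Ideal.absNorm Q : ℕ) : Om) ∉ P := by
    intro h
    have h2 : ((Ideal.absNorm Q : ℕ) : Om ⧸ P) = 0 := by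
      rw [← map_natCast (Ideal.Quotient.mk P)]; exact Ideal.Quotient.eq_zero_iff_mem.2 h
    have h3 := (ringChar.spec _ _).1 h2
    rw [r1, ← hcQ] at h3
    obtain ⟨n, -, h4⟩ := FiniteField.card (Om ⧸ Q) (ringChar (Om ⧸ Q))
    rw [h4, r2] at h3
    exact hpq ((Nat.prime_dvd_prime_iff_eq hp hq).1 (hp.dvd_of_dvd_pow h3))
  have n2 : ((Ideal.absNorm P : ℕ) : Om ⧸ Q) ≠ 0 := by
    intro h2
    have h3 := (ringChar.spec _ _).1 h2
    rw [r2, ← hcP] at h3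
    obtain ⟨n, -, h4⟩ := FiniteField.card (Om ⧸ P) (ringChar (Om ⧸ P))
    rw [h4, r1] at h3
    exact hpq ((Nat.prime_dvd_prime_iff_eq hq hp).1 (hq.dvd_of_dvd_pow h3)).symm
  rw [hcQ, hcP, cchar_apply _ _ n2, map_pow] at key
  have n3 : ((Ideal.absNorm Q : ℕ) : Om) * jac (mk_om_eq Q) (mk_om_ne hQ3) ∉ P := by
    intro h
    rcases hP.mem_or_mem h with h | h
    · exact n1 h
    · exact hJ h
  have sp := c3_spec (mk_om_eq P) (mk_om_ne hP3) (mk_ne n3)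
  rw [Nat.card_eq_fintype_card, hcP] at sp
  rw [sp, ← pow_add] at key
  have := w_pow_inj (mk_om_eq P) (mk_om_ne hP3) (n := 0) (by simpa using key)
  push_cast at this
  rw [ZMod.natCast_zmod_val, ZMod.natCast_zmod_val] at this
  rw [sym, sym, map_natCast (Ideal.Quotient.mk Q)]
  exact this

end MRank

namespace MRank

open UniqueFactorizationMonoid

lemma isUnit_of_nm {u : Om} (h : nm u = 1) : IsUnit u := by
  refine IsUnit.of_mul_eq_one (cO u) ?_
  rw [mul_cO, h]; simp

lemma nm_of_isUnit {u : Om} (h : IsUnit u) : nm u = 1 := by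
  obtain ⟨v, hv⟩ := h.exists_right_inv
  have h1 : nm u * nm v = 1 := by rw [← nm_mul, hv]; simp [nm, QuadraticAlgebra.re_one, QuadraticAlgebra.im_one]
  rcases Int.mul_eq_one_iff_eq_one_or_neg_one.1 h1 with h | h
  · exact h.1
  · have := nm_nonneg u; omega

lemma unit_primary {u : Om} (h : IsUnit u) {m : ℤ} (hm : (3 : Om) ∣ u - m) : u = 1 ∨ u = -1 := by
  have h1 := nm_of_isUnit h
  obtain ⟨z, hz⟩ := hm
  have hi : u.im = 3 * z.im := by
    have := congrArg QuadraticAlgebra.im hz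
    have e : (3 : Om) = ((3 : ℤ) : Om) := by norm_num
    rw [e, QuadraticAlgebra.im_mul, QuadraticAlgebra.re_intCast, QuadraticAlgebra.im_intCast,
      QuadraticAlgebra.im_sub, QuadraticAlgebra.im_intCast] at this
    simpa using this
  unfold nm at h1
  have h2 : u.im = 0 := by
    rw [hi] at h1 ⊢
    by_contra hne
    have : 1 ≤ z.im ^ 2 := by
      have : z.im ≠ 0 := by rintro h; exact hne (by rw [h]; ring)
      have := sq_pos_of_ne_zero this
      omega
    nlinarith [sq_nonneg (2 * u.re - 3 * z.im)]
  rw [h2] at h1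
  have h4 : (u.re - 1) * (u.re + 1) = 0 := by linear_combination h1
  rcases mul_eq_zero.1 h4 with h5 | h5
  · left; ext
    · rw [QuadraticAlgebra.re_one]; omega
    · rw [QuadraticAlgebra.im_one]; exact h2
  · right; ext
    · rw [QuadraticAlgebra.re_neg, QuadraticAlgebra.re_one]; omega
    · rw [QuadraticAlgebra.im_neg, QuadraticAlgebra.im_one, h2]; rfl

lemma rec_natPrime {π : Om} (hπ : Prime π) {q : ℕ} (hq : q.Prime) (hnm : nm π = q) (hq3 : q ≠ 3) :
    ∃ J : Om, Associated π J ∧ (3 : Om) ∣ J + 1 ∧ ∀ p : ℕ, p.Prime → p ≠ 3 → p ≠ q →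
      cub (p : Om) J = cub J (p : Om) := by
  set Q := Ideal.span {π} with hQ
  have hQprime : Q.IsPrime := (Ideal.span_singleton_prime hπ.ne_zero).2 hπ
  have hQ0 : Q ≠ ⊥ := by rw [hQ, Ne, Ideal.span_singleton_eq_bot]; exact hπ.ne_zero
  haveI : Q.IsMaximal := hQprime.isMaximal hQ0
  have hqQ : (q : Om) ∈ Q := by
    rw [hQ, Ideal.mem_span_singleton]
    exact ⟨cO π, by rw [mul_cO, hnm]; simp⟩
  have nat_co : ∀ {m n : ℕ}, m.Prime → n.Prime → m ≠ n → IsCoprime (m : Om) (n : Om) := by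
    intro m n hm hn hmn
    have := isCoprime_cast (Nat.isCoprime_iff_coprime.2 ((Nat.coprime_primes hm hn).2 hmn))
    simpa using this
  have hQ3 : (3 : Om) ∉ Q := by
    have := notMem_of_coprime hQprime (nat_co Nat.prime_three hq hq3.symm) hqQ
    simpa using this
  have hcQ : Ideal.absNorm Q = q := by rw [hQ, absNorm_span, hnm]; simp
  obtain ⟨J, hJ1, hJ2, hJ3, hJ4⟩ := jac_exists hQ0 hQ3 hq hqQ
  rw [hcQ] at hJ3 hJ4
  have hass : Associated π J := by
    obtain ⟨u, hu⟩ := Ideal.mem_span_singleton.1 hJ2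
    have h1 : nm π * nm u = q := by rw [← nm_mul, ← hu, hJ3]
    have hq0 : (q : ℤ) ≠ 0 := by exact_mod_cast hq.ne_zero
    have h2 : nm u = 1 := by
      rw [hnm] at h1
      exact mul_left_cancel₀ hq0 (by rw [h1, mul_one])
    exact ⟨(isUnit_of_nm h2).unit, hu.symm⟩
  refine ⟨J, hass, hJ1, ?_⟩
  intro p hp hp3 hpq
  have hpn0 : (p : Om) ≠ 0 := by
    have := cast_ne_zero (n := (p : ℤ)) (by exact_mod_cast hp.ne_zero)
    simpa using this
  have c3p : IsCoprime (3 : Om) (p : Om) := by simpa using nat_co Nat.prime_three hp hp3.symm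
  have cqp : IsCoprime (q : Om) (p : Om) := nat_co hq hp hpq.symm
  have cJp : IsCoprime J (p : Om) := by
    refine cqp.of_isCoprime_of_dvd_left ⟨cO J, ?_⟩
    rw [mul_cO, hJ3]; simp
  have hall : ∀ P ∈ normalizedFactors (Ideal.span {(p : Om)}),
      sym P ((q : Om) * J) + sym Q (Ideal.absNorm P) = 0 := by
    intro P hP
    obtain ⟨h1, h2, h4⟩ := nf_facts hpn0 hP
    exact hJ4 P h1 h2 (notMem_of_coprime h1 c3p h4) p hp hpq h4 (notMem_of_coprime h1 cJp h4)
  have hsum : cub ((q : Om) * J) (p : Om) + ((normalizedFactors (Ideal.span {(p : Om)})).map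
      (fun P => sym Q (Ideal.absNorm P))).sum = 0 := by
    rw [cub, ← Multiset.sum_map_add]
    apply Multiset.sum_eq_zero
    intro x hx
    obtain ⟨P, hP, rfl⟩ := Multiset.mem_map.1 hx
    exact hall P hP
  have hpQ : (p : Om) ∉ Q := notMem_of_coprime hQprime cqp.symm hqQ
  have hprod : ((normalizedFactors (Ideal.span {(p : Om)})).map
      (fun P => ((Ideal.absNorm P : ℕ) : Om))).prod = (p : Om) ^ 2 := by
    have h1 : ((normalizedFactors (Ideal.span {(p : Om)})).map
      (fun P => (Ideal.absNorm P : ℕ))).prod = p ^ 2 := by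
      rw [← map_multiset_prod Ideal.absNorm, Ideal.prod_normalizedFactors_eq_self
        (by simpa using hpn0), absNorm_span, nm_natCast]
      simp [Int.natAbs_pow]
    have h2 := congrArg (Nat.castRingHom Om) h1
    rw [map_multiset_prod, Multiset.map_map] at h2
    simpa using h2
  have hs2 : ((normalizedFactors (Ideal.span {(p : Om)})).map
      (fun P => sym Q (Ideal.absNorm P))).sum = sym Q ((p : Om) ^ 2) := by
    rw [← hprod, (sym_prod hQ0 hQ3 _ _ _).1]
    intro P hP h
    have h5 : ((normalizedFactors (Ideal.span {(p : Om)})).map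
      (fun P => ((Ideal.absNorm P : ℕ) : Om))).prod ∈ Q :=
      Ideal.mem_of_dvd Q (Multiset.dvd_prod (Multiset.mem_map_of_mem _ hP)) h
    rw [hprod] at h5
    exact hpQ (hQprime.mem_of_pow_mem _ h5)
  have hqp0 : cub (q : Om) (p : Om) = 0 := by
    have := cub_int (m := q) (n := p) (by
      intro h; exact hp3 ((Nat.prime_dvd_prime_iff_eq Nat.prime_three hp).1
        (by exact_mod_cast h)).symm)
      (Nat.isCoprime_iff_coprime.2 ((Nat.coprime_primes hq hp).2 hpq.symm))
    simpa using this
  rw [hs2, pow_two, sym_mul hQ0 hQ3 hpQ hpQ, cub_mul hpn0 c3p cqp cJp, hqp0, zero_add] at hsum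
  rw [← cub_assoc _ hass, cub_prime hπ]
  generalize cub J (p : Om) = a at *
  generalize sym (Ideal.span {π}) (p : Om) = b at *
  revert hsum; revert a b; decide

lemma rec_prime {π : Om} (hπ : Prime π) {q : ℕ} (hq : q.Prime) (hnm : nm π = q) (hq3 : q ≠ 3) :
    ∃ J : Om, Associated π J ∧ (3 : Om) ∣ J + 1 ∧ ∀ n : ℤ, ¬ (3 : ℤ) ∣ n → IsCoprime (n : Om) J →
      cub (n : Om) J = cub J (n : Om) := by
  obtain ⟨J, h1, h2, h3⟩ := rec_natPrime hπ hq hnm hq3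
  refine ⟨J, h1, h2, ?_⟩
  have hJ0 : J ≠ 0 := h1.ne_zero_iff.1 hπ.ne_zero
  have hJ3 : IsCoprime 3 J := by
    obtain ⟨z, hz⟩ := h2
    exact ⟨z, -1, by linear_combination -hz⟩
  have hprime : ∀ p : ℤ, Prime p → ¬ (3 : ℤ) ∣ p → IsCoprime (p : Om) J →
      cub (p : Om) J = cub J (p : Om) := by
    intro p hp hp3 hc
    have hpp : p.natAbs.Prime := Int.prime_iff_natAbs_prime.1 hp
    have hne : p.natAbs ≠ q := by
      intro h
      have hdq : J ∣ (p : Om) := by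
        refine (h1.dvd_iff_dvd_left).1 ?_
        have : π ∣ (q : Om) := ⟨cO π, by rw [mul_cO, hnm]; simp⟩
        rw [← h] at this
        rcases Int.natAbs_eq p with h | h
        · rw [h]; simpa using this
        · rw [h]; simpa using this
      exact (h1.prime hπ).not_isUnit (hc.isUnit_of_dvd' hdq dvd_rfl)
    have key := h3 p.natAbs hpp (by rintro h; exact hp3 (Int.natCast_dvd.2 (by rw [h]))) hne
    rcases Int.natAbs_eq p with h | h
    · rw [h]; simpa using key
    · have hc' : IsCoprime ((p.natAbs : ℕ) : Om) J := by
        rw [h, Int.cast_neg, Int.cast_natCast] at hc; exact (IsCoprime.neg_left_iff _ _).1 hc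
      rw [h, Int.cast_neg, cub_neg hJ0 hJ3 (by simpa using hc'), Int.cast_natCast, key]
      apply cub_assoc
      exact Associated.neg_right (Associated.refl _)
  intro n
  refine UniqueFactorizationMonoid.induction_on_prime (P := fun n : ℤ => ¬ (3 : ℤ) ∣ n →
    IsCoprime (n : Om) J → cub (n : Om) J = cub J (n : Om)) n ?_ ?_ ?_
  · intro h; simp at h
  · intro u hu _ _
    have hu' : IsUnit (u : Om) := hu.map (Int.castRingHom Om)
    rw [cub_unit _ hu']
    rcases Int.isUnit_iff.1 hu with h | h
    · rw [h]; simpa using cub_one hJ0 hJ3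
    · rw [h]; simpa using cub_neg_one hJ0 hJ3
  · intro a p ha hp ih hpa3 hc
    have hp3 : ¬ (3 : ℤ) ∣ p := fun h => hpa3 (h.mul_right _)
    have ha3 : ¬ (3 : ℤ) ∣ a := fun h => hpa3 (h.mul_left _)
    rw [Int.cast_mul] at hc ⊢
    have hcp := hc.of_mul_left_left
    have hca := hc.of_mul_left_right
    rw [cub_mul hJ0 hJ3 hcp hca, cub_mul_right _ (cast_ne_zero hp.ne_zero) (cast_ne_zero ha),
      ih ha3 hca, hprime p hp hp3 hcp]

lemma prime_cases {π : Om} (hπ : Prime π) : ∃ q : ℕ, q.Prime ∧ π ∣ (q : Om) ∧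
    (nm π = q ∨ Associated π (q : Om)) := by
  have hn : 0 < nm π := nm_pos hπ.ne_zero
  have hd : π ∣ (((nm π).natAbs : ℕ) : Om) := by
    refine ⟨cO π, ?_⟩
    rw [mul_cO]
    conv_rhs => rw [← Int.natAbs_of_nonneg hn.le]
    simp
  obtain ⟨q, hq, hπq⟩ : ∃ q : ℕ, q.Prime ∧ π ∣ (q : Om) := by
    have h0 : (nm π).natAbs ≠ 0 := by omega
    generalize (nm π).natAbs = N at hd h0
    induction N using Nat.recOnMul with
    | zero => exact absurd rfl h0
    | one => exact absurd (isUnit_of_dvd_one (by simpa using hd)) hπ.not_isUnit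
    | prime p hp => exact ⟨p, hp, hd⟩
    | mul a b iha ihb =>
      push_cast at hd
      rcases hπ.dvd_or_dvd hd with h | h
      · exact iha h (by rintro rfl; simp at h0)
      · exact ihb h (by rintro rfl; simp at h0)
  refine ⟨q, hq, hπq, ?_⟩
  obtain ⟨δ, hδ⟩ := hπq
  have h1 : nm π * nm δ = (q : ℤ) ^ 2 := by rw [← nm_mul, ← hδ, nm_natCast]
  have h2 : (nm π).natAbs ∣ q ^ 2 := by
    have : nm π ∣ ((q ^ 2 : ℕ) : ℤ) := ⟨nm δ, by push_cast; exact h1.symm⟩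
    exact Int.natAbs_dvd_natAbs.2 this
  obtain ⟨i, hi, he⟩ := (Nat.dvd_prime_pow hq).1 h2
  have he' : nm π = (q : ℤ) ^ i := by
    rw [← Int.natAbs_of_nonneg hn.le, he]; push_cast; rfl
  have hq0 : (q : ℤ) ^ 2 ≠ 0 := by exact_mod_cast (pow_ne_zero 2 hq.ne_zero)
  interval_cases i
  · exact absurd (isUnit_of_nm (by simpa using he')) hπ.not_isUnit
  · left; simpa using he'
  · right
    rw [he'] at h1
    have h3 : nm δ = 1 := mul_left_cancel₀ hq0 (by rw [h1, mul_one])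
    exact ⟨(isUnit_of_nm h3).unit, hδ.symm⟩

/-- Cubic reciprocity for a rational integer and a primary Eisenstein integer. -/
theorem recip {n : ℤ} {B : Om} {m : ℤ} (h3 : ¬ (3 : ℤ) ∣ n) (hB : (3 : Om) ∣ B - m)
    (hB3 : IsCoprime 3 B) (hc : IsCoprime (n : Om) B) : cub (n : Om) B = cub B (n : Om) := by
  have key : ∀ B : Om, IsCoprime 3 B → IsCoprime (n : Om) B → B ≠ 0 → ∃ B' : Om, Associated B B' ∧
      (∃ m' : ℤ, (3 : Om) ∣ B' - m') ∧ cub (n : Om) B' = cub B' (n : Om) := by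
    have hn0 := cast_ne_zero (ne_zero_of_not_three_dvd h3)
    intro B
    refine UniqueFactorizationMonoid.induction_on_prime (P := fun B : Om => IsCoprime 3 B →
      IsCoprime (n : Om) B → B ≠ 0 → ∃ B' : Om, Associated B B' ∧
      (∃ m' : ℤ, (3 : Om) ∣ B' - m') ∧ cub (n : Om) B' = cub B' (n : Om)) B ?_ ?_ ?_
    · intro _ _ h; exact absurd rfl h
    · intro u hu _ _ _
      refine ⟨1, associated_one_iff_isUnit.2 hu, ⟨1, by simp⟩, ?_⟩
      rw [cub_unit _ isUnit_one, cub_one hn0 (three_coprime' h3)]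
    · intro a p ha hp ih h1 h2 _
      obtain ⟨a', haa, ⟨m1, hm1⟩, hra⟩ := ih h1.of_mul_right_right h2.of_mul_right_right ha
      obtain ⟨p', hpp, ⟨m2, hm2⟩, hrp⟩ : ∃ p' : Om, Associated p p' ∧
          (∃ m' : ℤ, (3 : Om) ∣ p' - m') ∧ cub (n : Om) p' = cub p' (n : Om) := by
        obtain ⟨q, hq, hpq, hcase⟩ := prime_cases hp
        rcases hcase with hc | hc
        · have hq3 : q ≠ 3 := by
            rintro rfl
            exact hp.not_isUnit (h1.of_mul_right_left.isUnit_of_dvd' (by simpa using hpq) dvd_rfl)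
          obtain ⟨J, g1, g2, g3⟩ := rec_prime hp hq hc hq3
          refine ⟨J, g1, ⟨-1, by simpa using g2⟩, g3 n h3 ?_⟩
          exact h2.of_mul_right_left.of_isCoprime_of_dvd_right g1.symm.dvd
        · refine ⟨q, hc, ⟨q, by simp⟩, ?_⟩
          have c1 : ¬ (3 : ℤ) ∣ (q : ℤ) := by
            intro h
            have : q = 3 := ((Nat.prime_dvd_prime_iff_eq Nat.prime_three hq).1
              (by exact_mod_cast h)).symm
            subst this
            exact hp.not_isUnit (h1.of_mul_right_left.isUnit_of_dvd' (by simpa using hpq) dvd_rfl)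
          have c2 : IsCoprime n (q : ℤ) := by
            refine ((Nat.prime_iff_prime_int.1 hq).coprime_iff_not_dvd.2 ?_).symm
            intro h
            have : p ∣ (n : Om) := hpq.trans (by
              have := map_dvd (Int.castRingHom Om) h
              simpa using this)
            exact hp.not_isUnit (h2.of_mul_right_left.isUnit_of_dvd' this dvd_rfl)
          have e1 := cub_int c1 c2
          have e2 := cub_int h3 c2.symm
          rw [Int.cast_natCast] at e1 e2
          rw [e1, e2]
      refine ⟨p' * a', hpp.mul_mul haa, ⟨m2 * m1, ?_⟩, ?_⟩
      · have : p' * a' - ((m2 * m1 : ℤ) : Om) = (p' - m2) * a' + m2 * (a' - m1) := by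
          push_cast; ring
        rw [this]
        exact dvd_add (hm2.mul_right _) (hm1.mul_left _)
      · rw [cub_mul_right _ (hpp.ne_zero_iff.1 hp.ne_zero) (haa.ne_zero_iff.1 ha),
          cub_mul hn0 (three_coprime' h3), hra, hrp]
        · exact (h2.of_mul_right_left.of_isCoprime_of_dvd_right hpp.symm.dvd).symm
        · exact (h2.of_mul_right_right.of_isCoprime_of_dvd_right haa.symm.dvd).symm
  have h30 : ¬ IsUnit (3 : Om) := by
    intro h
    have := nm_of_isUnit h
    have e : (3 : Om) = ((3 : ℤ) : Om) := by norm_num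
    rw [e, nm_int] at this; norm_num at this
  have hB0 : B ≠ 0 := by
    rintro rfl
    exact h30 (isCoprime_zero_right.1 hB3)
  obtain ⟨B', ⟨u, hu⟩, ⟨m', hm'⟩, hr⟩ := key B hB3 hc hB0
  have hB3' : IsCoprime 3 B' := hB3.of_isCoprime_of_dvd_right
    (show Associated B B' from ⟨u, hu⟩).symm.dvd
  have hc' : IsCoprime (n : Om) B' := hc.of_isCoprime_of_dvd_right
    (show Associated B B' from ⟨u, hu⟩).symm.dvd
  -- m is invertible mod 3
  have hm3 : ¬ (3 : ℤ) ∣ m := by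
    rintro ⟨t, rfl⟩
    have : (3 : Om) ∣ B := by
      have h := dvd_add hB (Dvd.intro (t : Om) rfl : (3 : Om) ∣ 3 * (t : Om))
      push_cast at h
      simpa using h
    exact h30 (hB3.isUnit_of_dvd' dvd_rfl this)
  obtain ⟨s, t, hst⟩ := three_coprime hm3
  have hu1 : (u : Om) = 1 ∨ (u : Om) = -1 := by
    apply unit_primary u.isUnit (m := t * m')
    have : (u : Om) - ((t * m' : ℤ) : Om)
        = t * (B' - m') - (t * u) * (B - m) + 3 * (s * u) := by
      have e : (s : Om) * 3 + t * m = 1 := by exact_mod_cast congrArg (Int.cast (R := Om)) hst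
      push_cast
      rw [← hu]
      linear_combination (-(u : Om)) * e
    rw [this]
    exact dvd_add (dvd_sub (hm'.mul_left _) (hB.mul_left _)) (Dvd.intro _ rfl)
  have hn0 := cast_ne_zero (ne_zero_of_not_three_dvd h3)
  rcases hu1 with h | h
  · rw [h, mul_one] at hu; rw [hu]; exact hr
  · rw [h, mul_neg, mul_one] at hu
    rw [← hu] at hr hc'
    rw [cub_assoc _ (Associated.neg_right (Associated.refl B)), hr,
      cub_neg hn0 (three_coprime' h3) hc.symm]

end MRank

namespace MRank

open UniqueFactorizationMonoid

section ext
open Polynomial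
variable {F L : Type*} [Field F] [Field L] [Algebra F L] [FiniteDimensional F L]

lemma root_of_ext {f : F[X]} (hm : f.Monic) (hdeg : f.natDegree ∈ Finset.Icc 1 3)
    (h : ¬ f.natDegree ∣ Module.finrank F L) {t : L} (ht : aeval t f = 0) : ∃ x, IsRoot f x := by
  by_contra hcon
  push Not at hcon
  have hirr := irreducible_of_degree_le_three_of_not_isRoot hdeg hcon
  apply h
  rw [minpoly.eq_of_irreducible_of_monic hirr ht hm]
  exact minpoly.degree_dvd (Algebra.IsIntegral.isIntegral t)

/-- the cubic polynomial -/
noncomputable def cubP (a b : F) : F[X] := X ^ 3 - C (3 * a) * X - C (2 * b)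

lemma cubP_natDegree (a b : F) : (cubP a b).natDegree = 3 := by
  unfold cubP; compute_degree!

lemma cubP_monic (a b : F) : (cubP a b).Monic := by
  unfold cubP; monicity!

lemma cubP_aeval (a b : F) (t : L) : aeval t (cubP a b)
    = t ^ 3 - 3 * algebraMap F L a * t - 2 * algebraMap F L b := by
  simp only [cubP, map_sub, map_mul, map_pow, Polynomial.aeval_X, Polynomial.aeval_C, map_ofNat]

lemma cubic_root_of_ext (h : ¬ 3 ∣ Module.finrank F L) {a b : F} {t : L}
    (ht : t ^ 3 - 3 * algebraMap F L a * t - 2 * algebraMap F L b = 0) :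
    ∃ x : F, x ^ 3 - 3 * a * x - 2 * b = 0 := by
  obtain ⟨x, hx⟩ := root_of_ext (cubP_monic a b) (by rw [cubP_natDegree]; decide)
    (by rw [cubP_natDegree]; exact h) (by rw [cubP_aeval]; exact ht)
  refine ⟨x, ?_⟩
  simpa [cubP, IsRoot.def] using hx

lemma sq_of_ext (h : ¬ 2 ∣ Module.finrank F L) {a : F} {t : L}
    (ht : t ^ 2 = algebraMap F L a) : ∃ x : F, x ^ 2 = a := by
  have hd : (X ^ 2 - C a : F[X]).natDegree = 2 := by compute_degree!
  obtain ⟨x, hx⟩ := root_of_ext (f := X ^ 2 - C a) (by monicity!) (by rw [hd]; decide)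
    (by rw [hd]; exact h) (t := t) (by simp [ht])
  exact ⟨x, by simpa [sub_eq_zero] using hx⟩

end ext

lemma cubic_root_of_nonsq {p : ℕ} [hp : Fact p.Prime] {a b E k : ZMod p} (h2 : (2 : ZMod p) ≠ 0)
    (h3 : (3 : ZMod p) ≠ 0) (hE : E ≠ 0) (hk : k ≠ 0) (heq : b ^ 2 + 27 * E ^ 2 * k = a ^ 3)
    (hns : ¬ ∃ h, h ^ 2 = k) : ∃ t : ZMod p, t ^ 3 - 3 * a * t - 2 * b = 0 := by
  by_contra hcon
  have hirr : Irreducible (cubP a b) := by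
    apply Polynomial.irreducible_of_degree_le_three_of_not_isRoot
    · rw [cubP_natDegree]; decide
    · intro x hx
      exact hcon ⟨x, by simpa [cubP, Polynomial.IsRoot.def] using hx⟩
  haveI : Fact (Irreducible (cubP a b)) := ⟨hirr⟩
  let L := AdjoinRoot (cubP a b)
  let t : L := AdjoinRoot.root (cubP a b)
  have hm := cubP_monic a b
  let pb := AdjoinRoot.powerBasis' hm
  haveI : FiniteDimensional (ZMod p) L := pb.finite
  have hfr : Module.finrank (ZMod p) L = 3 := by
    rw [pb.finrank, AdjoinRoot.powerBasis'_dim, cubP_natDegree]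
  let j := algebraMap (ZMod p) L
  have ht : t ^ 3 - 3 * j a * t - 2 * j b = 0 := by
    rw [← cubP_aeval, AdjoinRoot.aeval_eq, AdjoinRoot.mk_self]
  haveI : CharP L p := charP_of_injective_algebraMap j.injective p
  have hjp : ∀ x : ZMod p, (j x) ^ p = j x := by
    intro x; rw [← map_pow, ZMod.pow_card]
  have hs : (t ^ p) ^ 3 - 3 * j a * t ^ p - 2 * j b = 0 := by
    have := congrArg (frobenius L p) ht
    simp only [map_sub, map_mul, map_pow, map_zero, map_ofNat] at this
    simpa [frobenius_def, hjp] using this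
  have hne : t ^ p ≠ t := by
    intro h
    have h5 := (Subfield.mem_bot_iff_pow_eq_self L p).2 h
    rw [← ZMod.fieldRange_castHom_eq_bot p] at h5
    obtain ⟨x, hx⟩ := h5
    have hx' : j x = t := by
      rw [← hx]; congr 1; exact Subsingleton.elim _ _
    apply hcon
    refine ⟨x, j.injective ?_⟩
    rw [← hx'] at ht
    simp only [map_sub, map_mul, map_pow, map_zero, map_ofNat]
    exact ht
  set s := t ^ p with hsdef
  have hq : s ^ 2 + s * t + t ^ 2 - 3 * j a = 0 := by
    have : (s - t) * (s ^ 2 + s * t + t ^ 2 - 3 * j a) = 0 := by linear_combination hs - ht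
    exact (mul_eq_zero.1 this).resolve_left (sub_ne_zero.2 hne)
  have heqL : (j b) ^ 2 + 27 * (j E) ^ 2 * j k = (j a) ^ 3 := by
    have := congrArg j heq
    simpa only [map_add, map_mul, map_pow, map_ofNat] using this
  have hdisc : (54 * j E) ^ 2 * j k = ((2 * s + t) * (3 * t ^ 2 - 3 * j a)) ^ 2 := by
    linear_combination 108 * heqL - 4 * (3 * t ^ 2 - 3 * j a) ^ 2 * hq
      + 27 * (2 * j b + t ^ 3 - 3 * j a * t) * ht
  have h54 : (54 : ZMod p) ≠ 0 := by
    rw [show (54 : ZMod p) = 2 * 3 ^ 3 by norm_num]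
    exact mul_ne_zero h2 (pow_ne_zero _ h3)
  have hE' : (54 * j E) ≠ 0 := by
    have : 54 * j E = j (54 * E) := by rw [map_mul, map_ofNat]
    rw [this]
    exact (map_ne_zero j).2 (mul_ne_zero h54 hE)
  apply hns
  apply sq_of_ext (L := L) (by rw [hfr]; decide)
    (t := ((2 * s + t) * (3 * t ^ 2 - 3 * j a)) / (54 * j E))
  rw [div_pow, ← hdisc, mul_div_cancel_left₀ _ (pow_ne_zero 2 hE')]

lemma cubic_two_roots {F : Type*} [Field F] {a b E h t : F} (h2 : (2 : F) ≠ 0)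
    (h3 : (3 : F) ≠ 0) (hE : E ≠ 0) (hh : h ≠ 0) (heq : b ^ 2 + 27 * E ^ 2 * h ^ 2 = a ^ 3)
    (ht : t ^ 3 - 3 * a * t - 2 * b = 0) :
    ∃ t s : F, t ≠ s ∧ t ^ 3 - 3 * a * t - 2 * b = 0 ∧ s ^ 3 - 3 * a * s - 2 * b = 0 := by
  have hdisc : (54 * E * h) ^ 2 = (12 * a - 3 * t ^ 2) * (3 * t ^ 2 - 3 * a) ^ 2 := by
    linear_combination 108 * heq + 27 * (2 * b + t ^ 3 - 3 * a * t) * ht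
  have h54 : 54 * E * h ≠ 0 := by
    rw [show (54 : F) = 2 * 3 ^ 3 by norm_num]
    exact mul_ne_zero (mul_ne_zero (mul_ne_zero h2 (pow_ne_zero _ h3)) hE) hh
  have hd : 3 * t ^ 2 - 3 * a ≠ 0 := by
    intro h; rw [h] at hdisc
    exact h54 (pow_eq_zero_iff two_ne_zero |>.1 (by rw [hdisc]; ring))
  obtain ⟨r, hr⟩ : ∃ r, r * (3 * t ^ 2 - 3 * a) = 54 * E * h :=
    ⟨54 * E * h / (3 * t ^ 2 - 3 * a), div_mul_cancel₀ _ hd⟩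
  have hr2 : r ^ 2 = 12 * a - 3 * t ^ 2 := by
    apply mul_right_cancel₀ (pow_ne_zero 2 hd)
    rw [← hdisc, ← hr]; ring
  obtain ⟨s, hs⟩ : ∃ s, 2 * s = -t + r := ⟨(-t + r) / 2, mul_div_cancel₀ _ h2⟩
  have hrs : r = 2 * s + t := by linear_combination -hs
  have hq : s ^ 2 + s * t + t ^ 2 - 3 * a = 0 := by
    rw [hrs] at hr2
    have : (2 * 2) * (s ^ 2 + s * t + t ^ 2 - 3 * a) = 0 := by linear_combination hr2
    exact (mul_eq_zero.1 this).resolve_left (mul_ne_zero h2 h2)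
  refine ⟨t, s, ?_, ht, ?_⟩
  · rintro rfl
    exact hd (by linear_combination hq)
  · linear_combination ht + (s - t) * hq

/-- the Eisenstein integer attached to a point -/
noncomputable def bet (b E h : ℤ) : Om := b + 3 * (2 * om + 1) * (E * h : ℤ)

lemma cO_bet (b E h : ℤ) : cO (bet b E h) = b - 3 * (2 * om + 1) * (E * h : ℤ) := by
  simp only [bet, map_add, map_mul, map_intCast, map_ofNat, map_one, cO_om]
  ring

lemma sqrt3_sq : (2 * om + 1) ^ 2 = -3 := by linear_combination 4 * om_eq

lemma bet_mul_cO (b E h : ℤ) : bet b E h * cO (bet b E h) = ((b ^ 2 + 27 * E ^ 2 * h ^ 2 : ℤ) : Om) := by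
  rw [cO_bet, bet]; push_cast; linear_combination -9 * (E * h) ^ 2 * sqrt3_sq

lemma nat_eq_of_prime_dvd {π : Om} (hπ : Prime π) {p q : ℕ} (hp : p.Prime) (hq : q.Prime)
    (h1 : π ∣ (p : Om)) (h2 : π ∣ (q : Om)) : p = q := by
  by_contra h
  have := isCoprime_cast (Nat.isCoprime_iff_coprime.2 ((Nat.coprime_primes hp hq).2 h))
  exact hπ.not_isUnit (this.isUnit_of_dvd' (by simpa using h1) (by simpa using h2))

lemma cubic_root_of_cub {p : ℕ} [hp : Fact p.Prime] (hp3 : p ≠ 3) {a b E h : ℤ}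
    (ha : ¬ (p : ℤ) ∣ a) (heq : (p : ℤ) ∣ b ^ 2 + 27 * E ^ 2 * h ^ 2 - a ^ 3)
    (hc : cub (bet b E h) (p : Om) = 0) :
    ∃ t : ZMod p, t ^ 3 - 3 * (a : ZMod p) * t - 2 * (b : ZMod p) = 0 := by
  have hpp := hp.1
  have hp0 : (p : Om) ≠ 0 := by
    have := cast_ne_zero (n := (p : ℤ)) (by exact_mod_cast hpp.ne_zero)
    simpa using this
  have hpu : ¬ IsUnit (p : Om) := by
    intro h
    have := nm_of_isUnit h
    rw [nm_natCast] at this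
    have h1 := hpp.one_lt
    have : p ^ 2 = 1 := by exact_mod_cast this
    nlinarith
  obtain ⟨π, hirr, hπp⟩ := WfDvdMonoid.exists_irreducible_factor hpu hp0
  have hπ : Prime π := irreducible_iff_prime.1 hirr
  have p3 : ¬ (3 : ℤ) ∣ (p : ℤ) := by
    intro h
    exact hp3 ((Nat.prime_dvd_prime_iff_eq Nat.prime_three hpp).1 (by exact_mod_cast h)).symm
  have c3p : IsCoprime (3 : Om) (p : Om) := by simpa using three_coprime' p3
  have cap : IsCoprime (a : Om) (p : Om) := by
    have := isCoprime_cast ((Nat.prime_iff_prime_int.1 hpp).coprime_iff_not_dvd.2 ha).symm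
    simpa using this
  have c3π := c3p.of_isCoprime_of_dvd_right hπp
  have caπ := cap.of_isCoprime_of_dvd_right hπp
  set β := bet b E h with hβ
  obtain ⟨z, hz⟩ := heq
  have hββ : β * cO β = (a : Om) ^ 3 + (p : Om) * z := by
    rw [hβ, bet_mul_cO, show b ^ 2 + 27 * E ^ 2 * h ^ 2 = a ^ 3 + p * z by linarith]
    push_cast; rfl
  have cβ2 : IsCoprime (β * cO β) (p : Om) := by
    rw [hββ]
    exact (IsCoprime.add_mul_left_left_iff).2 cap.pow_left
  have cβp := cβ2.of_mul_left_left
  have cβp' := cβ2.of_mul_left_right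
  have cβ := cβp.of_isCoprime_of_dvd_right hπp
  have cβ' := cβp'.of_isCoprime_of_dvd_right hπp
  obtain ⟨q, hq, hπq, hcase⟩ := prime_cases hπ
  have hqp : q = p := nat_eq_of_prime_dvd hπ hq hpp hπq hπp
  subst hqp
  have hrel : cub β π + cub (cO β) π = 0 := by
    rw [← cub_mul hπ.ne_zero c3π cβ cβ', hββ, cub_congr hπ.ne_zero (β' := (a : Om) ^ 3)
      (by rw [add_sub_cancel_left]; exact hπp.mul_right _), cub_cube hπ.ne_zero c3π caπ]
  have hsym : cub β π = 0 := by
    rcases hcase with hcase | hcase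
    · have e : (q : Om) = π * cO π := by rw [mul_cO, hcase]; simp
      have h0 : cO π ≠ 0 := (map_ne_zero_iff cO cO.injective).2 hπ.ne_zero
      rw [e, cub_mul_right _ hπ.ne_zero h0] at hc
      have h5 := cub_conj hπ.ne_zero c3π cβ'
      rw [cO_cO] at h5
      rw [h5] at hc
      generalize cub β π = x at *
      generalize cub (cO β) π = y at *
      clear h5
      revert hc hrel; revert x y; decide
    · rw [cub_assoc _ hcase]; exact hc
  rw [cub_prime hπ, sym] at hsym
  set Q := Ideal.span {π} with hQ
  have hQprime : Q.IsPrime := (Ideal.span_singleton_prime hπ.ne_zero).2 hπ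
  have hQ0 : Q ≠ ⊥ := by rw [hQ, Ne, Ideal.span_singleton_eq_bot]; exact hπ.ne_zero
  haveI : Q.IsMaximal := hQprime.isMaximal hQ0
  letI := Ideal.Quotient.field Q
  haveI := Om_quot_finite hQ0
  letI := Fintype.ofFinite (Om ⧸ Q)
  have hπQ : π ∈ Q := Ideal.mem_span_singleton_self π
  have hβ0 := mk_ne (notMem_of_coprime hQprime cβ hπQ)
  obtain ⟨ζ, hζ⟩ := exists_cube_root (mk_om_eq Q)
    (mk_om_ne (notMem_of_coprime hQprime c3π hπQ)) hβ0 hsym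
  have hζ0 : ζ ≠ 0 := by
    rintro rfl
    rw [zero_pow three_ne_zero] at hζ
    exact hβ0 hζ.symm
  have hqz : ((q : ℕ) : Om ⧸ Q) = 0 := by
    rw [← map_natCast (Ideal.Quotient.mk Q)]
    exact Ideal.Quotient.eq_zero_iff_mem.2 (Ideal.mem_span_singleton.2 hπp)
  have hββ' : ζ ^ 3 * Ideal.Quotient.mk Q (cO β) = (a : Om ⧸ Q) ^ 3 := by
    rw [hζ, ← map_mul, hββ]
    simp [hqz]
  have hsum : ζ ^ 3 + Ideal.Quotient.mk Q (cO β) = 2 * (b : Om ⧸ Q) := by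
    rw [hζ, ← map_add, hβ, cO_bet, bet]
    rw [show ((b : Om) + 3 * (2 * om + 1) * (E * h : ℤ)) + (b - 3 * (2 * om + 1) * (E * h : ℤ))
      = 2 * (b : Om) by ring]
    rw [map_mul, map_ofNat, map_intCast]
  haveI : CharP (Om ⧸ Q) q := by
    have h6 : ringChar (Om ⧸ Q) = q :=
      ((Nat.dvd_prime hpp).1 ((ringChar.spec _ _).1 hqz)).resolve_left CharP.ringChar_ne_one
    rw [← h6]; infer_instance
  letI : Algebra (ZMod q) (Om ⧸ Q) := ZMod.algebra _ q
  haveI : FiniteDimensional (ZMod q) (Om ⧸ Q) := Module.Finite.of_finite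
  refine cubic_root_of_ext (L := Om ⧸ Q) ?_ (t := ζ + (a : Om ⧸ Q) / ζ) ?_
  · have h7 : Nat.card (Om ⧸ Q) = q ^ Module.finrank (ZMod q) (Om ⧸ Q) := by
      rw [Module.natCard_eq_pow_finrank (K := ZMod q), Nat.card_zmod]
    have hN : Ideal.absNorm Q = (nm π).natAbs := by rw [hQ, absNorm_span]
    rw [card_quot, hN] at h7
    intro h8
    have h9 : q ^ 3 ∣ (nm π).natAbs := by rw [h7]; exact pow_dvd_pow _ (Nat.le_of_dvd
      Module.finrank_pos h8)
    have h10 : (nm π).natAbs ∣ q ^ 2 := by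
      have e : nm π ∣ nm (q : Om) := by
        obtain ⟨y, hy⟩ := hπp; rw [hy, nm_mul]; exact Dvd.intro _ rfl
      rw [nm_natCast] at e
      have := Int.natAbs_dvd_natAbs.2 e
      simpa [Int.natAbs_pow] using this
    have h11 := (Nat.pow_dvd_pow_iff_le_right hpp.one_lt).1 (h9.trans h10)
    omega
  · rw [map_intCast, map_intCast]
    have e2 : Ideal.Quotient.mk Q (cO β) = (a : Om ⧸ Q) ^ 3 / ζ ^ 3 := by
      rw [← hββ']; exact (mul_div_cancel_left₀ _ (pow_ne_zero 3 hζ0)).symm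
    rw [e2] at hsum
    rw [← hsum]
    field_simp
    ring

lemma exists_sq_mod {k0 : ℤ} (hk : k0 ≠ 0) {p : ℕ} (hp : p.Prime) (hp2 : p ≠ 2)
    (hpk : ¬ (p : ℤ) ∣ k0) (h : (p : ZMod (4 * k0.natAbs)) = 1) : ∃ h : ZMod p, h ^ 2 = k0 := by
  haveI : Fact p.Prime := ⟨hp⟩
  have hmod : p % (4 * k0.natAbs) = 1 := by
    have h1 : ((p : ℕ) : ZMod (4 * k0.natAbs)) = ((1 : ℕ) : ZMod (4 * k0.natAbs)) := by simpa using h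
    rw [ZMod.natCast_eq_natCast_iff'] at h1
    rw [h1, Nat.mod_eq_of_lt]
    have : 0 < k0.natAbs := Int.natAbs_pos.2 hk
    omega
  have h1 := jacobiSym.mod_right k0 (hp.odd_of_ne_two hp2)
  rw [hmod, jacobiSym.one_right, ← jacobiSym.legendreSym.to_jacobiSym] at h1
  have h2 : ((k0 : ℤ) : ZMod p) ≠ 0 := by
    rwa [Ne, ZMod.intCast_zmod_eq_zero_iff_dvd]
  obtain ⟨r, hr⟩ := (legendreSym.eq_one_iff p h2).1 h1
  exact ⟨r, by rw [hr]; ring⟩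

theorem cubic_root_of_cub_all {a b E k0 : ℤ} (ha : a ≠ 0) (hE : E ≠ 0) (hk : k0 ≠ 0)
    (heq : b ^ 2 + 27 * E ^ 2 * k0 = a ^ 3) {B : ℕ} (hB : 0 < B)
    (hyp : ∀ p : ℕ, p.Prime → ¬ p ∣ B → ∀ h : ℤ, (p : ℤ) ∣ h ^ 2 - k0 →
      cub (bet b E h) (p : Om) = 0) : ∃ t : ℚ, t ^ 3 - 3 * a * t - 2 * b = 0 := by
  set B' : ℕ := B * (6 * (a * E * k0)).natAbs with hB'
  have hpos : 0 < B' := by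
    apply Nat.mul_pos hB
    rw [Int.natAbs_pos]
    exact mul_ne_zero (by norm_num) (mul_ne_zero (mul_ne_zero ha hE) hk)
  haveI : NeZero (4 * k0.natAbs) := ⟨by
    have : 0 < k0.natAbs := Int.natAbs_pos.2 hk
    omega⟩
  have good : ∀ p : ℕ, p.Prime → ¬ p ∣ B' → ¬ p ∣ B ∧ p ≠ 2 ∧ p ≠ 3 ∧ ¬ (p : ℤ) ∣ a ∧
      ¬ (p : ℤ) ∣ E ∧ ¬ (p : ℤ) ∣ k0 := by
    intro p hp h
    have h1 : ¬ (p : ℤ) ∣ 6 * (a * E * k0) := fun h' => h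
      (Dvd.dvd.mul_left (Int.natCast_dvd.1 h') _)
    refine ⟨fun h' => h (h'.mul_right _), ?_, ?_, fun h' => h1 ?_, fun h' => h1 ?_, fun h' => h1 ?_⟩
    · rintro rfl; exact h1 (Dvd.dvd.mul_right (by norm_num) _)
    · rintro rfl; exact h1 (Dvd.dvd.mul_right (by norm_num) _)
    · exact ((h'.mul_right _).mul_right _).mul_left _
    · exact ((h'.mul_left _).mul_right _).mul_left _
    · exact (h'.mul_left _).mul_left _
  have cst : ∀ p : ℕ, p.Prime → ∀ m : ℤ, ¬ (p : ℤ) ∣ m → ((m : ℤ) : ZMod p) ≠ 0 := by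
    intro p hp m hm
    rwa [Ne, ZMod.intCast_zmod_eq_zero_iff_dvd]
  have c2 : ∀ p : ℕ, p.Prime → p ≠ 2 → (2 : ZMod p) ≠ 0 := by
    intro p hp hp2
    have := cst p hp 2 (fun h => hp2 ((Nat.prime_dvd_prime_iff_eq hp Nat.prime_two).1
      (by exact_mod_cast h)))
    simpa using this
  have c3 : ∀ p : ℕ, p.Prime → p ≠ 3 → (3 : ZMod p) ≠ 0 := by
    intro p hp hp2
    have := cst p hp 3 (fun h => hp2 ((Nat.prime_dvd_prime_iff_eq hp Nat.prime_three).1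
      (by exact_mod_cast h)))
    simpa using this
  have heqp : ∀ p : ℕ, (b : ZMod p) ^ 2 + 27 * (E : ZMod p) ^ 2 * (k0 : ZMod p)
      = (a : ZMod p) ^ 3 := by
    intro p
    exact_mod_cast congrArg (Int.cast (R := ZMod p)) heq
  have h1 : ∀ p : ℕ, p.Prime → ¬ p ∣ B' →
      ∃ t : ZMod p, t ^ 3 - 3 * (a : ZMod p) * t - 2 * b = 0 := by
    intro p hp hpB
    haveI : Fact p.Prime := ⟨hp⟩
    obtain ⟨g1, g2, g3, g4, g5, g6⟩ := good p hp hpB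
    by_cases hsq : ∃ h : ZMod p, h ^ 2 = (k0 : ZMod p)
    · obtain ⟨h, hh⟩ := hsq
      obtain ⟨h', rfl⟩ := ZMod.intCast_surjective h
      have hd : (p : ℤ) ∣ h' ^ 2 - k0 := by
        rw [← ZMod.intCast_zmod_eq_zero_iff_dvd]; push_cast; rw [hh, sub_self]
      refine cubic_root_of_cub g3 g4 (E := E) (h := h') ?_ (hyp p hp g1 h' hd)
      have : b ^ 2 + 27 * E ^ 2 * h' ^ 2 - a ^ 3 = 27 * E ^ 2 * (h' ^ 2 - k0) := by
        linear_combination heq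
      rw [this]; exact hd.mul_left _
    · exact cubic_root_of_nonsq (c2 p hp g2) (c3 p hp g3) (cst p hp E g5) (cst p hp k0 g6)
        (heqp p) hsq
  refine cubic_has_root a b B' hpos (4 * k0.natAbs) h1 ?_
  intro p hp hpB hpq
  haveI : Fact p.Prime := ⟨hp⟩
  obtain ⟨g1, g2, g3, g4, g5, g6⟩ := good p hp hpB
  obtain ⟨t, ht⟩ := h1 p hp hpB
  obtain ⟨h, hh⟩ := exists_sq_mod hk hp g2 g6 hpq
  have hh0 : h ≠ 0 := by
    rintro rfl
    exact cst p hp k0 g6 (by rw [← hh]; ring)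
  exact cubic_two_roots (c2 p hp g2) (c3 p hp g3) (cst p hp E g5) hh0
    (by rw [hh]; exact heqp p) ht

end MRank

namespace MRank
section
open UniqueFactorizationMonoid nonZeroDivisors

variable {R : Type*} [CommRing R] [IsDedekindDomain R]

/-- additive extension of a function on primes to ideals -/
noncomputable def chi (f : Ideal R → ZMod 3) (I : Ideal R) : ZMod 3 :=
  ((normalizedFactors I).map f).sum

lemma chi_mul (f : Ideal R → ZMod 3) {I J : Ideal R} (hI : I ≠ ⊥) (hJ : J ≠ ⊥) :
    chi f (I * J) = chi f I + chi f J := by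
  rw [chi, normalizedFactors_mul hI hJ, Multiset.map_add, Multiset.sum_add]
  rfl

lemma chi_prime (f : Ideal R → ZMod 3) {P : Ideal R} (hP : P.IsPrime) (h0 : P ≠ ⊥) :
    chi f P = f P := by
  rw [chi, normalizedFactors_irreducible (Ideal.prime_of_isPrime h0 hP).irreducible]
  simp

lemma chi_one (f : Ideal R → ZMod 3) : chi f (1 : Ideal R) = 0 := by
  rw [chi, normalizedFactors_one, Multiset.map_zero, Multiset.sum_zero]

lemma exists_coprime_rep {M : R} (hM : M ≠ 0) (c : ClassGroup R) :
    ∃ I : (Ideal R)⁰, ClassGroup.mk0 I = c ∧ IsCoprime (I : Ideal R) (Ideal.span {M}) := by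
  obtain ⟨J, hJ⟩ := ClassGroup.mk0_surjective (c⁻¹)
  have hJ0 : (J : Ideal R) ≠ 0 := nonZeroDivisors.coe_ne_zero J
  have hM0 : Ideal.span {M} ≠ 0 := by simpa using hM
  obtain ⟨a, ha⟩ := IsDedekindDomain.exists_sup_span_eq
    (I := Ideal.span {M} * (J : Ideal R)) (J := (J : Ideal R)) Ideal.mul_le_right
    (mul_ne_zero hM0 hJ0)
  by_cases ha0 : a = 0
  · subst ha0
    obtain ⟨I, hI⟩ := ClassGroup.mk0_surjective c
    refine ⟨I, hI, ?_⟩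
    have h1 : Ideal.span {M} * (J : Ideal R) = 1 * J := by
      simpa using ha
    have := mul_right_cancel₀ hJ0 h1
    rw [this]
    exact isCoprime_one_right
  · have h1 : (J : Ideal R) ∣ Ideal.span {a} := by
      rw [Ideal.dvd_iff_le]; rw [← ha]; exact le_sup_right
    obtain ⟨I, hI⟩ := h1
    have hI0 : I ≠ 0 := by
      rintro rfl
      rw [mul_zero] at hI
      exact ha0 (by simpa using hI)
    refine ⟨⟨I, mem_nonZeroDivisors_of_ne_zero hI0⟩, ?_, ?_⟩
    · rw [← inv_inv c, ← hJ, ClassGroup.mk0_eq_mk0_inv_iff]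
      exact ⟨a, ha0, by rw [hI, mul_comm]⟩
    · have h2 : (I ⊔ Ideal.span {M}) * (J : Ideal R) = 1 * J := by
        rw [Ideal.sup_mul, one_mul, sup_comm]
        rw [hI, mul_comm (J : Ideal R) I] at ha
        exact ha
      exact Ideal.isCoprime_iff_add.2 (mul_right_cancel₀ hJ0 h2)

theorem exists_char (f : Ideal R → ZMod 3) {M : R} (hM : M ≠ 0)
    (h : ∀ γ : R, γ ≠ 0 → IsCoprime γ M → chi f (Ideal.span {γ}) = 0) :
    ∃ χ : ClassGroup R →* Multiplicative (ZMod 3), ∀ I : (Ideal R)⁰,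
      IsCoprime (I : Ideal R) (Ideal.span {M}) →
        χ (ClassGroup.mk0 I) = Multiplicative.ofAdd (chi f (I : Ideal R)) := by
  choose r hr hrc using exists_coprime_rep (R := R) hM
  have hpr : ∀ I : (Ideal R)⁰, IsCoprime (I : Ideal R) (Ideal.span {M}) →
      ClassGroup.mk0 I = 1 → chi f (I : Ideal R) = 0 := by
    intro I hc h1
    obtain ⟨γ, hγ⟩ := ((ClassGroup.mk0_eq_one_iff I.2).1 h1).principal
    have hγ' : (I : Ideal R) = Ideal.span {γ} := hγ
    rw [hγ']
    apply h
    · rintro rfl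
      exact nonZeroDivisors.coe_ne_zero I (by simpa using hγ')
    · rw [hγ', Ideal.isCoprime_span_singleton_iff] at hc
      exact hc
  have key : ∀ I J : (Ideal R)⁰, IsCoprime (I : Ideal R) (Ideal.span {M}) →
      IsCoprime (J : Ideal R) (Ideal.span {M}) → ClassGroup.mk0 I = ClassGroup.mk0 J →
      chi f (I : Ideal R) = chi f J := by
    intro I J hI hJ hIJ
    set L := r (ClassGroup.mk0 I)⁻¹ with hL
    have h1 : chi f ((I * L : (Ideal R)⁰) : Ideal R) = 0 := by
      apply hpr
      · exact IsCoprime.mul_left hI (hrc _)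
      · rw [map_mul, hL, hr, mul_inv_cancel]
    have h2 : chi f ((J * L : (Ideal R)⁰) : Ideal R) = 0 := by
      apply hpr
      · exact IsCoprime.mul_left hJ (hrc _)
      · rw [map_mul, hL, hr, hIJ, mul_inv_cancel]
    rw [Submonoid.coe_mul, chi_mul f (nonZeroDivisors.coe_ne_zero _)
      (nonZeroDivisors.coe_ne_zero _)] at h1 h2
    exact add_right_cancel (h1.trans h2.symm)
  have hmul : ∀ x y, chi f (r (x * y) : Ideal R) = chi f (r x : Ideal R) + chi f (r y : Ideal R) := by
    intro x y
    rw [← chi_mul f (nonZeroDivisors.coe_ne_zero _) (nonZeroDivisors.coe_ne_zero _),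
      ← Submonoid.coe_mul]
    apply key _ _ (hrc _)
    · exact IsCoprime.mul_left (hrc _) (hrc _)
    · rw [map_mul, hr, hr, hr]
  refine ⟨MonoidHom.mk' (fun x => Multiplicative.ofAdd (chi f (r x : Ideal R))) ?_, ?_⟩
  · intro x y
    rw [hmul, ofAdd_add]
  · intro I hI
    rw [MonoidHom.mk'_apply, key _ I (hrc _) hI (hr _)]

/-- two characters agreeing on primes coprime to `M` agree. -/
theorem char_ext {M : R} (hM : M ≠ 0) {H : Type*} [CommGroup H] (χ χ' : ClassGroup R →* H)
    (h : ∀ (P : (Ideal R)⁰), (P : Ideal R).IsPrime → IsCoprime (P : Ideal R) (Ideal.span {M}) →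
      χ (ClassGroup.mk0 P) = χ' (ClassGroup.mk0 P)) : χ = χ' := by
  have key : ∀ I : Ideal R, I ≠ ⊥ → ∀ hI : I ∈ (Ideal R)⁰, IsCoprime I (Ideal.span {M}) →
      χ (ClassGroup.mk0 ⟨I, hI⟩) = χ' (ClassGroup.mk0 ⟨I, hI⟩) := by
    intro I
    induction I using UniqueFactorizationMonoid.induction_on_prime with
    | h₁ => intro h; exact absurd rfl h
    | h₂ x hx =>
      intro _ hI _
      have : x = 1 := by rwa [Ideal.isUnit_iff, ← Ideal.one_eq_top] at hx
      subst this
      have : (⟨1, hI⟩ : (Ideal R)⁰) = 1 := rfl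
      rw [this, map_one, map_one, map_one]
    | h₃ J P hJ hP ih =>
      intro _ hI hc
      have hP' : P ∈ (Ideal R)⁰ := mem_nonZeroDivisors_of_ne_zero hP.ne_zero
      have hJ' : J ∈ (Ideal R)⁰ := mem_nonZeroDivisors_of_ne_zero hJ
      have : (⟨P * J, hI⟩ : (Ideal R)⁰) = ⟨P, hP'⟩ * ⟨J, hJ'⟩ := rfl
      rw [this, map_mul, map_mul, map_mul, ih hJ hJ' (hc.of_mul_left_right),
        h ⟨P, hP'⟩ (Ideal.isPrime_of_prime hP) (hc.of_mul_left_left)]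
  ext x
  obtain ⟨I, hI, hc⟩ := exists_coprime_rep hM x
  rw [← hI]
  exact key I (nonZeroDivisors.coe_ne_zero I) I.2 hc

/-- number of cubic characters -/
theorem card_hom_three (G : Type*) [CommGroup G] [Finite G] :
    Finite (G →* Multiplicative (ZMod 3)) ∧
    Nat.card (G →* Multiplicative (ZMod 3)) ≤ Nat.card {x : G // x ^ 3 = 1} := by
  obtain ⟨φ⟩ := CommGroup.monoidHom_mulEquiv_of_hasEnoughRootsOfUnity G ℂ
  obtain ⟨i, hi⟩ : ∃ i : Multiplicative (ZMod 3) →* ℂˣ, Function.Injective i := by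
    refine ⟨((ZMod.stdAddChar (N := 3)).toMonoidHom).toHomUnits, ?_⟩
    intro x y h
    exact ZMod.injective_stdAddChar (congrArg Units.val h)
  let F : (G →* Multiplicative (ZMod 3)) → {x : G // x ^ 3 = 1} := fun χ =>
    ⟨φ (i.comp χ), by
      rw [← map_pow]
      have : (i.comp χ) ^ 3 = 1 := by
        ext1 g
        rw [MonoidHom.pow_apply, MonoidHom.comp_apply, ← map_pow]
        have : (χ g) ^ 3 = 1 := by
          generalize χ g = z
          revert z; decide
        rw [this, map_one, MonoidHom.one_apply]
      rw [this, map_one]⟩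
  have hF : Function.Injective F := by
    intro χ χ' h
    have h1 := φ.injective (congrArg Subtype.val h)
    ext1 g
    exact hi (DFunLike.congr_fun h1 g)
  exact ⟨Finite.of_injective F hF, Nat.card_le_card_of_injective F hF⟩

end
end MRank

namespace MRank

lemma coprime_of_dvd_sub {R : Type*} [CommRing R] {a b n : R} (h : n ∣ a - b) (hb : IsCoprime b n) :
    IsCoprime a n := by
  obtain ⟨c, hc⟩ := h
  rw [show a = b + n * c by rw [← hc]; ring]
  exact hb.add_mul_left_left c

lemma bet_coprime {a b E k0 h n : ℤ} (heq : b ^ 2 + 27 * E ^ 2 * k0 = a ^ 3)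
    (hn : n ∣ h ^ 2 - k0) (han : IsCoprime a n) : IsCoprime (bet b E h) (n : Om) := by
  have h1 : IsCoprime (b ^ 2 + 27 * E ^ 2 * h ^ 2) n := by
    apply coprime_of_dvd_sub (b := a ^ 3) _ han.pow_left
    rw [← heq, show b ^ 2 + 27 * E ^ 2 * h ^ 2 - (b ^ 2 + 27 * E ^ 2 * k0)
      = (h ^ 2 - k0) * (27 * E ^ 2) by ring]
    exact hn.mul_right _
  have h2 := isCoprime_cast h1
  rw [← bet_mul_cO] at h2
  exact h2.of_mul_left_left

lemma exists_three_pow {e : ℤ} (he : e ≠ 0) : ∃ (j : ℕ) (e1 : ℤ), e = 3 ^ j * e1 ∧ ¬ (3 : ℤ) ∣ e1 := by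
  obtain ⟨j, e1, h1, h2⟩ := (Int.finiteMultiplicity_iff.2 ⟨by decide, he⟩ :
    FiniteMultiplicity (3 : ℤ) e).exists_eq_pow_mul_and_not_dvd |> fun ⟨c, h1, h2⟩ =>
      (⟨multiplicity 3 e, c, h1, h2⟩ : ∃ (j : ℕ) (e1 : ℤ), e = 3 ^ j * e1 ∧ ¬ (3 : ℤ) ∣ e1)
  exact ⟨j, e1, h1, h2⟩

theorem cub_vanish {a b e D k0 x y h : ℤ} (he : e ≠ 0) (hD : ¬ (3 : ℤ) ∣ D)
    (heq : b ^ 2 + 27 * (e ^ 3 * D) ^ 2 * k0 = a ^ 3)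
    (h3b : ¬ (3 : ℤ) ∣ b) (hbE : IsCoprime b (e ^ 3 * D)) (hxy : IsCoprime x y)
    (h3y : ¬ (3 : ℤ) ∣ y) {n : ℤ} (hn : n = x ^ 2 - k0 * y ^ 2) (h3n : ¬ (3 : ℤ) ∣ n)
    (han : IsCoprime a n) (hh : n ∣ y * h + x) :
    cub (bet b (e ^ 3 * D) h) (n : Om) = 0 := by
  have hn0 : (n : Om) ≠ 0 := cast_ne_zero (ne_zero_of_not_three_dvd h3n)
  have hn3 : IsCoprime (3 : Om) n := three_coprime' h3n
  have hyn : IsCoprime y n := by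
    rw [hn, show x ^ 2 - k0 * y ^ 2 = x ^ 2 + y * (-(k0 * y)) by ring]
    exact (hxy.symm.pow_right).add_mul_left_right _
  have hhk : n ∣ h ^ 2 - k0 := by
    have h1 : n ∣ y ^ 2 * (h ^ 2 - k0) := by
      obtain ⟨c, hc⟩ := hh
      refine ⟨c * (y * h - x) + 1, ?_⟩
      linear_combination (y * h - x) * hc - hn
    exact (hyn.symm.pow_right).dvd_of_dvd_mul_left h1
  have hβ : IsCoprime (bet b (e ^ 3 * D) h) (n : Om) := bet_coprime heq hhk han
  -- decompose
  obtain ⟨j, e1, hej, he1⟩ := exists_three_pow he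
  set g : ℤ := (Int.gcd y (e1 ^ 3 * D) : ℤ) with hg
  have hD0 : D ≠ 0 := ne_zero_of_not_three_dvd hD
  have hy0 : y ≠ 0 := ne_zero_of_not_three_dvd h3y
  obtain ⟨y', hy'⟩ : g ∣ y := Int.gcd_dvd_left ..
  obtain ⟨E2, hE2⟩ : g ∣ e1 ^ 3 * D := Int.gcd_dvd_right ..
  have hg0 : g ≠ 0 := by rintro h; rw [h] at hy'; simp at hy'; exact hy0 hy'
  have hyE2 : IsCoprime y' E2 := by
    have h1 := Int.gcd_eq_gcd_ab y (e1 ^ 3 * D)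
    rw [← hg] at h1
    refine ⟨Int.gcdA y (e1 ^ 3 * D), Int.gcdB y (e1 ^ 3 * D), ?_⟩
    apply mul_left_cancel₀ hg0
    generalize Int.gcdA y (e1 ^ 3 * D) = A at *
    generalize Int.gcdB y (e1 ^ 3 * D) = B at *
    linear_combination (-A) * hy' - B * hE2 - h1
  have h3E1 : ¬ (3 : ℤ) ∣ e1 ^ 3 * D := by
    intro h
    rcases Int.prime_three.dvd_or_dvd h with h | h
    · exact he1 (Int.prime_three.dvd_of_dvd_pow h)
    · exact hD h
  have h3E2 : ¬ (3 : ℤ) ∣ E2 := fun h => h3E1 (by rw [hE2]; exact h.mul_left _)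
  have h3y' : ¬ (3 : ℤ) ∣ y' := fun h => h3y (by rw [hy']; exact h.mul_left _)
  have hE : e ^ 3 * D = (3 ^ j) ^ 3 * (g * E2) := by rw [← hE2, hej]; ring
  have hbE2 : IsCoprime b E2 := by
    rw [hE] at hbE
    exact (hbE.of_mul_right_right).of_mul_right_right
  have hxy' : IsCoprime x y' := by rw [hy'] at hxy; exact hxy.of_mul_right_right
  have hgn : IsCoprime g n := by rw [hy'] at hyn; exact hyn.of_mul_left_left
  set E' : ℤ := (3 ^ j) ^ 3 * E2 with hE'
  have h3y'c : IsCoprime (3 : ℤ) y' := three_coprime h3y'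
  have hE'y : IsCoprime E' y' := IsCoprime.mul_left (h3y'c.pow_left.pow_left) hyE2.symm
  -- the number
  set B : Om := (b * y' : ℤ) - 3 * (2 * om + 1) * ((E' * x : ℤ) : Om) with hB
  have hgB : (n : Om) ∣ (y : Om) * bet b (e ^ 3 * D) h - g * B := by
    have h1 : (n : Om) ∣ ((y * h + x : ℤ) : Om) := by
      obtain ⟨c, hc⟩ := hh; exact ⟨c, by rw [hc]; push_cast; ring⟩
    have h2 : (y : Om) * bet b (e ^ 3 * D) h - g * B
        = ((y * h + x : ℤ) : Om) * (3 * (2 * om + 1) * ((e ^ 3 * D : ℤ) : Om)) := by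
      rw [bet, hB, hE, hE', hy']
      push_cast; ring
    rw [h2]; exact h1.mul_right _
  have hynO : IsCoprime (y : Om) n := isCoprime_cast hyn
  have hgnO : IsCoprime (g : Om) n := isCoprime_cast hgn
  have hgBn : IsCoprime ((g : Om) * B) n := by
    apply coprime_of_dvd_sub (b := (y : Om) * bet b (e ^ 3 * D) h)
    · rw [← dvd_neg, neg_sub]; exact hgB
    · exact hynO.mul_left hβ
  have hBn : IsCoprime B n := hgBn.of_mul_left_right
  have s1 : cub (bet b (e ^ 3 * D) h) (n : Om) = cub B n := by
    have h1 := cub_congr hn0 hgB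
    rw [cub_mul hn0 hn3 hynO hβ, cub_mul hn0 hn3 hgnO hBn, cub_int h3n hyn, cub_int h3n hgn,
      zero_add, zero_add] at h1
    exact h1
  have h3dB : (3 : Om) ∣ B - ((b * y' : ℤ) : Om) := ⟨-((2 * om + 1) * ((E' * x : ℤ) : Om)), by
    rw [hB]; ring⟩
  have h3by : ¬ (3 : ℤ) ∣ b * y' := fun h => (Int.prime_three.dvd_or_dvd h).elim h3b h3y'
  have hB3 : IsCoprime (3 : Om) B :=
    (coprime_of_dvd_sub h3dB (three_coprime' h3by).symm).symm
  have hB0 : B ≠ 0 := by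
    intro h0
    rw [h0, isCoprime_zero_right] at hB3
    obtain ⟨z, hz⟩ := hB3.exists_right_inv
    have := congrArg nm hz
    rw [nm_mul, show (3 : Om) = ((3 : ℤ) : Om) by norm_num, nm_int] at this
    have h1 : nm 1 = 1 := by have := nm_int 1; simpa using this
    rw [h1] at this
    omega
  rw [s1, ← recip h3n h3dB hB3 hBn.symm]
  -- coprimality with B
  have hE2B : IsCoprime (E2 : Om) B := by
    apply IsCoprime.symm
    apply coprime_of_dvd_sub (b := ((b * y' : ℤ) : Om))
    · refine ⟨-(3 * (2 * om + 1) * (((3 ^ j) ^ 3 * x : ℤ) : Om)), ?_⟩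
      rw [hB, hE']; push_cast; ring
    · exact isCoprime_cast (hbE2.mul_left hyE2)
  have hE'B : IsCoprime (E' : Om) B := by
    rw [hE']; push_cast
    exact (hB3.pow_left.pow_left).mul_left hE2B
  have h3y'O : IsCoprime (3 : Om) y' := three_coprime' h3y'
  have hsq : IsCoprime (2 * om + 1 : Om) y' := by
    have : IsCoprime ((2 * om + 1 : Om) ^ 2) y' := by rw [sqrt3_sq]; exact h3y'O.neg_left
    exact (IsCoprime.pow_left_iff two_pos).1 this
  have hExy : IsCoprime (E' * x) y' := hE'y.mul_left hxy'
  have hyB : IsCoprime (y' : Om) B := by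
    apply IsCoprime.symm
    apply coprime_of_dvd_sub (b := (-(2 * om + 1)) ^ 3 * ((-(E' * x) : ℤ) : Om))
    · refine ⟨b, ?_⟩
      rw [hB]
      push_cast
      linear_combination (-(2 * om + 1) * (E' * x : Om)) * sqrt3_sq
    · exact (hsq.neg_left.pow_left).mul_left (isCoprime_cast hExy.neg_left)
  have hy'0 : (y' : Om) ≠ 0 := cast_ne_zero (ne_zero_of_not_three_dvd h3y')
  have hyB0 : cub (y' : Om) B = 0 := by
    rw [recip h3y' h3dB hB3 hyB]
    rw [cub_congr (β' := (-(2 * om + 1)) ^ 3 * ((-(E' * x) : ℤ) : Om)) hy'0,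
      cub_mul hy'0 h3y'O hsq.neg_left.pow_left (isCoprime_cast hExy.neg_left),
      cub_cube hy'0 h3y'O hsq.neg_left, cub_int h3y' hExy.neg_left, add_zero]
    refine ⟨b, ?_⟩
    rw [hB]
    push_cast
    linear_combination (-(2 * om + 1) * (E' * x : Om)) * sqrt3_sq
  have hE2B0 : cub (E2 : Om) B = 0 := by
    rw [recip h3E2 h3dB hB3 hE2B]
    rw [cub_congr (β' := ((b * y' : ℤ) : Om)) (cast_ne_zero (ne_zero_of_not_three_dvd h3E2)),
      cub_int h3E2 (hbE2.mul_left hyE2)]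
    refine ⟨-(3 * (2 * om + 1) * (((3 ^ j) ^ 3 * x : ℤ) : Om)), ?_⟩
    rw [hB, hE']; push_cast; ring
  have hE'B0 : cub (E' : Om) B = 0 := by
    rw [hE']; push_cast
    rw [cub_mul hB0 hB3 hB3.pow_left.pow_left hE2B, hE2B0, cub_cube hB0 hB3 hB3.pow_left, add_zero]
  -- the relation
  have hrel : B * ((b * y' : ℤ) + 3 * (2 * om + 1) * ((E' * x : ℤ) : Om))
      = (y' : Om) ^ 2 * (a : Om) ^ 3 + ((3 : Om) ^ 3 * ((E' : Om) ^ 2 * n)) := by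
    have h1 : (b * y') ^ 2 + 27 * (E' * x) ^ 2 = y' ^ 2 * a ^ 3 + 3 ^ 3 * (E' ^ 2 * n) := by
      rw [← heq, hn, hE, hE', hy']; ring
    have h2 := congrArg (fun z : ℤ => (z : Om)) h1
    push_cast at h2
    rw [hB]; push_cast
    linear_combination h2 - 9 * ((E' : Om) * x) ^ 2 * sqrt3_sq
  have hdv : B ∣ (3 : Om) ^ 3 * ((E' : Om) ^ 2 * n) - (-(y' : Om) ^ 2) * (a : Om) ^ 3 :=
    ⟨((b * y' : ℤ) + 3 * (2 * om + 1) * ((E' * x : ℤ) : Om)), by rw [hrel]; ring⟩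
  have hlc : IsCoprime ((3 : Om) ^ 3 * ((E' : Om) ^ 2 * n)) B :=
    hB3.pow_left.mul_left (hE'B.pow_left.mul_left hBn.symm)
  have hya : IsCoprime ((-(y' : Om) ^ 2) * (a : Om) ^ 3) B := by
    apply coprime_of_dvd_sub _ hlc
    rw [← dvd_neg, neg_sub]; exact hdv
  have haB : IsCoprime (a : Om) B :=
    (IsCoprime.pow_left_iff three_pos).1 hya.of_mul_left_right
  have hfin := cub_congr hB0 hdv
  rw [cub_mul hB0 hB3 hB3.pow_left (hE'B.pow_left.mul_left hBn.symm),
    cub_mul hB0 hB3 hE'B.pow_left hBn.symm, cub_mul hB0 hB3 hyB.pow_left.neg_left haB.pow_left,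
    cub_neg hB0 hB3 hyB.pow_left, cub_cube hB0 hB3 haB, cub_cube hB0 hB3 hB3,
    cub_pow hB0 hB3 hE'B, cub_pow hB0 hB3 hyB, hE'B0, hyB0] at hfin
  simpa using hfin

end MRank

namespace MRank
section
open NumberField UniqueFactorizationMonoid nonZeroDivisors

variable {K : Type*} [Field K] [NumberField K] {k0 : ℤ} (e : ℤ√k0 ≃+* 𝓞 K)

open Classical in
/-- the local symbol at a prime ideal -/
noncomputable def fQ (b E : ℤ) (P : Ideal (𝓞 K)) : ZMod 3 :=
  if H : ∃ ph : ℕ × ℤ, ph.1.Prime ∧ (ph.1 : 𝓞 K) ∈ P ∧ ww e - ph.2 ∈ P then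
    cub (bet b E H.choose.2) (H.choose.1 : Om) else 0

lemma int_mem_iff {P : Ideal (𝓞 K)} (hP : P.IsPrime) {p : ℕ} (hp : p.Prime) (hpP : (p : 𝓞 K) ∈ P)
    (m : ℤ) : (m : 𝓞 K) ∈ P ↔ (p : ℤ) ∣ m := by
  constructor
  · intro hm
    by_contra hcon
    obtain ⟨u, v, huv⟩ := ((Nat.prime_iff_prime_int.1 hp).coprime_iff_not_dvd).2 hcon
    apply hP.ne_top
    rw [Ideal.eq_top_iff_one]
    have h1 : (1 : 𝓞 K) = u * p + v * m := by
      have := congrArg (fun z : ℤ => (z : 𝓞 K)) huv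
      push_cast at this; exact this.symm
    rw [h1]
    exact P.add_mem (P.mul_mem_left _ hpP) (P.mul_mem_left _ hm)
  · rintro ⟨c, rfl⟩
    push_cast
    exact P.mul_mem_right _ hpP

lemma exists_prime_mem {P : Ideal (𝓞 K)} (hP : P.IsPrime) (h0 : P ≠ ⊥) :
    ∃ p : ℕ, p.Prime ∧ (p : 𝓞 K) ∈ P := by
  have key : ∀ n : ℕ, n ≠ 0 → (n : 𝓞 K) ∈ P → ∃ p : ℕ, p.Prime ∧ (p : 𝓞 K) ∈ P := by
    intro n
    induction n using Nat.recOnMul with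
    | zero => intro h; exact absurd rfl h
    | one =>
      intro _ h
      exact absurd ((Ideal.eq_top_iff_one P).2 (by simpa using h)) hP.ne_top
    | prime p hp => intro _ h; exact ⟨p, hp, h⟩
    | mul a b iha ihb =>
      intro h h'
      rw [Nat.cast_mul] at h'
      rcases hP.mem_or_mem h' with h1 | h1
      · exact iha (left_ne_zero_of_mul h) h1
      · exact ihb (right_ne_zero_of_mul h) h1
  refine key (Ideal.absNorm P) ?_ (Ideal.absNorm_mem P)
  rw [Ne, Ideal.absNorm_eq_zero_iff]; exact h0

lemma sq_sub_mem {P : Ideal (𝓞 K)} {h : ℤ} (hw : ww e - h ∈ P) : ((h ^ 2 - k0 : ℤ) : 𝓞 K) ∈ P := by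
  have h1 : ((h ^ 2 - k0 : ℤ) : 𝓞 K) = (ww e - h) * (-(ww e + h)) := by
    have := ww_sq e
    push_cast
    linear_combination this
  rw [h1]; exact P.mul_mem_right _ hw

lemma fQ_eq (b E : ℤ) {P : Ideal (𝓞 K)} (hP : P.IsPrime) {p : ℕ} (hp : p.Prime)
    (hpP : (p : 𝓞 K) ∈ P) {h : ℤ} (hw : ww e - h ∈ P) : fQ e b E P = cub (bet b E h) (p : Om) := by
  have H : ∃ ph : ℕ × ℤ, ph.1.Prime ∧ (ph.1 : 𝓞 K) ∈ P ∧ ww e - ph.2 ∈ P := ⟨(p, h), hp, hpP, hw⟩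
  rw [fQ, dif_pos H]
  obtain ⟨h1, h2, h3⟩ := H.choose_spec
  generalize H.choose = q at *
  obtain ⟨q, h'⟩ := q
  simp only at h1 h2 h3 ⊢
  have hpq : q = p := by
    have := (int_mem_iff hP hp hpP q).1 (by simpa using h2)
    exact ((Nat.prime_dvd_prime_iff_eq hp h1).1 (Int.natCast_dvd_natCast.1 this)).symm
  subst hpq
  have hd : (q : ℤ) ∣ h' - h := by
    rw [← int_mem_iff hP hp hpP]
    have := P.sub_mem hw h3
    rw [show ((h' - h : ℤ) : 𝓞 K) = ww e - h - (ww e - h') by push_cast; ring]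
    exact this
  obtain ⟨c, hc⟩ := hd
  apply cub_congr (by have := cast_ne_zero (n := (q : ℤ)) (by exact_mod_cast hp.ne_zero); simpa using this)
  refine ⟨3 * (2 * om + 1) * (E * c : ℤ), ?_⟩
  have hc' : (h' : Om) - h = q * c := by
    have := congrArg (fun z : ℤ => (z : Om)) hc
    push_cast at this; exact this
  rw [bet, bet]; push_cast
  linear_combination 3 * (2 * om + 1) * (E : Om) * hc'

lemma absNorm_of_w {I : Ideal (𝓞 K)} {h : ℤ} (hw : ww e - h ∈ I) {m : ℤ}
    (hm : ∀ j : ℤ, (j : 𝓞 K) ∈ I ↔ m ∣ j) : Ideal.absNorm I = m.natAbs := by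
  let φ : ℤ →+* 𝓞 K ⧸ I := (Ideal.Quotient.mk I).comp (Int.castRingHom (𝓞 K))
  have hsurj : Function.Surjective φ := by
    intro z
    obtain ⟨z, rfl⟩ := Ideal.Quotient.mk_surjective z
    obtain ⟨x, y, rfl⟩ := exists_xy e z
    refine ⟨x + y * h, ?_⟩
    show Ideal.Quotient.mk I _ = _
    rw [Ideal.Quotient.eq]
    have h1 : (Int.castRingHom (𝓞 K)) (x + y * h) - (x + y * ww e) = (ww e - h) * (-y) := by
      simp; ring
    rw [h1]; exact I.mul_mem_right _ hw
  have hker : RingHom.ker φ = Ideal.span {m} := by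
    ext j
    rw [RingHom.mem_ker, Ideal.mem_span_singleton, ← hm]
    exact Ideal.Quotient.eq_zero_iff_mem
  have h1 : Nat.card (ℤ ⧸ RingHom.ker φ) = Nat.card (𝓞 K ⧸ I) :=
    Nat.card_congr (RingHom.quotientKerEquivOfSurjective hsurj).toEquiv
  rw [Ideal.absNorm_apply, Submodule.cardQuot_apply, ← h1, hker]
  rw [Nat.card_congr (Int.quotientSpanEquivZMod m).toEquiv, Nat.card_zmod]

lemma chi_of_w (b E : ℤ) {h : ℤ} {I : Ideal (𝓞 K)} (hI : I ≠ ⊥) (hw : ww e - h ∈ I) :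
    chi (fQ e b E) I = cub (bet b E h) (Ideal.absNorm I : Om) := by
  induction I using UniqueFactorizationMonoid.induction_on_prime with
  | h₁ => exact absurd rfl hI
  | h₂ x hx =>
    have : x = 1 := by rwa [Ideal.isUnit_iff, ← Ideal.one_eq_top] at hx
    subst this
    rw [chi_one, map_one, Nat.cast_one, cub_unit _ isUnit_one]
  | h₃ J P hJ hP ih =>
    have hPp := Ideal.isPrime_of_prime hP
    have hP0 : P ≠ ⊥ := hP.ne_zero
    have hwP : ww e - h ∈ P := (Ideal.mul_le_left : P * J ≤ P) hw
    have hwJ : ww e - h ∈ J := (Ideal.mul_le_right : P * J ≤ J) hw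
    obtain ⟨p, hp, hpP⟩ := exists_prime_mem hPp hP0
    have hN : Ideal.absNorm P = p := by
      rw [absNorm_of_w e hwP (int_mem_iff hPp hp hpP), Int.natAbs_natCast]
    have hne : ∀ n : ℕ, n ≠ 0 → (n : Om) ≠ 0 := fun n hn => by
      have := cast_ne_zero (n := (n : ℤ)) (by exact_mod_cast hn); simpa using this
    rw [chi_mul _ hP0 hJ, chi_prime _ hPp hP0, ih hJ hwJ, fQ_eq e b E hPp hp hpP hwP, map_mul, hN,
      Nat.cast_mul, cub_mul_right _ (hne p hp.ne_zero)
      (hne _ (by rw [Ne, Ideal.absNorm_eq_zero_iff]; exact hJ))]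

lemma mem_map_cj {P : Ideal (𝓞 K)} {z : 𝓞 K} : z ∈ P.map (cj e) ↔ cj e z ∈ P := by
  rw [Ideal.mem_map_of_equiv]
  constructor
  · rintro ⟨x, hx, rfl⟩; rw [cj_cj]; exact hx
  · intro h; exact ⟨_, h, cj_cj e z⟩

lemma ne_zero_of_mul3 {P : Ideal (𝓞 K)} (hP : P.IsPrime) {p : ℕ} (hp : p.Prime)
    (hpP : (p : 𝓞 K) ∈ P) {a : ℤ} (hc : IsCoprime P (Ideal.span {((3 * a : ℤ) : 𝓞 K)})) :
    ¬ (3 : ℤ) ∣ p ∧ IsCoprime a (p : ℤ) := by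
  have hnot : ¬ (p : ℤ) ∣ 3 * a := by
    rw [← int_mem_iff hP hp hpP]
    intro hmem
    apply hP.ne_top
    have := Ideal.isCoprime_iff_add.1 hc
    rw [Ideal.add_eq_sup, sup_eq_left.2 ((Ideal.span_singleton_le_iff_mem _).2 hmem)] at this
    rw [this, Ideal.one_eq_top]
  have hpp := Nat.prime_iff_prime_int.1 hp
  constructor
  · intro h
    apply hnot
    have : p = 3 := ((Nat.prime_dvd_prime_iff_eq Nat.prime_three hp).1 (by exact_mod_cast h)).symm
    rw [this]; exact Dvd.intro _ rfl
  · exact ((hpp.coprime_iff_not_dvd).2 (fun h => hnot (h.mul_left _))).symm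

lemma fQ_cj {a b E : ℤ} (heq : b ^ 2 + 27 * E ^ 2 * k0 = a ^ 3) {P : Ideal (𝓞 K)} (hP : P.IsPrime)
    (hc : IsCoprime P (Ideal.span {((3 * a : ℤ) : 𝓞 K)})) :
    fQ e b E (P.map (cj e)) = - fQ e b E P := by
  have hP' : (P.map (cj e)).IsPrime := Ideal.map_isPrime_of_equiv (cj e)
  by_cases H : ∃ ph : ℕ × ℤ, ph.1.Prime ∧ (ph.1 : 𝓞 K) ∈ P ∧ ww e - ph.2 ∈ P
  · obtain ⟨⟨p, h⟩, hp, hpP, hw⟩ := H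
    simp only at hp hpP hw
    obtain ⟨h3, hap⟩ := ne_zero_of_mul3 hP hp hpP hc
    have hw' : ww e - (-h : ℤ) ∈ P.map (cj e) := by
      rw [mem_map_cj, map_sub, cj_ww, map_intCast]
      rw [show - ww e - ((-h : ℤ) : 𝓞 K) = -(ww e - h) by push_cast; ring]
      exact P.neg_mem hw
    have hpP' : (p : 𝓞 K) ∈ P.map (cj e) := by rw [mem_map_cj, map_natCast]; exact hpP
    rw [fQ_eq e b E hP hp hpP hw, fQ_eq e b E hP' hp hpP' hw']
    have hd := (int_mem_iff hP hp hpP _).1 (sq_sub_mem e hw)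
    have hb := bet_coprime heq hd hap
    have h1 := cub_conj (cast_ne_zero (ne_zero_of_not_three_dvd h3)) (three_coprime' h3) hb
    rw [map_intCast, Int.cast_natCast] at h1
    rw [← h1, cO_bet, bet]
    congr 1
    push_cast; ring
  · have H' : ¬ ∃ ph : ℕ × ℤ, ph.1.Prime ∧ (ph.1 : 𝓞 K) ∈ P.map (cj e) ∧
        ww e - ph.2 ∈ P.map (cj e) := by
      rintro ⟨⟨p, h⟩, hp, hpP, hw⟩
      apply H
      refine ⟨(p, -h), hp, ?_, ?_⟩
      · simpa [mem_map_cj] using hpP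
      · simp only at hw ⊢
        rw [mem_map_cj, map_sub, cj_ww, map_intCast] at hw
        rw [show ww e - ((-h : ℤ) : 𝓞 K) = -(-ww e - h) by push_cast; ring]
        exact P.neg_mem hw
    rw [fQ, dif_neg H', fQ, dif_neg H, neg_zero]

lemma chi_cj {a b E : ℤ} (heq : b ^ 2 + 27 * E ^ 2 * k0 = a ^ 3) {I : Ideal (𝓞 K)} (hI : I ≠ ⊥)
    (hc : IsCoprime I (Ideal.span {((3 * a : ℤ) : 𝓞 K)})) :
    chi (fQ e b E) (I.map (cj e)) = - chi (fQ e b E) I := by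
  rw [chi, nf_map (cj e) I hI, Multiset.map_map, chi, ← Multiset.sum_map_neg]
  congr 1
  apply Multiset.map_congr rfl
  intro P hP
  have hPp := Ideal.isPrime_of_prime (prime_of_normalized_factor P hP)
  exact fQ_cj e heq hPp (hc.of_isCoprime_of_dvd_left (dvd_of_mem_normalizedFactors hP))

lemma chi_int {a b E : ℤ} (heq : b ^ 2 + 27 * E ^ 2 * k0 = a ^ 3) {g : ℤ} (hg : (g : 𝓞 K) ≠ 0)
    (hc : IsCoprime (g : 𝓞 K) ((3 * a : ℤ) : 𝓞 K)) :
    chi (fQ e b E) (Ideal.span {(g : 𝓞 K)}) = 0 := by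
  have h1 := chi_cj e heq (I := Ideal.span {(g : 𝓞 K)}) (by simpa using hg)
    ((Ideal.isCoprime_span_singleton_iff _ _).2 hc)
  have h2 : (Ideal.span {(g : 𝓞 K)}).map (cj e) = Ideal.span {(g : 𝓞 K)} := by
    rw [Ideal.map_span, Set.image_singleton, map_intCast]
  rw [h2] at h1
  generalize chi (fQ e b E) (Ideal.span {(g : 𝓞 K)}) = s at *
  revert s; decide

end
end MRank

namespace MRank
section
open NumberField UniqueFactorizationMonoid nonZeroDivisors

variable {K : Type*} [Field K] [NumberField K] {k0 : ℤ} (e : ℤ√k0 ≃+* 𝓞 K)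

lemma int_dvd_xy {n x y : ℤ} (h : (n : 𝓞 K) ∣ x + y * ww e) : n ∣ x ∧ n ∣ y := by
  obtain ⟨z, hz⟩ := h
  obtain ⟨u, v, rfl⟩ := exists_xy e z
  have h1 : (((x - n * u : ℤ) : 𝓞 K) + ((y - n * v : ℤ) : 𝓞 K) * ww e) = 0 := by
    push_cast; linear_combination hz
  obtain ⟨h2, h3⟩ := xy_eq_zero e h1
  exact ⟨⟨u, by linarith⟩, ⟨v, by linarith⟩⟩


lemma int_coprime (e : ℤ√k0 ≃+* 𝓞 K) {m n : ℤ} (h : IsCoprime (m : 𝓞 K) (n : 𝓞 K)) : IsCoprime m n := by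
  obtain ⟨a, b, hab⟩ := h
  obtain ⟨u, v, rfl⟩ := exists_xy e a
  obtain ⟨u', v', rfl⟩ := exists_xy e b
  have h1 : (((u * m + u' * n - 1 : ℤ) : 𝓞 K) + ((v * m + v' * n : ℤ) : 𝓞 K) * ww e) = 0 := by
    push_cast; linear_combination hab
  have := (xy_eq_zero e h1).1
  exact ⟨u, u', by linarith⟩

variable {a b ee D : ℤ}

lemma chi_prim (he : ee ≠ 0) (hD : ¬ (3 : ℤ) ∣ D)
    (heq : b ^ 2 + 27 * (ee ^ 3 * D) ^ 2 * k0 = a ^ 3)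
    (h3b : ¬ (3 : ℤ) ∣ b) (hbE : IsCoprime b (ee ^ 3 * D)) {x y : ℤ} (hxy : IsCoprime x y)
    (h3y : ¬ (3 : ℤ) ∣ y) (hc : IsCoprime (x + y * ww e : 𝓞 K) ((3 * a : ℤ) : 𝓞 K)) :
    chi (fQ e b (ee ^ 3 * D)) (Ideal.span {(x + y * ww e : 𝓞 K)}) = 0 := by
  obtain ⟨n, hn⟩ : ∃ n : ℤ, n = x ^ 2 - k0 * y ^ 2 := ⟨_, rfl⟩
  set γ : 𝓞 K := x + y * ww e with hγ
  have hγn : γ * (x - y * ww e) = (n : 𝓞 K) := by rw [hn, hγ, mul_cj]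
  have hc' : IsCoprime (x - y * ww e : 𝓞 K) ((3 * a : ℤ) : 𝓞 K) := by
    have := hc.map (cj e : 𝓞 K →+* 𝓞 K)
    simp only [RingHom.coe_coe, map_intCast] at this
    rwa [hγ, cj_mk] at this
  have hnc : IsCoprime n (3 * a) := int_coprime e (by rw [← hγn]; exact hc.mul_left hc')
  have h3n : ¬ (3 : ℤ) ∣ n := fun h =>
    Int.prime_three.not_isUnit (hnc.of_mul_right_left.isUnit_of_dvd' h dvd_rfl)
  have hyn : IsCoprime y n := by
    rw [hn, show x ^ 2 - k0 * y ^ 2 = x ^ 2 + y * (-(k0 * y)) by ring]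
    exact (hxy.symm.pow_right).add_mul_left_right _
  obtain ⟨u, v, huv⟩ := hyn
  have hγ0 : γ ≠ 0 := by
    intro h
    have := (xy_eq_zero e h).2
    exact ne_zero_of_not_three_dvd h3y this
  have hw : ww e - ((-(x * u) : ℤ) : 𝓞 K) ∈ Ideal.span {γ} := by
    rw [Ideal.mem_span_singleton]
    refine ⟨u + v * ww e * (x - y * ww e), ?_⟩
    have h1 : (u : 𝓞 K) * y + v * n = 1 := by
      have := congrArg (fun z : ℤ => (z : 𝓞 K)) huv
      push_cast at this; exact this
    push_cast
    rw [mul_add, hγ] at *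
    linear_combination (-(ww e)) * h1 - v * ww e * hγn
  have hm : ∀ j : ℤ, (j : 𝓞 K) ∈ Ideal.span {γ} ↔ n ∣ j := by
    intro j
    rw [Ideal.mem_span_singleton]
    constructor
    · rintro ⟨z, hz⟩
      have h1 : (n : 𝓞 K) ∣ ((j * x : ℤ) : 𝓞 K) + ((-(j * y) : ℤ) : 𝓞 K) * ww e := by
        refine ⟨z, ?_⟩
        push_cast
        rw [← hγn]
        linear_combination (x - y * ww e) * hz
      obtain ⟨h2, h3⟩ := int_dvd_xy e h1
      obtain ⟨s, t, hst⟩ := hxy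
      have : j = s * (j * x) - t * (-(j * y)) := by linear_combination -j * hst
      rw [this]
      exact dvd_sub (h2.mul_left _) (h3.mul_left _)
    · rintro ⟨c, rfl⟩
      push_cast
      rw [← hγn]
      exact ⟨(x - y * ww e) * c, by ring⟩
  rw [chi_of_w e b _ (by simpa using hγ0) hw, absNorm_of_w e hw hm]
  have has : Associated ((n.natAbs : ℕ) : Om) (n : Om) := by
    have h1 := (Int.associated_natAbs n).symm
    have := h1.map (Int.castRingHom Om)
    simpa using this
  rw [cub_assoc _ has]
  refine cub_vanish he hD heq h3b hbE hxy h3y hn h3n hnc.of_mul_right_right.symm ?_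
  exact ⟨x * v, by linear_combination -x * huv⟩

lemma chi_three (he : ee ≠ 0) (hD : ¬ (3 : ℤ) ∣ D)
    (heq : b ^ 2 + 27 * (ee ^ 3 * D) ^ 2 * k0 = a ^ 3)
    (h3b : ¬ (3 : ℤ) ∣ b) (hbE : IsCoprime b (ee ^ 3 * D)) {x y : ℤ}
    (h3y : ¬ (3 : ℤ) ∣ y) (hc : IsCoprime (x + y * ww e : 𝓞 K) ((3 * a : ℤ) : 𝓞 K)) :
    chi (fQ e b (ee ^ 3 * D)) (Ideal.span {(x + y * ww e : 𝓞 K)}) = 0 := by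
  have hy0 := ne_zero_of_not_three_dvd h3y
  obtain ⟨g, x', y', hg0, hx, hy, hco⟩ : ∃ g x' y' : ℤ, g ≠ 0 ∧ x = g * x' ∧ y = g * y' ∧
      IsCoprime x' y' := by
    have hpos : 0 < Int.gcd x y := Int.gcd_pos_of_ne_zero_right _ hy0
    obtain ⟨x', y', h1, h2, h3⟩ := Int.exists_gcd_one hpos
    refine ⟨Int.gcd x y, x', y', by exact_mod_cast hpos.ne', ?_, ?_, Int.isCoprime_iff_gcd_eq_one.2 h1⟩
    · rw [mul_comm]; exact h2
    · rw [mul_comm]; exact h3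
  have hγ : (x + y * ww e : 𝓞 K) = g * (x' + y' * ww e) := by rw [hx, hy]; push_cast; ring
  have hgK : (g : 𝓞 K) ≠ 0 := by exact_mod_cast hg0
  have h3y' : ¬ (3 : ℤ) ∣ y' := fun h => h3y (by rw [hy]; exact h.mul_left _)
  have hγ0 : (x' + y' * ww e : 𝓞 K) ≠ 0 := fun h =>
    ne_zero_of_not_three_dvd h3y' (xy_eq_zero e h).2
  rw [hγ] at hc ⊢
  rw [← Ideal.span_singleton_mul_span_singleton, chi_mul _ (by simpa using hgK) (by simpa using hγ0),
    chi_int e heq hgK hc.of_mul_left_left, chi_prim e he hD heq h3b hbE hco h3y' hc.of_mul_left_right,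
    add_zero]

theorem chi_gamma (hk3 : k0 % 3 = 2) (he : ee ≠ 0) (hD : ¬ (3 : ℤ) ∣ D)
    (heq : b ^ 2 + 27 * (ee ^ 3 * D) ^ 2 * k0 = a ^ 3)
    (h3b : ¬ (3 : ℤ) ∣ b) (h3a : ¬ (3 : ℤ) ∣ a) (hbE : IsCoprime b (ee ^ 3 * D)) {γ : 𝓞 K}
    (hγ0 : γ ≠ 0) (hc : IsCoprime γ ((3 * a : ℤ) : 𝓞 K)) :
    chi (fQ e b (ee ^ 3 * D)) (Ideal.span {γ}) = 0 := by
  obtain ⟨x, y, rfl⟩ := exists_xy e γ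
  by_cases h3y : (3 : ℤ) ∣ y
  · have h3x : ¬ (3 : ℤ) ∣ x := by
      intro h3x
      have h1 : ((3 : ℤ) : 𝓞 K) ∣ x + y * ww e := by
        obtain ⟨u, rfl⟩ := h3x
        obtain ⟨v, rfl⟩ := h3y
        exact ⟨u + v * ww e, by push_cast; ring⟩
      have h2 : IsCoprime ((3 : ℤ) : 𝓞 K) ((3 : ℤ) : 𝓞 K) := by
        rw [Int.cast_mul] at hc
        exact (hc.of_mul_right_left).of_isCoprime_of_dvd_left h1
      have := int_coprime e h2
      rw [isCoprime_self] at this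
      exact Int.prime_three.not_isUnit this
    have hc2 : IsCoprime (((1 : ℤ) : 𝓞 K) + (a : ℤ) * ww e) ((3 * a : ℤ) : 𝓞 K) := by
      have h1 : IsCoprime (1 ^ 2 - k0 * a ^ 2) (3 * a) := by
        apply IsCoprime.mul_right
        · apply IsCoprime.symm
          apply three_coprime
          have h2 : a % 3 = 1 ∨ a % 3 = 2 := by omega
          intro h
          have h4 : (1 ^ 2 - k0 * a ^ 2) % 3 = 0 := Int.emod_eq_zero_of_dvd h
          rcases h2 with h2 | h2 <;> simp [Int.sub_emod, Int.mul_emod, pow_two, h2, hk3] at h4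
        · exact ⟨1, k0 * a, by ring⟩
      have h2 := h1.map (Int.castRingHom (𝓞 K))
      simp only [eq_intCast] at h2
      rw [← mul_cj e] at h2
      exact h2.of_mul_left_left
    have h20 : (((1 : ℤ) : 𝓞 K) + (a : ℤ) * ww e) ≠ 0 := fun h => by
      have := (xy_eq_zero e h).1; omega
    have hprod : (x + y * ww e : 𝓞 K) * (((1 : ℤ) : 𝓞 K) + (a : ℤ) * ww e)
        = ((x + k0 * y * a : ℤ) : 𝓞 K) + ((a * x + y : ℤ) : 𝓞 K) * ww e := by
      push_cast
      linear_combination (y * a : 𝓞 K) * ww_sq e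
    have h3 : ¬ (3 : ℤ) ∣ a * x + y := by
      intro h
      rw [Int.dvd_add_left h3y] at h
      rcases Int.prime_three.dvd_or_dvd h with h | h
      · exact h3a h
      · exact h3x h
    have h4 := chi_three e he hD heq h3b hbE h3 (x := x + k0 * y * a) (by
      rw [← hprod]; exact hc.mul_left hc2)
    rw [← hprod, ← Ideal.span_singleton_mul_span_singleton, chi_mul _ (by simpa using hγ0)
      (by simpa using h20), chi_three e he hD heq h3b hbE h3a hc2, add_zero] at h4
    exact h4
  · exact chi_three e he hD heq h3b hbE h3y hc

/-- the class group character attached to `(a, b, e)` -/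
theorem exists_char_abe (hk3 : k0 % 3 = 2) (he : ee ≠ 0) (hD : ¬ (3 : ℤ) ∣ D)
    (heq : b ^ 2 + 27 * (ee ^ 3 * D) ^ 2 * k0 = a ^ 3)
    (h3b : ¬ (3 : ℤ) ∣ b) (h3a : ¬ (3 : ℤ) ∣ a) (hbE : IsCoprime b (ee ^ 3 * D)) :
    ∃ χ : ClassGroup (𝓞 K) →* Multiplicative (ZMod 3), ∀ P : (Ideal (𝓞 K))⁰,
      (P : Ideal (𝓞 K)).IsPrime → ∀ p : ℕ, p.Prime → ¬ (p : ℤ) ∣ 3 * a →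
      (p : 𝓞 K) ∈ (P : Ideal (𝓞 K)) → ∀ h : ℤ, ww e - h ∈ (P : Ideal (𝓞 K)) →
      χ (ClassGroup.mk0 P) = Multiplicative.ofAdd (cub (bet b (ee ^ 3 * D) h) (p : Om)) := by
  have hM : ((3 * a : ℤ) : 𝓞 K) ≠ 0 := by
    have : 3 * a ≠ 0 := mul_ne_zero (by norm_num) (ne_zero_of_not_three_dvd h3a)
    exact_mod_cast this
  obtain ⟨χ, hχ⟩ := exists_char (fQ e b (ee ^ 3 * D)) hM
    (fun γ h1 h2 => chi_gamma e hk3 he hD heq h3b h3a hbE h1 h2)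
  refine ⟨χ, fun P hP p hp hpa hpP h hw => ?_⟩
  have hP0 : (P : Ideal (𝓞 K)) ≠ ⊥ := nonZeroDivisors.coe_ne_zero P
  have hmem : ((3 * a : ℤ) : 𝓞 K) ∉ (P : Ideal (𝓞 K)) := by
    rwa [int_mem_iff hP hp hpP]
  rw [hχ P, chi_prime _ hP hP0, fQ_eq e b _ hP hp hpP hw]
  have hmax := hP.isMaximal hP0
  rw [Ideal.isCoprime_iff_sup_eq]
  apply hmax.1.2
  rw [left_lt_sup, Ideal.span_singleton_le_iff_mem]
  exact hmem

end
end MRank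

namespace MRank
section

lemma cub_triple {n k0 D h L N m b1 b2 b3 c1 c2 c3 : ℤ} (h3 : ¬ (3 : ℤ) ∣ n) (hn : n ∣ h ^ 2 - k0)
    (hN : IsCoprime N n)
    (g1 : IsCoprime (bet b1 (c1 ^ 3 * D) h) (n : Om)) (g2 : IsCoprime (bet b2 (c2 ^ 3 * D) h) (n : Om))
    (g3 : IsCoprime (bet b3 (c3 ^ 3 * D) h) (n : Om))
    (e2 : N ^ 3 * (b1 * c2 ^ 3 * c3 ^ 3 + b2 * c1 ^ 3 * c3 ^ 3 + b3 * c1 ^ 3 * c2 ^ 3)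
      = (c1 * c2 * c3) ^ 3 * (3 * m * N ^ 2 + L ^ 3))
    (e1 : N ^ 3 * (b1 * b2 * c3 ^ 3 + b1 * b3 * c2 ^ 3 + b2 * b3 * c1 ^ 3)
      = (c1 * c2 * c3) ^ 3 * (3 * m ^ 2 * N))
    (e0 : N ^ 3 * (b1 * b2 * b3) = (c1 * c2 * c3) ^ 3 * (m ^ 3 + L ^ 3 * (27 * k0 * D ^ 2))) :
    cub (bet b1 (c1 ^ 3 * D) h) (n : Om) + cub (bet b2 (c2 ^ 3 * D) h) (n : Om)
      + cub (bet b3 (c3 ^ 3 * D) h) (n : Om) = 0 := by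
  have hn0 : (n : Om) ≠ 0 := cast_ne_zero (ne_zero_of_not_three_dvd h3)
  have hn3 : IsCoprime (3 : Om) n := three_coprime' h3
  have hNO : IsCoprime (N : Om) n := isCoprime_cast hN
  set s : Om := 3 * (2 * om + 1) * ((D * h : ℤ) : Om) with hs
  have hs2 : s ^ 2 = -27 * (D : Om) ^ 2 * (h : Om) ^ 2 := by
    rw [hs]; push_cast; linear_combination 9 * (D : Om) ^ 2 * (h : Om) ^ 2 * sqrt3_sq
  have hb : ∀ b c : ℤ, bet b (c ^ 3 * D) h = b + (c : Om) ^ 3 * s := by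
    intro b c; rw [bet, hs]; push_cast; ring
  have e2' := congrArg (fun z : ℤ => (z : Om)) e2
  have e1' := congrArg (fun z : ℤ => (z : Om)) e1
  have e0' := congrArg (fun z : ℤ => (z : Om)) e0
  push_cast at e2' e1' e0'
  obtain ⟨d, hd⟩ := hn
  have hd' := congrArg (fun z : ℤ => (z : Om)) hd
  push_cast at hd'
  have hdv : (n : Om) ∣ (N : Om) ^ 3 * (bet b1 (c1 ^ 3 * D) h * bet b2 (c2 ^ 3 * D) h
      * bet b3 (c3 ^ 3 * D) h) - ((c1 * c2 * c3 : Om) * (m + N * s)) ^ 3 := by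
    refine ⟨-(c1 * c2 * c3 : Om) ^ 3 * (L : Om) ^ 3 * 27 * (D : Om) ^ 2 * d, ?_⟩
    rw [hb, hb, hb]
    linear_combination s ^ 2 * e2' + s * e1' + e0' + (c1 * c2 * c3 : Om) ^ 3 * (L : Om) ^ 3 * hs2
      - (c1 * c2 * c3 : Om) ^ 3 * (L : Om) ^ 3 * 27 * (D : Om) ^ 2 * hd'
  have hl : IsCoprime ((N : Om) ^ 3 * (bet b1 (c1 ^ 3 * D) h * bet b2 (c2 ^ 3 * D) h
      * bet b3 (c3 ^ 3 * D) h)) (n : Om) := hNO.pow_left.mul_left ((g1.mul_left g2).mul_left g3)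
  have hr : IsCoprime (((c1 * c2 * c3 : Om) * (m + N * s)) ^ 3) (n : Om) := by
    apply coprime_of_dvd_sub _ hl
    rw [← dvd_neg, neg_sub]; exact hdv
  have hf := cub_congr hn0 hdv
  rw [cub_cube hn0 hn3 ((IsCoprime.pow_left_iff three_pos).1 hr),
    cub_mul hn0 hn3 hNO.pow_left ((g1.mul_left g2).mul_left g3), cub_cube hn0 hn3 hNO,
    cub_mul hn0 hn3 (g1.mul_left g2) g3, cub_mul hn0 hn3 g1 g2, zero_add] at hf
  exact hf

lemma bet_neg (b E h : ℤ) : bet (-b) E h = -cO (bet b E h) := by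
  rw [cO_bet, bet]; push_cast; ring

lemma cub_bet_neg {n b E h : ℤ} (h3 : ¬ (3 : ℤ) ∣ n)
    (g : IsCoprime (bet b E h) (n : Om)) :
    cub (bet (-b) E h) (n : Om) = - cub (bet b E h) (n : Om) ∧
      IsCoprime (bet (-b) E h) (n : Om) := by
  have hn0 : (n : Om) ≠ 0 := cast_ne_zero (ne_zero_of_not_three_dvd h3)
  have hn3 : IsCoprime (3 : Om) n := three_coprime' h3
  have g' : IsCoprime (cO (bet b E h)) (n : Om) := by
    have := g.map (cO : Om →+* Om)
    simpa using this
  have h1 := cub_conj hn0 hn3 g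
  rw [map_intCast] at h1
  rw [bet_neg, cub_neg hn0 hn3 g', h1]
  exact ⟨rfl, g'.neg_left⟩

lemma cub_bet_scale {n D b1 b2 c1 c2 h : ℤ} (h3 : ¬ (3 : ℤ) ∣ n)
    (g1 : IsCoprime (bet b1 (c1 ^ 3 * D) h) (n : Om)) (g2 : IsCoprime (bet b2 (c2 ^ 3 * D) h) (n : Om))
    (hc1 : IsCoprime c1 n) (hc2 : IsCoprime c2 n) (hb : b1 * c2 ^ 3 = b2 * c1 ^ 3) :
    cub (bet b1 (c1 ^ 3 * D) h) (n : Om) = cub (bet b2 (c2 ^ 3 * D) h) (n : Om) := by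
  have hn0 : (n : Om) ≠ 0 := cast_ne_zero (ne_zero_of_not_three_dvd h3)
  have hn3 : IsCoprime (3 : Om) n := three_coprime' h3
  have hb' := congrArg (fun z : ℤ => (z : Om)) hb
  push_cast at hb'
  have h1 : (c2 : Om) ^ 3 * bet b1 (c1 ^ 3 * D) h = (c1 : Om) ^ 3 * bet b2 (c2 ^ 3 * D) h := by
    rw [bet, bet]; push_cast; linear_combination hb'
  have h2 := congrArg (fun z => cub z (n : Om)) h1
  have k1 : IsCoprime (c1 : Om) n := isCoprime_cast hc1
  have k2 : IsCoprime (c2 : Om) n := isCoprime_cast hc2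
  rw [cub_mul hn0 hn3 k2.pow_left g1, cub_mul hn0 hn3 k1.pow_left g2, cub_cube hn0 hn3 k1,
    cub_cube hn0 hn3 k2, zero_add, zero_add] at h2
  exact h2

variable {l : ℤ}

lemma exists_abc {Q : Pt l} (h : Q ≠ 0) : ∃ t : ℤ × ℤ × ℤ, 0 < t.2.2 ∧
    IsPt Q ((t.1 : ℚ) / (t.2.2 : ℚ) ^ 2) ((t.2.1 : ℚ) / (t.2.2 : ℚ) ^ 3) ∧
    IsCoprime t.1 t.2.2 ∧ IsCoprime t.2.1 t.2.2 ∧ t.2.1 ^ 2 = t.1 ^ 3 + l * t.2.2 ^ 6 := by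
  obtain ⟨x, y, hxy⟩ := exists_coords h
  obtain ⟨a, b, c, h1, h2, h3, h4, h5, h6⟩ := int_coords hxy.eq
  exact ⟨(a, b, c), h1, by simpa only [← h2, ← h3] using hxy, h4, h5, h6⟩

/-- integer coordinates -/
noncomputable def abc (Q : Pt l) (h : Q ≠ 0) : ℤ × ℤ × ℤ := (exists_abc h).choose

open Classical in
/-- the local symbol of a point -/
noncomputable def symF (D : ℤ) (Q : Pt l) (p : ℕ) (h : ℤ) : ZMod 3 :=
  if H : Q ≠ 0 then cub (bet (abc Q H).2.1 ((abc Q H).2.2 ^ 3 * D) h) (p : Om) else 0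

lemma symF_spec (D : ℤ) {Q : Pt l} (H : Q ≠ 0) : ∃ a b c : ℤ, 0 < c ∧
    IsPt Q ((a : ℚ) / (c : ℚ) ^ 2) ((b : ℚ) / (c : ℚ) ^ 3) ∧
    IsCoprime a c ∧ IsCoprime b c ∧ b ^ 2 = a ^ 3 + l * c ^ 6 ∧
    ∀ p h, symF D Q p h = cub (bet b (c ^ 3 * D) h) (p : Om) := by
  obtain ⟨h1, h2, h3, h4, h5⟩ := (exists_abc H).choose_spec
  refine ⟨_, _, _, h1, h2, h3, h4, h5, fun p h => ?_⟩
  rw [symF, dif_pos H]; rfl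

lemma symF_zero (D : ℤ) (p : ℕ) (h : ℤ) : symF D (0 : Pt l) p h = 0 := by
  rw [symF, dif_neg (by simp)]

lemma common_den (x y : ℚ) : ∃ N L m : ℤ, N ≠ 0 ∧ x * N = L ∧ y * N = m := by
  refine ⟨x.den * y.den, x.num * y.den, y.num * x.den, ?_, ?_, ?_⟩
  · have := x.den_nz; have := y.den_nz; positivity
  · have := Rat.mul_den_eq_num x; push_cast; linear_combination (y.den : ℚ) * this
  · have := Rat.mul_den_eq_num y; push_cast; linear_combination (x.den : ℚ) * this

lemma cop_of_not_dvd {p : ℕ} (hp : p.Prime) {m M : ℤ} (hm : m ∣ M) (h : ¬ (p : ℤ) ∣ M) :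
    IsCoprime m (p : ℤ) :=
  (((Nat.prime_iff_prime_int.1 hp).coprime_iff_not_dvd).2 (fun h' => h (h'.trans hm))).symm

theorem symF_add {k0 D : ℤ} (hl : l = -27 * (k0 * D ^ 2)) (hns : ¬ IsSquare (l : ℚ)) (P Q : Pt l) :
    ∃ M : ℤ, M ≠ 0 ∧ ∀ p : ℕ, p.Prime → ¬ (p : ℤ) ∣ M → ∀ h : ℤ, (p : ℤ) ∣ h ^ 2 - k0 →
      symF D (P + Q) p h = symF D P p h + symF D Q p h := by
  by_cases hP : P = 0
  · refine ⟨1, one_ne_zero, fun p _ _ h _ => ?_⟩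
    rw [hP, symF_zero, zero_add, zero_add]
  by_cases hQ : Q = 0
  · refine ⟨1, one_ne_zero, fun p _ _ h _ => ?_⟩
    rw [hQ, symF_zero, add_zero, add_zero]
  obtain ⟨a1, b1, c1, p1, q1, -, -, r1, s1⟩ := symF_spec D hP
  obtain ⟨a2, b2, c2, p2, q2, -, -, r2, s2⟩ := symF_spec D hQ
  have heqs : ∀ a b c : ℤ, b ^ 2 = a ^ 3 + l * c ^ 6 →
      b ^ 2 + 27 * (c ^ 3 * D) ^ 2 * k0 = a ^ 3 := by
    intro a b c h; rw [h, hl]; ring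
  have hane : ∀ {R : Pt l} {a b c : ℤ}, 0 < c →
      IsPt R ((a : ℚ) / (c : ℚ) ^ 2) ((b : ℚ) / (c : ℚ) ^ 3) → a ≠ 0 := by
    intro R a b c hc h h0
    apply x_ne_zero hns h
    rw [h0]; simp
  have a10 := hane p1 q1
  have a20 := hane p2 q2
  have c1q : (c1 : ℚ) ≠ 0 := by exact_mod_cast p1.ne'
  have c2q : (c2 : ℚ) ≠ 0 := by exact_mod_cast p2.ne'
  have three : ∀ p : ℕ, p.Prime → ∀ M : ℤ, ¬ (p : ℤ) ∣ 3 * M → ¬ (3 : ℤ) ∣ p := by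
    intro p hp M h h'
    apply h
    have : p = 3 := ((Nat.prime_dvd_prime_iff_eq Nat.prime_three hp).1 (by exact_mod_cast h')).symm
    rw [this]; exact Dvd.intro _ rfl
  by_cases hR : P + Q = 0
  · refine ⟨3 * (a1 * a2 * c1 * c2), by have := p1.ne'; have := p2.ne'; positivity,
      fun p hp hM h hh => ?_⟩
    have h3 := three p hp _ hM
    have u1 : IsCoprime a1 (p : ℤ) := cop_of_not_dvd hp ⟨3 * (a2 * c1 * c2), by ring⟩ hM
    have u2 : IsCoprime a2 (p : ℤ) := cop_of_not_dvd hp ⟨3 * (a1 * c1 * c2), by ring⟩ hM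
    have v1 : IsCoprime c1 (p : ℤ) := cop_of_not_dvd hp ⟨3 * (a1 * a2 * c2), by ring⟩ hM
    have v2 : IsCoprime c2 (p : ℤ) := cop_of_not_dvd hp ⟨3 * (a1 * a2 * c1), by ring⟩ hM
    have g1 := bet_coprime (heqs _ _ _ r1) hh u1
    have g2 := bet_coprime (heqs _ _ _ r2) hh u2
    obtain ⟨k1, k2⟩ := cub_bet_neg h3 g2
    have hy := ((add_eq_zero_iff' q1 q2).1 hR).2
    have hbb : b1 * c2 ^ 3 = (-b2) * c1 ^ 3 := by
      field_simp at hy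
      have : (b1 : ℚ) * c2 ^ 3 = (-b2) * c1 ^ 3 := by linear_combination hy
      exact_mod_cast this
    have k3 := cub_bet_scale h3 g1 k2 v1 v2 hbb
    rw [k1] at k3
    rw [hR, symF_zero, s1, s2]
    rw [Int.cast_natCast] at k3
    rw [k3, neg_add_cancel]
  · obtain ⟨a3, b3, c3, p3, q3, -, -, r3, s3⟩ := symF_spec D hR
    have a30 := hane p3 q3
    have c3q : (c3 : ℚ) ≠ 0 := by exact_mod_cast p3.ne'
    obtain ⟨lam, mu, w1, w2, w3, w4, w5, w6⟩ := vieta q1 q2 q3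
    obtain ⟨N, L, m, hN, hL, hm⟩ := common_den lam mu
    refine ⟨3 * (a1 * a2 * a3 * N), by positivity, fun p hp hM h hh => ?_⟩
    have h3 := three p hp _ hM
    have u1 : IsCoprime a1 (p : ℤ) := cop_of_not_dvd hp ⟨3 * (a2 * a3 * N), by ring⟩ hM
    have u2 : IsCoprime a2 (p : ℤ) := cop_of_not_dvd hp ⟨3 * (a1 * a3 * N), by ring⟩ hM
    have u3 : IsCoprime a3 (p : ℤ) := cop_of_not_dvd hp ⟨3 * (a1 * a2 * N), by ring⟩ hM
    have u4 : IsCoprime N (p : ℤ) := cop_of_not_dvd hp ⟨3 * (a1 * a2 * a3), by ring⟩ hM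
    have g1 := bet_coprime (heqs _ _ _ r1) hh u1
    have g2 := bet_coprime (heqs _ _ _ r2) hh u2
    have g3 := bet_coprime (heqs _ _ _ r3) hh u3
    obtain ⟨k1, k2⟩ := cub_bet_neg h3 g3
    set y1 : ℚ := (b1 : ℚ) / (c1 : ℚ) ^ 3 with hy1
    set y2 : ℚ := (b2 : ℚ) / (c2 : ℚ) ^ 3 with hy2
    set y3 : ℚ := (b3 : ℚ) / (c3 : ℚ) ^ 3 with hy3
    set x1 : ℚ := (a1 : ℚ) / (c1 : ℚ) ^ 2 with hx1
    set x2 : ℚ := (a2 : ℚ) / (c2 : ℚ) ^ 2 with hx2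
    set x3 : ℚ := (a3 : ℚ) / (c3 : ℚ) ^ 2 with hx3
    have f2 : y1 + y2 + -y3 = 3 * mu + lam ^ 3 := by
      rw [w1, w2, w3]; linear_combination lam * w4
    have f1 : y1 * y2 + y1 * -y3 + y2 * -y3 = 3 * mu ^ 2 := by
      rw [w1, w2, w3]; linear_combination lam ^ 2 * w5 + 2 * lam * mu * w4
    have f0 : y1 * y2 * -y3 = mu ^ 3 - lam ^ 3 * l := by
      rw [w1, w2, w3]; linear_combination lam ^ 3 * w6 + lam ^ 2 * mu * w5 + lam * mu ^ 2 * w4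
    have z1 : (b1 : ℚ) = y1 * c1 ^ 3 := by rw [hy1]; field_simp
    have z2 : (b2 : ℚ) = y2 * c2 ^ 3 := by rw [hy2]; field_simp
    have z3 : (b3 : ℚ) = y3 * c3 ^ 3 := by rw [hy3]; field_simp
    have hlq : (l : ℚ) = -27 * (k0 * D ^ 2) := by rw [hl]; push_cast; ring
    rw [hlq] at f0
    have k4 := cub_triple (k0 := k0) (D := D) (L := L) (N := N) (m := m) h3 hh u4 g1 g2 k2
      (by
        have : (N : ℚ) ^ 3 * (b1 * c2 ^ 3 * c3 ^ 3 + b2 * c1 ^ 3 * c3 ^ 3 + (-b3) * c1 ^ 3 * c2 ^ 3)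
          = (c1 * c2 * c3) ^ 3 * (3 * m * N ^ 2 + L ^ 3) := by
          rw [z1, z2, z3, ← hL, ← hm]
          linear_combination (N : ℚ) ^ 3 * (c1 * c2 * c3) ^ 3 * f2
        exact_mod_cast this)
      (by
        have : (N : ℚ) ^ 3 * (b1 * b2 * c3 ^ 3 + b1 * (-b3) * c2 ^ 3 + b2 * (-b3) * c1 ^ 3)
          = (c1 * c2 * c3) ^ 3 * (3 * m ^ 2 * N) := by
          rw [z1, z2, z3, ← hm]
          linear_combination (N : ℚ) ^ 3 * (c1 * c2 * c3) ^ 3 * f1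
        exact_mod_cast this)
      (by
        have : (N : ℚ) ^ 3 * (b1 * b2 * (-b3))
          = (c1 * c2 * c3) ^ 3 * (m ^ 3 + L ^ 3 * (27 * k0 * D ^ 2)) := by
          rw [z1, z2, z3, ← hm, ← hL]
          linear_combination (N : ℚ) ^ 3 * (c1 * c2 * c3) ^ 3 * f0
        exact_mod_cast this)
    rw [k1] at k4
    rw [s1, s2, s3]
    rw [Int.cast_natCast] at k4
    linear_combination -k4

end
end MRank

namespace MRank
section
open NumberField UniqueFactorizationMonoid nonZeroDivisors

lemma dvd_of_sq {q a c : ℤ} (hq : Prime q) (h : a ^ 2 = q * c) : q ∣ a :=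
  hq.dvd_of_dvd_pow (n := 2) ⟨c, h⟩

lemma mod9_aux : ∀ a b K : ZMod 9, (K = 1 ∨ K = 7) → 3 * b ^ 2 = a ^ 3 + K → 3 * b = 0 := by
  decide

lemma mod9_six : ∀ c : ZMod 9, 3 * c ≠ 0 → c ^ 6 = 1 := by decide

lemma mod9_cube : ∀ c : ZMod 9, 3 * c = 3 → c ^ 3 = 1 := by decide

lemma dvd3_iff (b : ℤ) : (3 : ℤ) ∣ b ↔ 3 * (b : ZMod 9) = 0 := by
  have : 3 * (b : ZMod 9) = ((3 * b : ℤ) : ZMod 9) := by push_cast; ring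
  rw [this, ZMod.intCast_zmod_eq_zero_iff_dvd]
  push_cast
  omega

lemma not_dvd_pow {q a : ℤ} (hq : Prime q) (h : ¬ q ∣ a) (n : ℕ) : ¬ q ∣ a ^ n :=
  fun h' => h (hq.dvd_of_dvd_pow h')

lemma dbl_three {B a b c X c2 : ℤ} (hB : B % 9 = 1 ∨ B % 9 = 7) (h : b ^ 2 = a ^ 3 + 27 * B * c ^ 6)
    (hbc : IsCoprime b c) (hX : X * (4 * b ^ 2 * c ^ 2) = c2 ^ 2 * (a * (a ^ 3 - 216 * B * c ^ 6)))
    (hXc : IsCoprime X c2) : ¬ (3 : ℤ) ∣ X := by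
  intro h3X
  have p3 := Int.prime_three
  have h3c2 : ¬ (3 : ℤ) ∣ c2 := fun h => p3.not_isUnit (hXc.isUnit_of_dvd' h3X h)
  have h3B : ¬ (3 : ℤ) ∣ B := by omega
  by_cases hb : (3 : ℤ) ∣ b
  · have h3c : ¬ (3 : ℤ) ∣ c := fun h => p3.not_isUnit (hbc.isUnit_of_dvd' hb h)
    have h3a : (3 : ℤ) ∣ a := by
      apply p3.dvd_of_dvd_pow (n := 3)
      have : a ^ 3 = b ^ 2 - 3 * (9 * B * c ^ 6) := by linear_combination -h
      rw [this]
      exact dvd_sub (dvd_pow hb two_ne_zero) (Dvd.intro _ rfl)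
    obtain ⟨a', rfl⟩ := h3a
    obtain ⟨b1, rfl⟩ := hb
    have e1 : b1 ^ 2 = 3 * (a' ^ 3 + B * c ^ 6) := by linarith
    obtain ⟨b2, rfl⟩ := dvd_of_sq p3 e1
    have e2 : 3 * b2 ^ 2 = a' ^ 3 + B * c ^ 6 := by linarith
    have hb2 : (3 : ℤ) ∣ b2 := by
      rw [dvd3_iff]
      have hc6 := mod9_six (c : ZMod 9) (fun h => h3c ((dvd3_iff c).2 h))
      have e3 := congrArg (fun z : ℤ => (z : ZMod 9)) e2
      push_cast at e3
      rw [hc6, mul_one] at e3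
      refine mod9_aux _ _ _ ?_ e3
      rcases hB with hB | hB
      · left
        have : ((B : ℤ) : ZMod 9) = ((1 : ℤ) : ZMod 9) := by
          rw [ZMod.intCast_eq_intCast_iff]; exact hB
        simpa using this
      · right
        have : ((B : ℤ) : ZMod 9) = ((7 : ℤ) : ZMod 9) := by
          rw [ZMod.intCast_eq_intCast_iff]; exact hB
        simpa using this
    obtain ⟨b3, rfl⟩ := hb2
    have e3 : X * (4 * b3 ^ 2 * c ^ 2) = c2 ^ 2 * (a' * (3 * b3 ^ 2 - B * c ^ 6)) := by
      have : 729 * (X * (4 * b3 ^ 2 * c ^ 2)) = 729 * (c2 ^ 2 * (a' * (3 * b3 ^ 2 - B * c ^ 6))) := by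
        linear_combination hX - 81 * c2 ^ 2 * a' * e2
      linarith
    have h4 : (3 : ℤ) ∣ c2 ^ 2 * (a' * (3 * b3 ^ 2 - B * c ^ 6)) := by
      rw [← e3]; exact h3X.mul_right _
    have h3Bc : ¬ (3 : ℤ) ∣ B * c ^ 6 := fun h =>
      (p3.dvd_or_dvd h).elim h3B (not_dvd_pow p3 h3c 6)
    rcases p3.dvd_or_dvd h4 with h5 | h5
    · exact not_dvd_pow p3 h3c2 2 h5
    rcases p3.dvd_or_dvd h5 with h6 | h6
    · apply h3Bc
      have : B * c ^ 6 = 3 * (9 * b3 ^ 2) - a' ^ 3 := by linear_combination -e2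
      rw [this]
      exact dvd_sub (Dvd.intro _ rfl) (dvd_pow h6 three_ne_zero)
    · apply h3Bc
      have : B * c ^ 6 = 3 * (b3 ^ 2) - (3 * b3 ^ 2 - B * c ^ 6) := by ring
      rw [this]
      exact dvd_sub (Dvd.intro _ rfl) h6
  · have h3a : ¬ (3 : ℤ) ∣ a := by
      intro h3a
      apply hb
      apply p3.dvd_of_dvd_pow (n := 2)
      rw [h]
      exact dvd_add (dvd_pow h3a three_ne_zero) ⟨9 * B * c ^ 6, by ring⟩
    have h4 : (3 : ℤ) ∣ c2 ^ 2 * (a * (a ^ 3 - 216 * B * c ^ 6)) := by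
      rw [← hX]; exact h3X.mul_right _
    rcases p3.dvd_or_dvd h4 with h5 | h5
    · exact not_dvd_pow p3 h3c2 2 h5
    rcases p3.dvd_or_dvd h5 with h6 | h6
    · exact h3a h6
    · apply not_dvd_pow p3 h3a 3
      have : a ^ 3 = (a ^ 3 - 216 * B * c ^ 6) + 3 * (72 * B * c ^ 6) := by ring
      rw [this]
      exact dvd_add h6 (Dvd.intro _ rfl)

lemma dbl_D {A D a b c X c2 q : ℤ} (hq : Prime q) (hqD : q ∣ D) (hDsf : Squarefree D)
    (hAD : IsCoprime A D) (hq3 : ¬ q ∣ 3) (h : b ^ 2 = a ^ 3 + 27 * (A * D ^ 3) * c ^ 6)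
    (hbc : IsCoprime b c)
    (hX : X * (4 * b ^ 2 * c ^ 2) = c2 ^ 2 * (a * (a ^ 3 - 216 * (A * D ^ 3) * c ^ 6)))
    (hXc : IsCoprime X c2) : ¬ q ∣ X := by
  intro hqX
  have hqc2 : ¬ q ∣ c2 := fun h => hq.not_isUnit (hXc.isUnit_of_dvd' hqX h)
  have hqA : ¬ q ∣ A := fun h => hq.not_isUnit (hAD.isUnit_of_dvd' h hqD)
  obtain ⟨D', rfl⟩ := hqD
  have hq0 := hq.ne_zero
  by_cases hb : q ∣ b
  · have hqc : ¬ q ∣ c := fun h => hq.not_isUnit (hbc.isUnit_of_dvd' hb h)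
    have hqD' : ¬ q ∣ D' := by
      rintro ⟨D'', rfl⟩
      exact hq.not_isUnit (hDsf q ⟨D'', by ring⟩)
    have hqa : q ∣ a := by
      apply hq.dvd_of_dvd_pow (n := 3)
      have : a ^ 3 = b ^ 2 - q * (27 * (A * (q ^ 2 * D' ^ 3)) * c ^ 6) := by linear_combination -h
      rw [this]
      exact dvd_sub (dvd_pow hb two_ne_zero) (Dvd.intro _ rfl)
    obtain ⟨a', rfl⟩ := hqa
    obtain ⟨b1, rfl⟩ := hb
    have e1 : b1 ^ 2 = q * (a' ^ 3 + 27 * (A * D' ^ 3) * c ^ 6) := by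
      apply mul_left_cancel₀ (pow_ne_zero 2 hq0)
      linear_combination h
    obtain ⟨b2, rfl⟩ := dvd_of_sq hq e1
    have e2 : q * b2 ^ 2 = a' ^ 3 + 27 * (A * D' ^ 3) * c ^ 6 := by
      apply mul_left_cancel₀ hq0
      linear_combination e1
    have e3 : X * (4 * b2 ^ 2 * c ^ 2) = c2 ^ 2 * (a' * (a' ^ 3 - 216 * (A * D' ^ 3) * c ^ 6)) := by
      apply mul_left_cancel₀ (pow_ne_zero 4 hq0)
      linear_combination hX
    have hn : ∀ n : ℕ, ¬ q ∣ 3 ^ n * (A * D' ^ 3 * c ^ 6) := by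
      intro n h
      rcases hq.dvd_or_dvd h with h | h
      · exact not_dvd_pow hq hq3 n h
      rcases hq.dvd_or_dvd h with h | h
      · rcases hq.dvd_or_dvd h with h | h
        · exact hqA h
        · exact not_dvd_pow hq hqD' 3 h
      · exact not_dvd_pow hq hqc 6 h
    have h4 : q ∣ c2 ^ 2 * (a' * (a' ^ 3 - 216 * (A * D' ^ 3) * c ^ 6)) := by
      rw [← e3]; exact hqX.mul_right _
    rcases hq.dvd_or_dvd h4 with h5 | h5
    · exact not_dvd_pow hq hqc2 2 h5
    rcases hq.dvd_or_dvd h5 with h6 | h6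
    · apply hn 3
      have : 3 ^ 3 * (A * D' ^ 3 * c ^ 6) = q * b2 ^ 2 - a' ^ 3 := by linear_combination -e2
      rw [this]
      exact dvd_sub (Dvd.intro _ rfl) (dvd_pow h6 three_ne_zero)
    · apply hn 5
      have : 3 ^ 5 * (A * D' ^ 3 * c ^ 6) = q * b2 ^ 2 - (a' ^ 3 - 216 * (A * D' ^ 3) * c ^ 6) := by
        linear_combination -e2
      rw [this]
      exact dvd_sub (Dvd.intro _ rfl) h6
  · have hqa : ¬ q ∣ a := by
      intro hqa
      apply hb
      apply hq.dvd_of_dvd_pow (n := 2)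
      rw [h]
      exact dvd_add (dvd_pow hqa three_ne_zero) ⟨27 * (A * (q ^ 2 * D' ^ 3)) * c ^ 6, by ring⟩
    have h4 : q ∣ c2 ^ 2 * (a * (a ^ 3 - 216 * (A * (q * D') ^ 3) * c ^ 6)) := by
      rw [← hX]; exact hqX.mul_right _
    rcases hq.dvd_or_dvd h4 with h5 | h5
    · exact not_dvd_pow hq hqc2 2 h5
    rcases hq.dvd_or_dvd h5 with h6 | h6
    · exact hqa h6
    · apply not_dvd_pow hq hqa 3
      have : a ^ 3 = (a ^ 3 - 216 * (A * (q * D') ^ 3) * c ^ 6)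
        + q * (216 * (A * (q ^ 2 * D' ^ 3)) * c ^ 6) := by ring
      rw [this]
      exact dvd_add h6 (Dvd.intro _ rfl)

end
end MRank

namespace MRank
section
open NumberField UniqueFactorizationMonoid nonZeroDivisors

variable {K : Type*} [Field K] [NumberField K] {k0 : ℤ} (e : ℤ√k0 ≃+* 𝓞 K)

/-- A class group character whose values at almost all primes are given by the symbol of a point. -/
def Rep {l : ℤ} (D : ℤ) (Q : Pt l) (χ : ClassGroup (𝓞 K) →* Multiplicative (ZMod 3)) : Prop :=
  ∃ M : ℤ, M ≠ 0 ∧ ∀ P : (Ideal (𝓞 K))⁰,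
      (P : Ideal (𝓞 K)).IsPrime → ∀ p : ℕ, p.Prime → ¬ (p : ℤ) ∣ M →
      (p : 𝓞 K) ∈ (P : Ideal (𝓞 K)) → ∀ h : ℤ, ww e - h ∈ (P : Ideal (𝓞 K)) →
      χ (ClassGroup.mk0 P) = Multiplicative.ofAdd (symF D Q p h)

lemma rep_zero {l : ℤ} (D : ℤ) : Rep e D (0 : Pt l) 1 := by
  refine ⟨1, one_ne_zero, fun P _ p _ _ _ h _ => ?_⟩
  rw [symF_zero]; rfl

lemma dbl_coords {l : ℤ} {P : Pt l} {a b c a3 b3 c3 : ℤ} (hc : 0 < c) (hc3 : 0 < c3)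
    (hP : IsPt P (a / c ^ 2) (b / c ^ 3)) (hQ : IsPt (P + P) (a3 / c3 ^ 2) (b3 / c3 ^ 3))
    (h : b ^ 2 = a ^ 3 + l * c ^ 6) :
    a3 * (4 * b ^ 2 * c ^ 2) = c3 ^ 2 * (a * (a ^ 3 - 8 * l * c ^ 6)) := by
  obtain ⟨s, m, h1, -, -, h2, h3, -⟩ := vieta hP hP hQ
  have hc0 : (c : ℚ) ≠ 0 := by exact_mod_cast hc.ne'
  have hc30 : (c3 : ℚ) ≠ 0 := by exact_mod_cast hc3.ne'
  have h' : (b : ℚ) ^ 2 = a ^ 3 + l * c ^ 6 := by exact_mod_cast h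
  obtain ⟨x, hx⟩ : ∃ x : ℚ, x = a / c ^ 2 := ⟨_, rfl⟩
  obtain ⟨y, hy⟩ : ∃ y : ℚ, y = b / c ^ 3 := ⟨_, rfl⟩
  obtain ⟨z, hz⟩ : ∃ z : ℚ, z = a3 / c3 ^ 2 := ⟨_, rfl⟩
  rw [← hx, ← hz] at h2 h3
  rw [← hx, ← hy] at h1
  have ea : (a : ℚ) = x * c ^ 2 := by rw [hx]; field_simp
  have eb : (b : ℚ) = y * c ^ 3 := by rw [hy]; field_simp
  have ez : (a3 : ℚ) = z * c3 ^ 2 := by rw [hz]; field_simp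
  have hxy : y ^ 2 = x ^ 3 + l := by
    rw [ea, eb] at h'
    have : (c : ℚ) ^ 6 * (y ^ 2 - (x ^ 3 + l)) = 0 := by linear_combination h'
    have := (mul_eq_zero.1 this).resolve_left (pow_ne_zero _ hc0)
    linarith
  have ht : 3 * x ^ 2 = 2 * s * y := by
    linear_combination (-1) * h3 + 2 * s * h1 * (-1) + 2 * x * h2
  have hz4 : 4 * y ^ 2 * z = x ^ 4 - 8 * l * x := by
    linear_combination 4 * y ^ 2 * h2 - (3 * x ^ 2 + 2 * s * y) * ht - 8 * x * hxy
  have : (a3 : ℚ) * (4 * b ^ 2 * c ^ 2) = c3 ^ 2 * (a * (a ^ 3 - 8 * l * c ^ 6)) := by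
    rw [ea, eb, ez]
    linear_combination c3 ^ 2 * c ^ 8 * hz4
  exact_mod_cast this

theorem exists_rep {A D l : ℤ} (hk0 : k0 = -(A * D)) (hk3 : k0 % 3 = 2) (hl : l = -27 * (k0 * D ^ 2))
    (hB : (A * D ^ 3) % 9 = 1 ∨ (A * D ^ 3) % 9 = 7) (hD3 : ¬ (3 : ℤ) ∣ D) (hDsf : Squarefree D)
    (hAD : IsCoprime A D) (P : Pt l) : ∃ χ, Rep e D (P + P) χ := by
  by_cases hQ : P + P = 0
  · rw [hQ]; exact ⟨1, rep_zero e D⟩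
  have hP : P ≠ 0 := by rintro rfl; simp at hQ
  obtain ⟨a, b, c, hc, hPt, hac, hbc, h, -⟩ := symF_spec D hP
  obtain ⟨a3, b3, c3, hc3, hPt3, hac3, hbc3, h3, hs⟩ := symF_spec D hQ
  have hX := dbl_coords hc hc3 hPt hPt3 h
  have hl' : l = 27 * (A * D ^ 3) := by rw [hl, hk0]; ring
  rw [hl'] at h hX
  have hX' : a3 * (4 * b ^ 2 * c ^ 2) = c3 ^ 2 * (a * (a ^ 3 - 216 * (A * D ^ 3) * c ^ 6)) := by
    rw [hX]; ring
  have h3a : ¬ (3 : ℤ) ∣ a3 := dbl_three hB h hbc hX' hac3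
  have hD0 : D ≠ 0 := hDsf.ne_zero
  have haD : IsCoprime a3 D := by
    apply isCoprime_of_prime_dvd
    · rintro ⟨-, h0⟩; exact hD0 h0
    · intro q hq hqa hqD
      refine dbl_D hq hqD hDsf hAD ?_ h hbc hX' hac3 hqa
      intro hq3
      have := (hq.associated_of_dvd Int.prime_three hq3)
      exact hD3 (this.symm.dvd.trans hqD)
  have h3b : ¬ (3 : ℤ) ∣ b3 := by
    intro hb
    apply h3a
    apply Int.prime_three.dvd_of_dvd_pow (n := 3)
    have : a3 ^ 3 = b3 ^ 2 - 3 * (9 * (A * D ^ 3) * c3 ^ 6) := by rw [h3, hl']; ring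
    rw [this]
    exact dvd_sub (dvd_pow hb two_ne_zero) (Dvd.intro _ rfl)
  have hbD : IsCoprime b3 D := by
    apply (IsCoprime.pow_left_iff two_pos).1
    apply coprime_of_dvd_sub (b := a3 ^ 3) _ haD.pow_left
    refine ⟨27 * (A * D ^ 2) * c3 ^ 6, ?_⟩
    rw [h3, hl']; ring
  obtain ⟨χ, hχ⟩ := exists_char_abe e (a := a3) (b := b3) (ee := c3) (D := D) hk3 hc3.ne' hD3
    (by rw [h3, hl]; ring) h3b h3a (hbc3.pow_right.mul_right hbD)
  refine ⟨χ, 3 * a3, mul_ne_zero (by norm_num) (by rintro rfl; simp at h3a), ?_⟩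
  intro 𝔭 h𝔭 p hp hpM hmem h hw
  rw [hχ 𝔭 h𝔭 p hp hpM hmem h hw, hs]

lemma eq_span_of_inert {P : Ideal (𝓞 K)} (hP : P.IsPrime) {p : ℕ} (hp : p.Prime)
    (hpP : (p : 𝓞 K) ∈ P) (hn : ∀ h : ℤ, ww e - h ∉ P) : P = Ideal.span {(p : 𝓞 K)} := by
  apply le_antisymm
  · intro z hz
    obtain ⟨x, y, rfl⟩ := exists_xy e z
    have hy : (p : ℤ) ∣ y := by
      by_contra hy
      have hcop : IsCoprime y (p : ℤ) := ((Nat.prime_iff_prime_int.1 hp).coprime_iff_not_dvd.2 hy).symm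
      obtain ⟨u, v, huv⟩ := hcop
      apply hn (-(u * x))
      have huv' := congrArg (fun z : ℤ => (z : 𝓞 K)) huv
      push_cast at huv'
      have : ww e - ((-(u * x) : ℤ) : 𝓞 K) = u * (x + y * ww e) + (v * ww e) * p := by
        push_cast; linear_combination (-ww e) * huv'
      rw [this]
      exact add_mem (Ideal.mul_mem_left _ _ hz) (Ideal.mul_mem_left _ _ hpP)
    have hx : (p : ℤ) ∣ x := by
      rw [← int_mem_iff hP hp hpP]
      have : (x : 𝓞 K) = (x + y * ww e) - ww e * y := by ring
      rw [this]
      exact sub_mem hz (Ideal.mul_mem_left _ _ ((int_mem_iff hP hp hpP y).2 hy))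
    obtain ⟨x', rfl⟩ := hx
    obtain ⟨y', rfl⟩ := hy
    rw [Ideal.mem_span_singleton]
    exact ⟨x' + y' * ww e, by push_cast; ring⟩
  · rw [Ideal.span_singleton_le_iff_mem]; exact hpP

lemma rep_ext {M : ℤ} (hM : M ≠ 0) (χ χ' : ClassGroup (𝓞 K) →* Multiplicative (ZMod 3))
    (H : ∀ P : (Ideal (𝓞 K))⁰,
      (P : Ideal (𝓞 K)).IsPrime → ∀ p : ℕ, p.Prime → ¬ (p : ℤ) ∣ M →
      (p : 𝓞 K) ∈ (P : Ideal (𝓞 K)) → ∀ h : ℤ, ww e - h ∈ (P : Ideal (𝓞 K)) →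
      χ (ClassGroup.mk0 P) = χ' (ClassGroup.mk0 P)) : χ = χ' := by
  apply char_ext (M := (M : 𝓞 K)) (by exact_mod_cast hM)
  intro P hP hcop
  obtain ⟨p, hp, hpP⟩ := exists_prime_mem hP (nonZeroDivisors.coe_ne_zero P)
  have hpM : ¬ (p : ℤ) ∣ M := by
    rw [← int_mem_iff hP hp hpP]
    intro hm
    rw [Ideal.isCoprime_iff_sup_eq] at hcop
    apply hP.ne_top
    rw [← hcop, eq_comm, sup_eq_left, Ideal.span_singleton_le_iff_mem]
    exact hm
  by_cases hw : ∃ h : ℤ, ww e - h ∈ (P : Ideal (𝓞 K))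
  · obtain ⟨h, hw⟩ := hw
    exact H P hP p hp hpM hpP h hw
  · push Not at hw
    have hsp := eq_span_of_inert e hP hp hpP hw
    have : ClassGroup.mk0 P = 1 := by
      rw [ClassGroup.mk0_eq_one_iff, hsp]
      exact ⟨⟨(p : 𝓞 K), rfl⟩⟩
    rw [this, map_one, map_one]

lemma rep_add {D l : ℤ} (hl : l = -27 * (k0 * D ^ 2)) (hns : ¬ IsSquare (l : ℚ)) {P Q : Pt l}
    {χ χ' ψ : ClassGroup (𝓞 K) →* Multiplicative (ZMod 3)}
    (h1 : Rep e D P χ) (h2 : Rep e D Q χ') (h3 : Rep e D (P + Q) ψ) : ψ = χ * χ' := by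
  obtain ⟨M1, hM1, h1⟩ := h1
  obtain ⟨M2, hM2, h2⟩ := h2
  obtain ⟨M3, hM3, h3⟩ := h3
  obtain ⟨M4, hM4, h4⟩ := symF_add hl hns P Q
  apply rep_ext e (M := M1 * M2 * M3 * M4) (by positivity)
  intro 𝔭 h𝔭 p hp hpM hmem h hw
  have n1 : ¬ (p : ℤ) ∣ M1 := fun hd => hpM (hd.trans ⟨M2 * M3 * M4, by ring⟩)
  have n2 : ¬ (p : ℤ) ∣ M2 := fun hd => hpM (hd.trans ⟨M1 * M3 * M4, by ring⟩)
  have n3 : ¬ (p : ℤ) ∣ M3 := fun hd => hpM (hd.trans ⟨M1 * M2 * M4, by ring⟩)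
  have n4 : ¬ (p : ℤ) ∣ M4 := fun hd => hpM (hd.trans ⟨M1 * M2 * M3, by ring⟩)
  rw [MonoidHom.mul_apply, h1 𝔭 h𝔭 p hp n1 hmem h hw, h2 𝔭 h𝔭 p hp n2 hmem h hw,
    h3 𝔭 h𝔭 p hp n3 hmem h hw, h4 p hp n4 h ((int_mem_iff h𝔭 hp hmem _).1 (sq_sub_mem e hw)),
    ofAdd_add]

lemma exists_prime_w {p : ℕ} (hp : p.Prime) {h : ℤ} (hd : (p : ℤ) ∣ h ^ 2 - k0) :
    ∃ P : (Ideal (𝓞 K))⁰, (P : Ideal (𝓞 K)).IsPrime ∧ (p : 𝓞 K) ∈ (P : Ideal (𝓞 K)) ∧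
      ww e - h ∈ (P : Ideal (𝓞 K)) := by
  haveI : Fact p.Prime := ⟨hp⟩
  have hh : (h : ZMod p) * h = (k0 : ZMod p) := by
    have := (ZMod.intCast_zmod_eq_zero_iff_dvd (h ^ 2 - k0) p).2 hd
    push_cast at this
    linear_combination this
  let F : 𝓞 K →+* ZMod p := (Zsqrtd.lift ⟨(h : ZMod p), hh⟩).comp (e.symm : 𝓞 K →+* ℤ√k0)
  have hpF : (p : 𝓞 K) ∈ RingHom.ker F := by
    rw [RingHom.mem_ker, map_natCast]; simp
  have hne : RingHom.ker F ≠ ⊥ := by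
    intro h0
    rw [h0, Ideal.mem_bot] at hpF
    exact hp.ne_zero (by exact_mod_cast hpF)
  refine ⟨⟨RingHom.ker F, mem_nonZeroDivisors_of_ne_zero hne⟩, RingHom.ker_isPrime F, hpF, ?_⟩
  change ww e - h ∈ RingHom.ker F
  rw [RingHom.mem_ker, map_sub, map_intCast]
  simp [F, ww]

lemma rep_one_cubic {D l : ℤ} (hl : l = -27 * (k0 * D ^ 2)) (hl0 : ¬ IsSquare (l : ℚ)) (hk0 : k0 ≠ 0)
    (hD0 : D ≠ 0)
    {Q : Pt l} (hQ : Q ≠ 0) (h1 : Rep e D Q 1) : ∃ x y t : ℚ, IsPt Q x y ∧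
      t ^ 3 - 3 * x * t - 2 * y = 0 := by
  obtain ⟨M, hM, h1⟩ := h1
  obtain ⟨a, b, c, hc, hPt, hac, hbc, h, hs⟩ := symF_spec D hQ
  have hc0 : (c : ℚ) ≠ 0 := by exact_mod_cast hc.ne'
  have ha : a ≠ 0 := by
    rintro rfl
    have := x_ne_zero hl0 hPt
    simp at this
  obtain ⟨t, ht⟩ := cubic_root_of_cub_all (a := a) (b := b) (E := c ^ 3 * D) (k0 := k0) ha
    (mul_ne_zero (pow_ne_zero _ hc.ne') hD0) hk0 (by rw [h, hl]; ring) (B := M.natAbs)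
    (Int.natAbs_pos.2 hM) (by
      intro p hp hpM h hd
      obtain ⟨𝔭, h𝔭, hmem, hw⟩ := exists_prime_w e hp hd
      have := h1 𝔭 h𝔭 p hp (by rwa [Int.natCast_dvd]) hmem h hw
      rw [MonoidHom.one_apply, hs] at this
      exact (congrArg Multiplicative.toAdd this).symm)
  refine ⟨_, _, t / c, hPt, ?_⟩
  field_simp
  linear_combination ht

theorem selphi (e : ℤ√k0 ≃+* 𝓞 K) {A D k : ℤ} (hk0 : k0 = -(A * D)) (hk3 : k0 % 3 = 2) (hk : k = k0 * D ^ 2)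
    (hB : (A * D ^ 3) % 9 = 1 ∨ (A * D ^ 3) % 9 = 7) (hD3 : ¬ (3 : ℤ) ∣ D) (hDsf : Squarefree D)
    (hAD : IsCoprime A D) (hkn : ¬ IsSquare (k : ℚ)) (hln : ¬ IsSquare ((-27 * k : ℤ) : ℚ))
    {f : Pt k →+ Pt (-27 * k)} {g : Pt (-27 * k) →+ Pt k} (hf : IsIsog 1 f)
    (hfg : ∀ P, f (g P) = 3 • P) :
    f.range.index ≠ 0 ∧ f.range.index ≤ Nat.card {x : ClassGroup (𝓞 K) // x ^ 3 = 1} := by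
  have hl : -27 * k = -27 * (k0 * D ^ 2) := by rw [hk]
  have hk00 : k0 ≠ 0 := by omega
  have hkk : k ≠ 0 := by rw [hk]; exact mul_ne_zero hk00 (pow_ne_zero _ hDsf.ne_zero)
  choose X hX using exists_rep e hk0 hk3 hl hB hD3 hDsf hAD
  have hadd : ∀ P Q, X (P + Q) = X P * X Q := by
    intro P Q
    apply rep_add e hl hln (hX P) (hX Q)
    have : P + P + (Q + Q) = P + Q + (P + Q) := by abel
    rw [this]
    exact hX _
  let F : Pt (-27 * k) →+ Additive (ClassGroup (𝓞 K) →* Multiplicative (ZMod 3)) :=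
    AddMonoidHom.mk' (fun P => Additive.ofMul (X P)) (fun P Q => by rw [hadd]; rfl)
  obtain ⟨hfin, hcard⟩ := card_hom_three (ClassGroup (𝓞 K))
  refine selK_fin F f.range ?_ X (fun _ => rfl) Set.univ Set.finite_univ (fun _ => Set.mem_univ _)
    (by rw [Set.ncard_univ]; exact hcard)
  intro P hP
  have hP1 : X P = 1 := hP
  have hdbl : P + P ∈ f.range := by
    by_cases h0 : P + P = 0
    · rw [h0]; exact zero_mem _
    have hr := hX P
    rw [hP1] at hr
    obtain ⟨x, y, t, hPt, ht⟩ := rep_one_cubic e hl hln hk00 hDsf.ne_zero h0 hr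
    obtain ⟨R, hR⟩ := isog_surj (u := 1) one_ne_zero (by push_cast; ring) hkk hf hPt
      (t := t) (by linear_combination ht)
    exact ⟨R, hR⟩
  have h3 : f (g P) ∈ f.range := ⟨_, rfl⟩
  rw [hfg] at h3
  have : P = 3 • P - (P + P) := by abel
  rw [this]
  exact sub_mem h3 hdbl

theorem main_aux (e : ℤ√k0 ≃+* 𝓞 K) {A D : ℤ} (hk0 : k0 = -(A * D)) (hsf : Squarefree k0)
    (hk3 : k0 % 3 = 2) (hk4 : k0 % 4 = 3)
    (hB : (A * D ^ 3) % 9 = 1 ∨ (A * D ^ 3) % 9 = 7) (hD3 : ¬ (3 : ℤ) ∣ D) (hDsf : Squarefree D)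
    (hAD : IsCoprime A D) {d : ℕ} (hd : Nat.card {x : ClassGroup (𝓞 K) // x ^ 3 = 1} = 3 ^ d) :
    mordellRank (-(A * D ^ 3)) ≤ 1 + 2 * d := by
  obtain ⟨k, hk⟩ : ∃ k : ℤ, k = k0 * D ^ 2 := ⟨_, rfl⟩
  have hkA : -(A * D ^ 3) = k := by rw [hk, hk0]; ring
  rw [hkA]
  have hD0 : (D : ℚ) ≠ 0 := by exact_mod_cast hDsf.ne_zero
  have h3 : ¬ (3 : ℤ) ∣ k0 := by omega
  have hkn : ¬ IsSquare (k : ℚ) := by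
    rintro ⟨r, hr⟩
    have hr' : (1 : ℤ) * (r / D) ^ 2 = ((k0 : ℤ) : ℚ) := by
      rw [hk] at hr; push_cast at hr ⊢
      rw [div_pow]; field_simp; linarith
    obtain ⟨n, hn⟩ := rat_int_of_sqfree squarefree_one hr'
    rw [hn] at hr'
    apply k0_ne_sq hk4 n
    have : (1 : ℤ) * n ^ 2 = k0 := by exact_mod_cast hr'
    linarith
  have hln : ¬ IsSquare ((-27 * k : ℤ) : ℚ) := by
    rintro ⟨r, hr⟩
    apply not_sq_neg3 h3 (r := r / (3 * D))
    rw [hk] at hr; push_cast at hr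
    rw [div_pow]; field_simp; linarith
  have hkk : k ≠ 0 := by rintro rfl; exact hkn ⟨0, by simp⟩
  obtain ⟨f, hf⟩ := exists_isog (k := k) (l := -27 * k) (u := 1) one_ne_zero (by push_cast; ring) hkn
  obtain ⟨g, hg⟩ := exists_isog (k := -27 * k) (l := k) (u := 3) (by norm_num) (by push_cast; ring) hln
  have hgf : ∀ P, g (f P) = 3 • P :=
    isog_comp (by norm_num) (by push_cast; ring) hkn hln hf hg
  have hfg : ∀ P, f (g P) = 3 • P :=
    isog_comp (by norm_num) (by push_cast; ring) hln hkn hg hf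
  obtain ⟨g0, g1⟩ := selK e h3 (D := D) ⟨-A, by rw [hk0]; ring⟩ hDsf.ne_zero hk hkn hg
  obtain ⟨f0, f1⟩ := selphi e hk0 hk3 hk hB hD3 hDsf hAD hkn hln hf hfg
  rw [hd] at g1 f1
  have := rank_bound hkk f g hgf (a := 1 + d) (b := d) g0 (by rw [pow_add, pow_one]; exact g1) f0 f1
  omega

end
end MRank

/-- For a negative square-free `A ≡ 1` or `25 (mod 36)` and a square-free `D ≡ 1 (mod 12)`
coprime to `A`, the rank of `E_D : y² = x³ - A·D³` over `ℚ` is at most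
`1 + 2·dim_{𝔽₃} Cl(ℚ(√(-A·D)))[3]`; the `𝔽₃`-dimension `d` of the elementary abelian
`3`-group `Cl(ℚ(√(-A·D)))[3]` is recorded by the hypothesis that this group has `3 ^ d`
elements. -/
theorem rank_le_one_add_two_mul_three_torsion_dim_of_neg
    (A : ℤ) (hAneg : A < 0) (hAsf : Squarefree A)
    (hAmod : A % 36 = 1 ∨ A % 36 = 25)
    (D : ℤ) (hDsf : Squarefree D) (hDmod : D % 12 = 1) (hcop : IsCoprime A D)
    (c : ℂ) (hc : c ^ 2 = ((-(A * D) : ℤ) : ℂ)) (d : ℕ)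
    (hd : Nat.card {x : ClassGroup (NumberField.RingOfIntegers ℚ⟮c⟯) // x ^ 3 = 1} = 3 ^ d) :
    mordellRank (-(A * D ^ 3)) ≤ 1 + 2 * d := by
  have hm4 : (-(A * D)) % 4 = 3 := by
    have h1 : A % 4 = 1 := by omega
    have h2 : D % 4 = 1 := by omega
    have : (A * D) % 4 = 1 := by rw [Int.mul_emod, h1, h2]; rfl
    omega
  have hm3 : (-(A * D)) % 3 = 2 := by
    have h1 : A % 3 = 1 := by omega
    have h2 : D % 3 = 1 := by omega
    have : (A * D) % 3 = 1 := by rw [Int.mul_emod, h1, h2]; rfl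
    omega
  have hB : (A * D ^ 3) % 9 = 1 ∨ (A * D ^ 3) % 9 = 7 := by
    have h3 : D ^ 3 % 9 = 1 := by
      have : D % 9 = 1 ∨ D % 9 = 4 ∨ D % 9 = 7 := by omega
      rw [pow_succ, pow_two, Int.mul_emod, Int.mul_emod D D]
      rcases this with h | h | h <;> rw [h] <;> rfl
    rw [Int.mul_emod, h3]
    have : A % 9 = 1 ∨ A % 9 = 7 := by omega
    omega
  have hsf : Squarefree (-(A * D)) := by
    rw [← neg_one_mul]
    have : Squarefree (A * D) := (squarefree_mul_iff).2 ⟨hcop.isRelPrime, hAsf, hDsf⟩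
    rw [neg_one_mul]
    exact this.squarefree_of_dvd (neg_dvd.2 dvd_rfl)
  obtain ⟨e⟩ := MRank.exists_equiv hsf hm4 c hc
  have hInteg : IsIntegral ℚ c := by
    refine ⟨Polynomial.X ^ 2 - Polynomial.C ((-(A * D) : ℤ) : ℚ),
      Polynomial.monic_X_pow_sub_C _ two_ne_zero, ?_⟩
    rw [Polynomial.eval₂_sub, Polynomial.eval₂_X_pow, Polynomial.eval₂_C, hc, map_intCast, sub_self]
  haveI : FiniteDimensional ℚ ℚ⟮c⟯ := IntermediateField.adjoin.finiteDimensional hInteg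
  haveI : NumberField ℚ⟮c⟯ := { to_charZero := inferInstance, to_finiteDimensional := inferInstance }
  exact MRank.main_aux e rfl hsf hm3 hm4 hB (by omega) hDsf hcop hd
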